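/- Let (A◊, φ◊, a◊₃) be a data set on H obeying KW (i)–(iii) with ∫_H (1+t²)|𝔛◊|² < ∞, let T ∈ (0, ∞], let s ↦ g|_s, s ∈ [0, T), be a flow for (A◊, φ◊, a◊₃), and let (A|_s, φ|_s, a₃|_s) be the associated data sets. Then for every open set Ω ⊂ H with compact closure in H there exist a sequence s_k → T in [0, T) and smooth maps h_k : Ω → SU(2) such that the gauge-transformed data sets with components h_k (A|_{s_k})_i h_k^{−1} − (∂_i h_k) h_k^{−1}, h_k φ|_{s_k} h_k^{−1}, h_k a₃|_{s_k} h_k^{−1} converge in the C^∞ topology on Ω to a data set (A, φ, a₃) that obeys KW (i)–(iii) on Ω and whose 𝔛 satisfies |𝔛| = e^{−T}|𝔛◊| pointwise on Ω (with e^{−T} = 0 when T = ∞). -/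

import Mathlib

open MeasureTheory Matrix Filter Set
open scoped ENNReal NNReal Topology

noncomputable section

attribute [local instance] Matrix.normedAddCommGroup Matrix.normedSpace

/-- Points of `(0,∞) × ℝ²` live in `ℝ × ℝ × ℝ` with coordinates `(t, z₁, z₂)`. -/
abbrev P3 := ℝ × ℝ × ℝ

/-- 2×2 complex matrices. -/
abbrev M2 := Matrix (Fin 2) (Fin 2) ℂ

/-- The open half-space `H = (0,∞) × ℝ²`. -/
def Hsp : Set P3 := {p | 0 < p.1}

/-- The half-space minus the locus `z = 0`. -/
def Hstar : Set P3 := {p | 0 < p.1 ∧ p.2 ≠ 0}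

/-- The coordinate directions. -/
def et : P3 := (1, 0, 0)
def ez1 : P3 := (0, 1, 0)
def ez2 : P3 := (0, 0, 1)

/-- Commutator of matrices. -/
def mcomm (X Y : M2) : M2 := X * Y - Y * X

/-- `η* = -η†`, minus the conjugate transpose. -/
def mstar (X : M2) : M2 := -Xᴴ

/-- The norm `|M| = ((1/2) trace (M M†))^{1/2}`. -/
noncomputable def mnorm (X : M2) : ℝ := Real.sqrt ((Matrix.trace (X * Xᴴ)).re / 2)

/-- `⟨στ⟩ = -(1/2) trace (στ)`. -/
noncomputable def minner (X Y : M2) : ℂ := -(2:ℂ)⁻¹ * Matrix.trace (X * Y)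

/-- The real inner product of su(2)-valued matrices. -/
noncomputable def ipR (X Y : M2) : ℝ := (minner X Y).re

/-- Membership in su(2): traceless and anti-Hermitian. -/
def IsSU2 (X : M2) : Prop := Matrix.trace X = 0 ∧ Xᴴ = -X

/-- `|z|` for a point of the half-space. -/
noncomputable def znorm (p : P3) : ℝ := Real.sqrt (p.2.1^2 + p.2.2^2)

/-- `z = z₁ + i z₂` as a complex number. -/
noncomputable def zc (p : P3) : ℂ := (p.2.1 : ℂ) + Complex.I * (p.2.2 : ℂ)

/-- Euclidean distance on `ℝ³`. -/
noncomputable def dist3 (p q : P3) : ℝ :=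
  Real.sqrt ((p.1 - q.1)^2 + (p.2.1 - q.2.1)^2 + (p.2.2 - q.2.2)^2)

/-- Directional derivative of a matrix-valued function. -/
noncomputable def pd (v : P3) (f : P3 → M2) (p : P3) : M2 := fderiv ℝ f p v

/-- Directional derivative of a real-valued function. -/
noncomputable def pdR (v : P3) (f : P3 → ℝ) (p : P3) : ℝ := fderiv ℝ f p v

/-- The flat Laplacian `∂_t² + ∂_{z₁}² + ∂_{z₂}²` on real functions. -/
noncomputable def lap3 (f : P3 → ℝ) (p : P3) : ℝ :=
  pdR et (fun q => pdR et f q) p + pdR ez1 (fun q => pdR ez1 f q) p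
    + pdR ez2 (fun q => pdR ez2 f q) p

/-- Covariant derivative `∇_A f = ∂_v f + [A, f]` in direction `v`. -/
noncomputable def cd (A : P3 → M2) (v : P3) (f : P3 → M2) : P3 → M2 :=
  fun p => pd v f p + mcomm (A p) (f p)

/-- `a₁ = (1/2)(φ + φ*)`. -/
noncomputable def a1Of (phi : P3 → M2) (p : P3) : M2 := (2:ℂ)⁻¹ • (phi p + mstar (phi p))

/-- `a₂ = (i/2)(φ - φ*)`. -/
noncomputable def a2Of (phi : P3 → M2) (p : P3) : M2 :=
  (Complex.I * (2:ℂ)⁻¹) • (phi p - mstar (phi p))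

/-- Curvature component `E_{A_1} = ∂_t A₁ - ∂_{z₁} A_t + [A_t, A₁]`. -/
noncomputable def EA1Of (At A1 : P3 → M2) (p : P3) : M2 :=
  pd et A1 p - pd ez1 At p + mcomm (At p) (A1 p)

/-- Curvature component `E_{A_2} = ∂_t A₂ - ∂_{z₂} A_t + [A_t, A₂]`. -/
noncomputable def EA2Of (At A2 : P3 → M2) (p : P3) : M2 :=
  pd et A2 p - pd ez2 At p + mcomm (At p) (A2 p)

/-- Curvature component `B_{A_3} = ∂_{z₁} A₂ - ∂_{z₂} A₁ + [A₁, A₂]`. -/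
noncomputable def B3Of (A1 A2 : P3 → M2) (p : P3) : M2 :=
  pd ez1 A2 p - pd ez2 A1 p + mcomm (A1 p) (A2 p)

/-- `𝔛 = ∇_{A_t} a₃ - B_{A_3} - (i/2)[φ, φ*]`. -/
noncomputable def XOf (At A1 A2 a3 phi : P3 → M2) (p : P3) : M2 :=
  cd At et a3 p - B3Of A1 A2 p - (Complex.I * (2:ℂ)⁻¹) • mcomm (phi p) (mstar (phi p))

/-- The Kapustin-Witten equations (i), (ii), (iii) at a point. -/
def KW123At (At A1 A2 a3 phi : P3 → M2) (p : P3) : Prop :=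
  EA1Of At A1 p = cd A2 ez2 a3 p ∧
  EA2Of At A2 p = -(cd A1 ez1 a3 p) ∧
  cd A1 ez1 phi p + Complex.I • cd A2 ez2 phi p = 0 ∧
  cd At et phi p = Complex.I • mcomm (a3 p) (phi p)

/-- The Kapustin-Witten equation (iv) at a point. -/
def KW4At (At A1 A2 a3 phi : P3 → M2) (p : P3) : Prop :=
  cd At et a3 p = B3Of A1 A2 p + (Complex.I * (2:ℂ)⁻¹) • mcomm (phi p) (mstar (phi p))

/-- The operator `Δ_{(A,a)} u = -(∇²_t + ∇²₁ + ∇²₂) u + Σ_a [a_a, [u, a_a]]`. -/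
noncomputable def lapOf (At A1 A2 a3 phi u : P3 → M2) (p : P3) : M2 :=
  -(cd At et (cd At et u) p + cd A1 ez1 (cd A1 ez1 u) p + cd A2 ez2 (cd A2 ez2 u) p)
  + mcomm (a1Of phi p) (mcomm (u p) (a1Of phi p))
  + mcomm (a2Of phi p) (mcomm (u p) (a2Of phi p))
  + mcomm (a3 p) (mcomm (u p) (a3 p))

/-- An ℝ-invariant data set on an open set `U ⊆ H`: smooth su(2)-valued connection
components `A_t, A₁, A₂`, an su(2)-valued `a₃` and an sl(2,ℂ)-valued `φ`. -/
structure DataSet (U : Set P3) where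
  At : P3 → M2
  A1 : P3 → M2
  A2 : P3 → M2
  a3 : P3 → M2
  phi : P3 → M2
  smooth_At : ContDiffOn ℝ (⊤:ℕ∞) At U
  smooth_A1 : ContDiffOn ℝ (⊤:ℕ∞) A1 U
  smooth_A2 : ContDiffOn ℝ (⊤:ℕ∞) A2 U
  smooth_a3 : ContDiffOn ℝ (⊤:ℕ∞) a3 U
  smooth_phi : ContDiffOn ℝ (⊤:ℕ∞) phi U
  su2_At : ∀ p ∈ U, IsSU2 (At p)
  su2_A1 : ∀ p ∈ U, IsSU2 (A1 p)
  su2_A2 : ∀ p ∈ U, IsSU2 (A2 p)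
  su2_a3 : ∀ p ∈ U, IsSU2 (a3 p)
  sl2_phi : ∀ p ∈ U, Matrix.trace (phi p) = 0

namespace DataSet

variable {U : Set P3} (D : DataSet U)

noncomputable def a1 : P3 → M2 := a1Of D.phi
noncomputable def a2 : P3 → M2 := a2Of D.phi
noncomputable def X : P3 → M2 := XOf D.At D.A1 D.A2 D.a3 D.phi
noncomputable def lap (u : P3 → M2) : P3 → M2 := lapOf D.At D.A1 D.A2 D.a3 D.phi u

end DataSet

/-- The Kapustin-Witten equations (i)-(iii) on `U`. -/
def KW123 (U : Set P3) (D : DataSet U) : Prop :=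
  ∀ p ∈ U, KW123At D.At D.A1 D.A2 D.a3 D.phi p

/-- The Kapustin-Witten equation (iv) on `U`. -/
def KW4 (U : Set P3) (D : DataSet U) : Prop :=
  ∀ p ∈ U, KW4At D.At D.A1 D.A2 D.a3 D.phi p

/-- `|∇_A f|² = Σ_{i ∈ {t,1,2}} |∇_{A_i} f|²`. -/
noncomputable def covGradSqOf (At A1 A2 : P3 → M2) (f : P3 → M2) (p : P3) : ℝ :=
  (mnorm (cd At et f p))^2 + (mnorm (cd A1 ez1 f p))^2 + (mnorm (cd A2 ez2 f p))^2

/-- `|B_{A_3}|² + |E_{A_1}|² + |E_{A_2}|²`. -/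
noncomputable def curvSqOf (At A1 A2 : P3 → M2) (p : P3) : ℝ :=
  (mnorm (B3Of A1 A2 p))^2 + (mnorm (EA1Of At A1 p))^2 + (mnorm (EA2Of At A2 p))^2

/-- `|a| = (|a₁|² + |a₂|² + |a₃|²)^{1/2}`. -/
noncomputable def anormOf (a1 a2 a3 : P3 → M2) (p : P3) : ℝ :=
  Real.sqrt ((mnorm (a1 p))^2 + (mnorm (a2 p))^2 + (mnorm (a3 p))^2)

/-- `σ₁ = i·(first Pauli matrix)` and its siblings: a basis of su(2) with
`σ_a² = -𝕀`, `σ₁σ₂ = -σ₃`, `σ₂σ₃ = -σ₁`, `σ₃σ₁ = -σ₂`. -/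
def s1 : M2 := !![0, Complex.I; Complex.I, 0]
def s2 : M2 := !![0, 1; -1, 0]
def s3 : M2 := !![Complex.I, 0; 0, -Complex.I]

/-- `Θ = arcsinh(t/|z|)`. -/
noncomputable def Th (p : P3) : ℝ := Real.arsinh (p.1 / znorm p)

/-- The function `α_m`. -/
noncomputable def alphaM (m : ℕ) (p : P3) : ℝ :=
  -(1/(2*p.1)) * (((m:ℝ)+1) * Real.sinh (Th p) / Real.sinh (((m:ℝ)+1) * Th p))
    * (Real.cosh (((m:ℝ)+1) * Th p) / Real.cosh (Th p))

/-- The function `f_m`. -/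
noncomputable def fM (m : ℕ) (p : P3) : ℝ :=
  1 - (Real.sinh (Th p) * Real.cosh (((m:ℝ)+1) * Th p))
      / (Real.cosh (Th p) * Real.sinh (((m:ℝ)+1) * Th p))

/-- Model data: `A_t^{(m)} = 0`. -/
noncomputable def modelAt (_m : ℕ) : P3 → M2 := fun _ => 0

/-- Model data: `A₁^{(m)}`. -/
noncomputable def modelA1 (m : ℕ) (p : P3) : M2 :=
  ((-((((m:ℝ)+1))/2) * fM m p * (p.2.2 / (znorm p)^2) : ℝ) : ℂ) • s3

/-- Model data: `A₂^{(m)}`. -/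
noncomputable def modelA2 (m : ℕ) (p : P3) : M2 :=
  ((((((m:ℝ)+1))/2) * fM m p * (p.2.1 / (znorm p)^2) : ℝ) : ℂ) • s3

/-- Model data: `a₃^{(m)} = α_m σ₃`. -/
noncomputable def modela3 (m : ℕ) (p : P3) : M2 := ((alphaM m p : ℝ) : ℂ) • s3

/-- Model data: `φ^{(m)}`. -/
noncomputable def modelPhi (m : ℕ) (p : P3) : M2 :=
  (-(((2*p.1 : ℝ) : ℂ))⁻¹
    * (((((m:ℝ)+1) * Real.sinh (Th p) / Real.sinh (((m:ℝ)+1) * Th p)) : ℝ) : ℂ)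
    * (zc p / ((znorm p : ℝ) : ℂ))^m) • (s1 - Complex.I • s2)

/-- A smooth SU(2)-valued map on `U`. -/
def SU2Map (h : P3 → M2) (U : Set P3) : Prop :=
  ContDiffOn ℝ (⊤:ℕ∞) h U ∧ ∀ p ∈ U, (h p)ᴴ * h p = 1 ∧ (h p).det = 1

/-- Gauge action on a connection component: `A ↦ h A h⁻¹ - (∂_v h) h⁻¹`. -/
noncomputable def gAct (h : P3 → M2) (v : P3) (A : P3 → M2) (p : P3) : M2 :=
  h p * A p * (h p)⁻¹ - pd v h p * (h p)⁻¹

/-- Pointwise norm of the difference between the `h`-gauge transform of a data set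
and the model data set labelled by `m` (summing all six components). -/
noncomputable def gaugeDiff (h : P3 → M2) {U : Set P3} (D : DataSet U) (m : ℕ) (p : P3) : ℝ :=
  mnorm (gAct h et D.At p - modelAt m p) + mnorm (gAct h ez1 D.A1 p - modelA1 m p)
  + mnorm (gAct h ez2 D.A2 p - modelA2 m p)
  + mnorm (h p * D.a1 p * (h p)⁻¹ - a1Of (modelPhi m) p)
  + mnorm (h p * D.a2 p * (h p)⁻¹ - a2Of (modelPhi m) p)
  + mnorm (h p * D.a3 p * (h p)⁻¹ - modela3 m p)

/-- The asymptotic description (1.10) for the pair `(m, np)`:  gauge-asymptotic to the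
model `m + 2np` as `t → 0`, to the model `m` as `t → ∞` (with convergence of
`ln(|φ|/|φ^{(m)}|)`), and to the model `0` as `|z|/t → ∞` (via an `SU(2)/{±1}`-valued
gauge transformation, encoded by local smooth lifts). -/
def Described110 (D : DataSet Hsp) (m np : ℕ) : Prop :=
  ∃ g0 gi : P3 → M2, ∃ dgt : P3 → ℝ,
    SU2Map g0 (Hsp ∩ {q | q.1 < 1}) ∧
    SU2Map gi (Hsp ∩ {q | 1 < q.1}) ∧
    (∀ ε > (0:ℝ), ∃ δ : ℝ, 0 < δ ∧ δ ≤ 1 ∧ ∀ q ∈ Hsp, q.1 < δ →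
        q.1 * gaugeDiff g0 D (m + 2*np) q < ε) ∧
    (∀ ε > (0:ℝ), ∃ K : ℝ, 1 ≤ K ∧ ∀ q ∈ Hsp, K < q.1 →
        q.1 * gaugeDiff gi D m q
          + |Real.log (mnorm (D.phi q) / mnorm (modelPhi m q))| < ε) ∧
    (∀ q ∈ Hsp, q.1 < znorm q →
        ∃ V : Set P3, IsOpen V ∧ q ∈ V ∧ ∃ h : P3 → M2, SU2Map h (V ∩ Hsp) ∧
          ∀ q' ∈ V ∩ Hsp, q'.1 < znorm q' → dgt q' = gaugeDiff h D 0 q') ∧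
    (∀ ε > (0:ℝ), ∃ K : ℝ, 0 < K ∧ ∀ q ∈ Hsp, K * q.1 < znorm q → q.1 * dgt q < ε)

/-- Gauge equivalence of two data sets on `H` by a smooth SU(2)-valued map. -/
def GaugeEquiv (D D' : DataSet Hsp) : Prop :=
  ∃ h : P3 → M2, SU2Map h Hsp ∧ ∀ p ∈ Hsp,
    D'.At p = gAct h et D.At p ∧ D'.A1 p = gAct h ez1 D.A1 p ∧
    D'.A2 p = gAct h ez2 D.A2 p ∧
    D'.phi p = h p * D.phi p * (h p)⁻¹ ∧ D'.a3 p = h p * D.a3 p * (h p)⁻¹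

/-- Condition (1.9). -/
def Obeys19 (D : DataSet Hsp) : Prop :=
  (∃ C : ℝ, ∀ p ∈ Hsp, p.1 * anormOf D.a1 D.a2 D.a3 p ≤ C) ∧
  (∃ t0 > (0:ℝ), ∃ ε > (0:ℝ), ∃ r > (0:ℝ), ∀ p ∈ Hsp,
      p.1 < t0 → r * p.1 ≤ znorm p → ε < p.1 * anormOf D.a1 D.a2 D.a3 p) ∧
  (∃ C > (0:ℝ), ∀ R > (0:ℝ),
      (∫⁻ p in Hsp ∩ {q | R < znorm q}, ENNReal.ofReal (curvSqOf D.At D.A1 D.A2 p))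
        ≤ ENNReal.ofReal (C / R))

/-- `|f| → 0` as `t → 0` and as `t → ∞` (uniformly in `z`) and as `t/|z| → 0`. -/
def UAsymp (f : P3 → M2) : Prop :=
  (∀ ε > (0:ℝ), ∃ δ > (0:ℝ), ∀ p ∈ Hsp, p.1 < δ → mnorm (f p) < ε) ∧
  (∀ ε > (0:ℝ), ∃ K : ℝ, ∀ p ∈ Hsp, K < p.1 → mnorm (f p) < ε) ∧
  (∀ ε > (0:ℝ), ∃ δ > (0:ℝ), ∀ p ∈ Hsp, p.1 < δ * znorm p → mnorm (f p) < ε)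

/-- The parameter domain `[0, T)` of a flow. -/
def flowDom (T : ℝ≥0∞) : Set ℝ := {s : ℝ | 0 ≤ s ∧ ENNReal.ofReal s < T}

/-- A flow for the base data set `D` on `[0, T)`:  a smooth family `s ↦ g|_s` of
`SL(2,ℂ)`-valued maps with `g|₀ ≡ 𝕀` such that `u|_s = -i(∂_s g)g⁻¹` is su(2)-valued,
the associated data sets `Ds s` are obtained from `g|_s` by the complex gauge action,
`Δ_{(A|_s,a|_s)} u|_s = 𝔛|_s`, and `|u|_s|` decays as `t → 0`, `t → ∞`, `t/|z| → 0`. -/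
structure KWFlow (D : DataSet Hsp) (T : ℝ≥0∞) where
  g : ℝ → P3 → M2
  Ds : ℝ → DataSet Hsp
  u : ℝ → P3 → M2
  smooth_g : ContDiffOn ℝ (⊤:ℕ∞) (fun q : ℝ × P3 => g q.1 q.2) (flowDom T ×ˢ Hsp)
  g_zero : ∀ p ∈ Hsp, g 0 p = 1
  det_g : ∀ s ∈ flowDom T, ∀ p ∈ Hsp, (g s p).det = 1
  u_def : ∀ s ∈ flowDom T, ∀ p ∈ Hsp,
    u s p = (-Complex.I) • (deriv (fun s' => g s' p) s * (g s p)⁻¹)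
  su2_u : ∀ s ∈ flowDom T, ∀ p ∈ Hsp, IsSU2 (u s p)
  eq_t : ∀ s ∈ flowDom T, ∀ p ∈ Hsp,
    ((Ds s).At p - D.At p) - Complex.I • ((Ds s).a3 p - D.a3 p)
      = -(cd D.At et (g s) p * (g s p)⁻¹) + Complex.I • (mcomm (D.a3 p) (g s p) * (g s p)⁻¹)
  eq_z : ∀ s ∈ flowDom T, ∀ p ∈ Hsp,
    ((Ds s).A1 p - D.A1 p) + Complex.I • ((Ds s).A2 p - D.A2 p)
      = -((cd D.A1 ez1 (g s) p + Complex.I • cd D.A2 ez2 (g s) p) * (g s p)⁻¹)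
  eq_phi : ∀ s ∈ flowDom T, ∀ p ∈ Hsp, (Ds s).phi p = g s p * D.phi p * (g s p)⁻¹
  lap_eq : ∀ s ∈ flowDom T, ∀ p ∈ Hsp, (Ds s).lap (u s) p = (Ds s).X p
  asymp_u : ∀ s ∈ flowDom T, UAsymp (u s)

/-- `|∇_{A} a|²`, summing over all three covariant derivatives of all of `a₁,a₂,a₃`. -/
noncomputable def covaNormSq {U : Set P3} (D : DataSet U) (p : P3) : ℝ :=
  covGradSqOf D.At D.A1 D.A2 D.a1 p + covGradSqOf D.At D.A1 D.A2 D.a2 p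
    + covGradSqOf D.At D.A1 D.A2 D.a3 p

/-- `|a|² = Σ_a |a_a|²`. -/
noncomputable def anormSq {U : Set P3} (D : DataSet U) (p : P3) : ℝ :=
  (mnorm (D.a1 p))^2 + (mnorm (D.a2 p))^2 + (mnorm (D.a3 p))^2

/-- The function `q ↦ μ_q`: the largest `μ ∈ (0, min(1/t_q, 1/100)]` such that
`μ² t_q² (|B| + |E₁| + |E₂| + |∇_A a| + |a|²) ≤ 1` on the ball of radius `t_q/4`
centered at `q`. -/
noncomputable def mu (D : DataSet Hsp) (q : P3) : ℝ :=
  sSup {μ : ℝ | 0 < μ ∧ μ ≤ min (1/q.1) (1/100) ∧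
    ∀ p, dist3 p q < q.1/4 →
      μ^2 * q.1^2 * (mnorm (B3Of D.A1 D.A2 p) + mnorm (EA1Of D.At D.A1 p)
        + mnorm (EA2Of D.At D.A2 p) + Real.sqrt (covaNormSq D p) + anormSq D p) ≤ 1}

/-- The Dirichlet Green's function of the half-space Laplacian with pole at `q`. -/
noncomputable def Gf (q p : P3) : ℝ :=
  (4*Real.pi)⁻¹ * (Real.sqrt ((p.1 - q.1)^2 + (p.2.1 - q.2.1)^2 + (p.2.2 - q.2.2)^2))⁻¹
  - (4*Real.pi)⁻¹ * (Real.sqrt ((p.1 + q.1)^2 + (p.2.1 - q.2.1)^2 + (p.2.2 - q.2.2)^2))⁻¹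

/-- A family `g : [0,T) → (maps on H)` extends smoothly to the closed interval `[0,T]`;
when `T = ∞` this is in the reparametrized sense `r = 1 - e^{-s}`. -/
def ExtendsToClosed (T : ℝ≥0∞) (g : ℝ → P3 → M2) : Prop :=
  (T ≠ ⊤ → ∃ G : ℝ → P3 → M2,
     ContDiffOn ℝ (⊤:ℕ∞) (fun q : ℝ × P3 => G q.1 q.2) (Set.Icc 0 T.toReal ×ˢ Hsp) ∧
     ∀ s ∈ Set.Ico (0:ℝ) T.toReal, ∀ p ∈ Hsp, G s p = g s p) ∧
  (T = ⊤ → ∃ G : ℝ → P3 → M2,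
     ContDiffOn ℝ (⊤:ℕ∞) (fun q : ℝ × P3 => G q.1 q.2) (Set.Icc (0:ℝ) 1 ×ˢ Hsp) ∧
     ∀ r ∈ Set.Ico (0:ℝ) 1, ∀ p ∈ Hsp, G r p = g (-Real.log (1 - r)) p)

/-- A family `g : [0,∞) → (maps on H)` extends smoothly (in the reparametrized sense
`r = 1 - e^{-s}`) to `s = ∞` with limit `gi`. -/
def ExtendsToLimit (g : ℝ → P3 → M2) (gi : P3 → M2) : Prop :=
  ∃ G : ℝ → P3 → M2,
    ContDiffOn ℝ (⊤:ℕ∞) (fun q : ℝ × P3 => G q.1 q.2) (Set.Icc (0:ℝ) 1 ×ˢ Hsp) ∧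
    (∀ r ∈ Set.Ico (0:ℝ) 1, ∀ p ∈ Hsp, G r p = g (-Real.log (1 - r)) p) ∧
    (∀ p ∈ Hsp, G 1 p = gi p)

/-- `∫_H (1+t²)|𝔛|²` for a data set on `H`. -/
noncomputable def XnormSqInt (D : DataSet Hsp) : ℝ≥0∞ :=
  ∫⁻ p in Hsp, ENNReal.ofReal ((1 + p.1^2) * (mnorm (D.X p))^2)

/-- Convergence in the C^∞ topology on an open set `Ω`: all iterated derivatives
converge uniformly on every compact subset of `Ω`. -/
def CinftyTendsTo (Ω : Set P3) (f : ℕ → P3 → M2) (g : P3 → M2) : Prop :=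
  ∀ K : Set P3, K ⊆ Ω → IsCompact K → ∀ n : ℕ,
    Filter.Tendsto
      (fun k => sSup ((fun p => ‖iteratedFDeriv ℝ n (fun q => f k q - g q) p‖) '' K))
      Filter.atTop (nhds (0:ℝ))

/-- The hypotheses of Proposition 6.1 for a base data set `D` with constants `M, t0`. -/
def Prop61Hyp (D : DataSet Hsp) (M t0 : ℝ) : Prop :=
  KW123 Hsp D ∧
  XnormSqInt D < ⊤ ∧
  (∃ m np : ℕ, 1 ≤ np ∧ Described110 D m np) ∧
  (∃ μ0 > (0:ℝ), ∀ q ∈ Hsp, μ0 ≤ mu D q) ∧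
  0 < M ∧
  (∀ R > (1:ℝ),
    (∫⁻ p in Hsp ∩ {q | R < znorm q},
        ENNReal.ofReal (curvSqOf D.At D.A1 D.A2 p)) ≤ ENNReal.ofReal (M/R) ∧
    (∫⁻ p in Hsp ∩ {q | R < znorm q},
        ENNReal.ofReal ((mnorm (D.X p))^2)) ≤ ENNReal.ofReal (M/R)) ∧
  (0 < t0 ∧ t0 ≤ 1) ∧
  (∃ C : ℝ, ∀ t ∈ Set.Ioc (0:ℝ) t0,
      (∫⁻ z : ℝ × ℝ, ENNReal.ofReal ((mnorm (D.X (t, z)))^2)) ≤ ENNReal.ofReal C) ∧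
  (∀ t ∈ Set.Ioc (0:ℝ) t0, ∀ R > (1:ℝ),
      (∫⁻ z in {z : ℝ × ℝ | R < Real.sqrt (z.1^2 + z.2^2)},
          ENNReal.ofReal ((mnorm (D.X (t, z)))^2)) ≤ ENNReal.ofReal (M/R))


/-! ### Interior gradient estimate for the flat Laplacian -/

section GradientEstimate

variable {E : Type*} [NormedAddCommGroup E] [NormedSpace ℝ E]

/-- The flat Laplacian of a vector-valued function. -/
def lapE (f : P3 → E) (p : P3) : E :=
  fderiv ℝ (fun q => fderiv ℝ f q et) p et + fderiv ℝ (fun q => fderiv ℝ f q ez1) p ez1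
    + fderiv ℝ (fun q => fderiv ℝ f q ez2) p ez2

lemma second_deriv_le_of_isLocalMax {F F' : ℝ → ℝ} {F'' a B c : ℝ}
    (hF : ∀ᶠ τ in 𝓝 0, HasDerivAt F (F' τ) τ) (hF' : HasDerivAt F' F'' 0)
    (hmax : IsLocalMax (fun τ => F τ - (a + B * τ + c * τ ^ 2)) 0) : F'' ≤ 2 * c := by
  by_contra hlt
  push Not at hlt
  set h : ℝ → ℝ := fun τ => F τ - (a + B * τ + c * τ ^ 2) with hh
  have hd : ∀ᶠ τ in 𝓝 0, HasDerivAt h (F' τ - (B + 2 * c * τ)) τ := by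
    filter_upwards [hF] with τ hτ
    have h2 : HasDerivAt (fun τ : ℝ => a + B * τ + c * τ ^ 2) (B + 2 * c * τ) τ := by
      have := (((hasDerivAt_id τ).const_mul B).const_add a).add
        (((hasDerivAt_id τ).pow 2).const_mul c)
      refine this.congr_deriv ?_
      simp; ring
    exact hτ.sub h2
  have hd0 : deriv h =ᶠ[𝓝 0] fun τ => F' τ - (B + 2 * c * τ) := by
    filter_upwards [hd] with τ hτ using hτ.deriv
  have hdd : HasDerivAt (deriv h) (F'' - 2 * c) 0 := by
    have h2 : HasDerivAt (fun τ : ℝ => B + 2 * c * τ) (2 * c) 0 := by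
      simpa using ((hasDerivAt_id (0:ℝ)).const_mul (2 * c)).const_add B
    exact (hF'.sub h2).congr_of_eventuallyEq hd0
  have h1 : deriv h 0 = 0 := hmax.deriv_eq_zero
  have hmin : IsLocalMin h 0 :=
    isLocalMin_of_deriv_deriv_pos (by rw [hdd.deriv]; linarith) h1
      hd.self_of_nhds.continuousAt
  have hconst : h =ᶠ[𝓝 0] fun _ => h 0 := by
    filter_upwards [hmax, hmin] with τ h1 h2 using le_antisymm h1 h2
  have hdc : deriv h =ᶠ[𝓝 0] fun _ => 0 := by
    have := hconst.deriv
    simpa using this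
  have := hdd.deriv
  rw [hdc.deriv_eq] at this
  simp at this
  linarith

lemma hasDerivAt_line {f : P3 → E} {p e : P3} {τ : ℝ} (hf : DifferentiableAt ℝ f (p + τ • e)) :
    HasDerivAt (fun τ : ℝ => f (p + τ • e)) (fderiv ℝ f (p + τ • e) e) τ := by
  have h1 : HasDerivAt (fun τ : ℝ => p + τ • e) e τ := by
    simpa using ((hasDerivAt_id τ).smul_const e).const_add p
  exact hf.hasFDerivAt.comp_hasDerivAt τ h1

lemma ContDiffAt.fderiv_apply_differentiableAt {f : P3 → E} {p : P3} (e : P3)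
    (hf : ContDiffAt ℝ 2 f p) : DifferentiableAt ℝ (fun q => fderiv ℝ f q e) p := by
  have : ContDiffAt ℝ 1 (fderiv ℝ f) p := hf.fderiv_right (by norm_num)
  exact (this.differentiableAt (by norm_num)).clm_apply (differentiableAt_const _)

lemma line_derivs {f : P3 → ℝ} {p : P3} (e : P3) (hf : ContDiffAt ℝ 2 f p) :
    (∀ᶠ τ in 𝓝 (0:ℝ), HasDerivAt (fun τ : ℝ => f (p + τ • e)) (pdR e f (p + τ • e)) τ) ∧
      HasDerivAt (fun τ : ℝ => pdR e f (p + τ • e)) (pdR e (fun q => pdR e f q) p) 0 := by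
  constructor
  · have h1 : ∀ᶠ q in 𝓝 p, ContDiffAt ℝ 2 f q := hf.eventually (by simp)
    have h2 : Tendsto (fun τ : ℝ => p + τ • e) (𝓝 0) (𝓝 p) := by
      have : Continuous (fun τ : ℝ => p + τ • e) := by fun_prop
      simpa using this.tendsto 0
    filter_upwards [h2.eventually h1] with τ hτ
    exact hasDerivAt_line (hτ.differentiableAt (by norm_num))
  · have := hasDerivAt_line (f := fun q => pdR e f q) (p := p) (e := e) (τ := 0)
      (by simpa [pdR] using hf.fderiv_apply_differentiableAt e)
    simpa [pdR] using this

/-- Reflection in the first coordinate. -/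
def reflT (p : P3) : P3 := (-p.1, p.2)

lemma odd_part_le_barrier {f : P3 → ℝ} {d M N : ℝ} (hd : 0 < d)
    (hf : ∀ p ∈ Metric.closedBall (0:P3) d, ContDiffAt ℝ 2 f p)
    (hM : ∀ p ∈ Metric.closedBall (0:P3) d, |f p| ≤ M)
    (hN : ∀ p ∈ Metric.closedBall (0:P3) d, |lap3 f p| < N) {t : ℝ} (ht : t ∈ Icc 0 d) :
    (f (t, 0, 0) - f (-t, 0, 0)) / 2 ≤ M / d ^ 2 * (t * (3 * d - 2 * t)) + N / 2 * (t * (d - t)) := by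
  have hmem : ∀ p : P3, p ∈ Metric.closedBall (0:P3) d ↔ |p.1| ≤ d ∧ |p.2.1| ≤ d ∧ |p.2.2| ≤ d := by
    intro p
    simp [Prod.norm_def]
  have hM0 : 0 ≤ M := (abs_nonneg _).trans (hM 0 (by simp [hd.le]))
  set ψ : P3 → ℝ := fun p => M / d ^ 2 * (p.2.1 ^ 2 + p.2.2 ^ 2 + p.1 * (3 * d - 2 * p.1))
    + N / 2 * (p.1 * (d - p.1)) with hψ
  set w : P3 → ℝ := fun p => (f p - f (reflT p)) / 2 - ψ p with hw
  set Q : Set P3 := Icc 0 d ×ˢ (Icc (-d) d ×ˢ Icc (-d) d) with hQ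
  have hQc : IsCompact Q := isCompact_Icc.prod (isCompact_Icc.prod isCompact_Icc)
  have hQb : ∀ p ∈ Q, p ∈ Metric.closedBall (0:P3) d ∧ reflT p ∈ Metric.closedBall (0:P3) d := by
    rintro p ⟨⟨h1, h2⟩, ⟨h3, h4⟩, ⟨h5, h6⟩⟩
    rw [hmem, hmem]
    refine ⟨⟨abs_le.2 ⟨by linarith, h2⟩, abs_le.2 ⟨h3, h4⟩, abs_le.2 ⟨h5, h6⟩⟩, ?_⟩
    simp only [reflT, abs_neg]
    exact ⟨abs_le.2 ⟨by linarith, h2⟩, abs_le.2 ⟨h3, h4⟩, abs_le.2 ⟨h5, h6⟩⟩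
  have hrc : Continuous reflT := by unfold reflT; fun_prop
  have hwc : ContinuousOn w Q := by
    intro p hp
    have h1 := (hf p (hQb p hp).1).continuousAt
    have h2 := (hf _ (hQb p hp).2).continuousAt
    have h3 : ContinuousAt ψ p := by
      have : Continuous ψ := by rw [hψ]; fun_prop
      exact this.continuousAt
    exact (((h1.sub (h2.comp hrc.continuousAt)).div_const 2).sub h3).continuousWithinAt
  obtain ⟨m, hmQ, hmmax⟩ := hQc.exists_isMaxOn
    ⟨(0, 0, 0), by simp [hQ, hd.le]⟩ hwc
  have key : w m ≤ 0 := by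
    by_contra hpos
    push Not at hpos
    obtain ⟨⟨h1, h2⟩, ⟨h3, h4⟩, ⟨h5, h6⟩⟩ := id hmQ
    have hN0 : 0 < N := (abs_nonneg _).trans_lt (hN m (hQb m hmQ).1)
    have hfm := abs_le.1 (hM m (hQb m hmQ).1)
    have hfr := abs_le.1 (hM _ (hQb m hmQ).2)
    have hd2 : M / d ^ 2 * d ^ 2 = M := by field_simp
    have hMd : 0 ≤ M / d ^ 2 := by positivity
    have hNt : 0 ≤ N / 2 * (m.1 * (d - m.1)) := by
      have := mul_nonneg h1 (sub_nonneg.2 h2); positivity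
    have hφM : (f m - f (reflT m)) / 2 ≤ M := by linarith
    -- if the quadratic part is at least `d²`, the barrier dominates
    have hbar : m.2.1 ^ 2 + m.2.2 ^ 2 + m.1 * (3 * d - 2 * m.1) < d ^ 2 := by
      by_contra hge
      push Not at hge
      have := mul_le_mul_of_nonneg_left hge hMd
      simp only [hw, hψ] at hpos
      linarith
    have ht0 : 0 < m.1 := by
      rcases h1.eq_or_lt with h | h
      · exfalso
        have : reflT m = m := by ext <;> simp [reflT, ← h]
        simp only [hw, hψ, this, ← h] at hpos
        have := mul_nonneg hMd (add_nonneg (sq_nonneg m.2.1) (sq_nonneg m.2.2))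
        simp at hpos
        linarith
      · exact h
    have hq : 0 ≤ m.1 * (3 * d - 2 * m.1) := mul_nonneg h1 (by linarith)
    have ht1 : m.1 < d := by
      rcases h2.eq_or_lt with h | h
      · exfalso
        rw [h] at hbar
        nlinarith [sq_nonneg m.2.1, sq_nonneg m.2.2]
      · exact h
    have hy : |m.2.1| < d := by
      apply abs_lt_of_sq_lt_sq _ hd.le
      nlinarith [sq_nonneg m.2.2]
    have hz : |m.2.2| < d := by
      apply abs_lt_of_sq_lt_sq _ hd.le
      nlinarith [sq_nonneg m.2.1]
    have hnhds : Q ∈ 𝓝 m :=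
      prod_mem_nhds (Icc_mem_nhds ht0 ht1) (prod_mem_nhds
        (Icc_mem_nhds (abs_lt.1 hy).1 (abs_lt.1 hy).2) (Icc_mem_nhds (abs_lt.1 hz).1 (abs_lt.1 hz).2))
    have hloc : IsLocalMax w m := hmmax.isLocalMax hnhds
    have hdir : ∀ (e e' : P3) (B c : ℝ), (∀ τ : ℝ, reflT (m + τ • e) = reflT m + τ • e') →
        (∀ τ : ℝ, ψ (m + τ • e) = ψ m + B * τ + c * τ ^ 2) →
        (pdR e (fun q => pdR e f q) m - pdR e' (fun q => pdR e' f q) (reflT m)) / 2 ≤ 2 * c := by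
      intro e e' B c he hψe
      obtain ⟨ha, hb⟩ := line_derivs e (hf m (hQb m hmQ).1)
      obtain ⟨ha', hb'⟩ := line_derivs e' (hf _ (hQb m hmQ).2)
      refine second_deriv_le_of_isLocalMax
        (F := fun τ => (f (m + τ • e) - f (reflT m + τ • e')) / 2)
        (F' := fun τ => (pdR e f (m + τ • e) - pdR e' f (reflT m + τ • e')) / 2)
        (a := ψ m) (B := B) (c := c) ?_ ((hb.sub hb').div_const 2) ?_
      · filter_upwards [ha, ha'] with τ h1 h2 using (h1.sub h2).div_const 2
      · have hcont : Tendsto (fun τ : ℝ => m + τ • e) (𝓝 0) (𝓝 m) := by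
          have : Continuous (fun τ : ℝ => m + τ • e) := by fun_prop
          simpa using this.tendsto 0
        filter_upwards [hcont.eventually hloc] with τ hτ
        have e0 : reflT m + (0:ℝ) • e' = reflT m := by simp
        have e1 : m + (0:ℝ) • e = m := by simp
        simp only [hw] at hτ
        rw [he, hψe] at hτ
        simp only [e0, e1]
        simpa using hτ
    have hT := hdir et (-et) (M / d ^ 2 * (3 * d - 4 * m.1) + N / 2 * (d - 2 * m.1))
      (-(2 * (M / d ^ 2)) - N / 2) (by intro τ; ext <;> simp [reflT, et]; ring)
      (by intro τ; simp [hψ, et]; ring)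
    have h1' := hdir ez1 ez1 (M / d ^ 2 * (2 * m.2.1)) (M / d ^ 2)
      (by intro τ; ext <;> simp [reflT, ez1]) (by intro τ; simp [hψ, ez1]; ring)
    have h2' := hdir ez2 ez2 (M / d ^ 2 * (2 * m.2.2)) (M / d ^ 2)
      (by intro τ; ext <;> simp [reflT, ez2]) (by intro τ; simp [hψ, ez2]; ring)
    have hneg : pdR (-et) (fun q => pdR (-et) f q) (reflT m)
        = pdR et (fun q => pdR et f q) (reflT m) := by
      simp only [pdR, map_neg]
      rw [show (fun q => -(fderiv ℝ f q) et) = -(fun q => (fderiv ℝ f q) et) from rfl, fderiv_neg]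
      simp
    rw [hneg] at hT
    have hl1 := abs_lt.1 (hN m (hQb m hmQ).1)
    have hl2 := abs_lt.1 (hN _ (hQb m hmQ).2)
    simp only [lap3] at hl1 hl2
    linarith
  have hfin : w (t, 0, 0) ≤ w m := hmmax (by simp [hQ, hd.le, ht.1, ht.2])
  have := hfin.trans key
  simp only [hw, hψ, reflT] at this
  norm_num at this
  linarith

lemma pdR_et_zero_le {f : P3 → ℝ} {d M N : ℝ} (hd : 0 < d)
    (hf : ∀ p ∈ Metric.closedBall (0:P3) d, ContDiffAt ℝ 2 f p)
    (hM : ∀ p ∈ Metric.closedBall (0:P3) d, |f p| ≤ M)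
    (hN : ∀ p ∈ Metric.closedBall (0:P3) d, |lap3 f p| < N) :
    pdR et f 0 ≤ 3 * M / d + d * N / 2 := by
  have hc := hf 0 (by simp [hd.le])
  set ζ : ℝ → ℝ := fun t => M / d ^ 2 * (t * (3 * d - 2 * t)) + N / 2 * (t * (d - t))
    - (f (t, 0, 0) - f (-t, 0, 0)) / 2 with hζ
  have hζ0 : ζ 0 = 0 := by simp [hζ]
  have hpos : ∀ t ∈ Icc 0 d, 0 ≤ ζ t := by
    intro t ht
    have := odd_part_le_barrier hd hf hM hN ht
    simp only [hζ]; linarith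
  have hder : HasDerivAt ζ (3 * M / d + d * N / 2 - pdR et f 0) 0 := by
    have h1 : HasDerivAt (fun t : ℝ => f (t, 0, 0)) (pdR et f 0) 0 := by
      have := hasDerivAt_line (f := f) (p := 0) (e := et) (τ := 0)
        (by simpa using hc.differentiableAt (by norm_num))
      simpa [pdR, et] using this
    have h2 : HasDerivAt (fun t : ℝ => f (-t, 0, 0)) (-pdR et f 0) 0 := by
      have h3 : HasDerivAt (fun t : ℝ => f (t, 0, 0)) (pdR et f 0) (-0) := by simpa using h1
      have := h3.comp (0:ℝ) (hasDerivAt_neg (0:ℝ))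
      simpa [Function.comp_def] using this
    have h3 : HasDerivAt (fun t : ℝ => t * (3 * d - 2 * t)) (3 * d) 0 := by
      have := (hasDerivAt_id (0:ℝ)).mul (((hasDerivAt_id (0:ℝ)).const_mul 2).const_sub (3 * d))
      refine HasDerivAt.congr_deriv (f := fun t : ℝ => t * (3 * d - 2 * t)) this ?_
      simp
    have h4 : HasDerivAt (fun t : ℝ => t * (d - t)) d 0 := by
      have := (hasDerivAt_id (0:ℝ)).mul ((hasDerivAt_id (0:ℝ)).const_sub d)
      refine HasDerivAt.congr_deriv (f := fun t : ℝ => t * (d - t)) this ?_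
      simp
    have := ((h3.const_mul (M / d ^ 2)).add (h4.const_mul (N / 2))).sub ((h1.sub h2).div_const 2)
    refine this.congr_deriv ?_
    field_simp
    ring
  by_contra hlt
  push Not at hlt
  have hneg : 3 * M / d + d * N / 2 - pdR et f 0 < 0 := by linarith
  have h1 := hder.tendsto_slope_zero_right
  have h2 : ∀ᶠ t in 𝓝[>] (0:ℝ), 0 ≤ t⁻¹ • (ζ (0 + t) - ζ 0) := by
    filter_upwards [Ioc_mem_nhdsGT hd] with t ht
    have := hpos t ⟨ht.1.le, ht.2⟩
    rw [hζ0]; simp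
    have := ht.1
    positivity
  have := ge_of_tendsto h1 h2
  linarith

lemma fderiv_comp_affine {f : P3 → E} {L : P3 →L[ℝ] P3} {p q e : P3}
    (hf : DifferentiableAt ℝ f (p + L q)) :
    fderiv ℝ (fun q => f (p + L q)) q e = fderiv ℝ f (p + L q) (L e) := by
  have h1 : HasFDerivAt (fun q => p + L q) L q := L.hasFDerivAt.const_add p
  have h2 : HasFDerivAt (fun q => f (p + L q)) ((fderiv ℝ f (p + L q)).comp L) q :=
    hf.hasFDerivAt.comp q h1
  rw [h2.fderiv]; rfl

lemma pdR_pdR_comp_affine {f : P3 → ℝ} {L : P3 →L[ℝ] P3} {p q e : P3}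
    (hf : ContDiffAt ℝ 2 f (p + L q)) :
    pdR e (fun q' => pdR e (fun q => f (p + L q)) q') q
      = pdR (L e) (fun q' => pdR (L e) f q') (p + L q) := by
  have h1 : (fun q' => pdR e (fun q => f (p + L q)) q') =ᶠ[𝓝 q]
      fun q' => (fun y => pdR (L e) f y) (p + L q') := by
    have h2 : ∀ᶠ y in 𝓝 (p + L q), ContDiffAt ℝ 2 f y := hf.eventually (by simp)
    have h3 : Tendsto (fun q => p + L q) (𝓝 q) (𝓝 (p + L q)) :=
      (by fun_prop : Continuous (fun q => p + L q)).tendsto q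
    filter_upwards [h3.eventually h2] with q' hq'
    exact fderiv_comp_affine (hq'.differentiableAt (by norm_num))
  unfold pdR at h1 ⊢
  rw [h1.fderiv_eq]
  exact fderiv_comp_affine (f := fun y => fderiv ℝ f y (L e)) (hf.fderiv_apply_differentiableAt _)

/-- The linear map exchanging the first and the second coordinate. -/
def swap12 : P3 →L[ℝ] P3 :=
  (ContinuousLinearMap.fst ℝ ℝ ℝ ∘L ContinuousLinearMap.snd ℝ ℝ (ℝ × ℝ)).prod
    ((ContinuousLinearMap.fst ℝ ℝ (ℝ × ℝ)).prod
      (ContinuousLinearMap.snd ℝ ℝ ℝ ∘L ContinuousLinearMap.snd ℝ ℝ (ℝ × ℝ)))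

/-- The linear map exchanging the first and the third coordinate. -/
def swap13 : P3 →L[ℝ] P3 :=
  (ContinuousLinearMap.snd ℝ ℝ ℝ ∘L ContinuousLinearMap.snd ℝ ℝ (ℝ × ℝ)).prod
    ((ContinuousLinearMap.fst ℝ ℝ ℝ ∘L ContinuousLinearMap.snd ℝ ℝ (ℝ × ℝ)).prod
      (ContinuousLinearMap.fst ℝ ℝ (ℝ × ℝ)))

lemma pdR_le {f : P3 → ℝ} {p : P3} {d M N : ℝ} (hd : 0 < d)
    (hf : ∀ q ∈ Metric.closedBall p d, ContDiffAt ℝ 2 f q)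
    (hM : ∀ q ∈ Metric.closedBall p d, |f q| ≤ M)
    (hN : ∀ q ∈ Metric.closedBall p d, |lap3 f q| < N)
    {L : P3 →L[ℝ] P3} (hL : ∀ q, ‖L q‖ = ‖q‖)
    (hlap : ∀ q, pdR (L et) (fun q' => pdR (L et) f q') q
      + pdR (L ez1) (fun q' => pdR (L ez1) f q') q
      + pdR (L ez2) (fun q' => pdR (L ez2) f q') q = lap3 f q) :
    pdR (L et) f p ≤ 3 * M / d + d * N / 2 := by
  have hb : ∀ q ∈ Metric.closedBall (0:P3) d, p + L q ∈ Metric.closedBall p d := by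
    intro q hq
    simpa [hL] using hq
  have h0 := pdR_et_zero_le (f := fun q => f (p + L q)) (M := M) (N := N) hd
    (fun q hq => (hf _ (hb q hq)).comp q (by fun_prop))
    (fun q hq => hM _ (hb q hq))
    (fun q hq => by
      have hc := hf _ (hb q hq)
      rw [lap3, pdR_pdR_comp_affine hc, pdR_pdR_comp_affine hc, pdR_pdR_comp_affine hc, hlap]
      exact hN _ (hb q hq))
  have hp : ContDiffAt ℝ 2 f (p + L 0) := by simpa using hf p (by simp [hd.le])
  have := fderiv_comp_affine (f := f) (L := L) (p := p) (q := 0) (e := et)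
    (hp.differentiableAt (by norm_num))
  unfold pdR at h0 ⊢
  rw [this] at h0
  simpa using h0

lemma pdR_coord_le {f : P3 → ℝ} {p : P3} {d M N : ℝ} (hd : 0 < d)
    (hf : ∀ q ∈ Metric.closedBall p d, ContDiffAt ℝ 2 f q)
    (hM : ∀ q ∈ Metric.closedBall p d, |f q| ≤ M)
    (hN : ∀ q ∈ Metric.closedBall p d, |lap3 f q| < N) :
    pdR et f p ≤ 3 * M / d + d * N / 2 ∧ pdR ez1 f p ≤ 3 * M / d + d * N / 2
      ∧ pdR ez2 f p ≤ 3 * M / d + d * N / 2 := by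
  refine ⟨?_, ?_, ?_⟩
  · simpa using pdR_le hd hf hM hN (L := ContinuousLinearMap.id ℝ P3) (fun q => rfl)
      (fun q => by simp [lap3])
  · have := pdR_le hd hf hM hN (L := swap12)
      (fun q => by
        simp only [swap12, Prod.norm_def, ContinuousLinearMap.prod_apply]
        simp [max_left_comm])
      (fun q => by
        simp only [lap3, et, ez1, ez2, swap12, ContinuousLinearMap.prod_apply]
        simp only [ContinuousLinearMap.comp_apply, ContinuousLinearMap.coe_fst',
          ContinuousLinearMap.coe_snd']
        ring)
    simpa [swap12, et, ez1] using this
  · have := pdR_le hd hf hM hN (L := swap13)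
      (fun q => by
        simp only [swap13, Prod.norm_def, ContinuousLinearMap.prod_apply]
        simp [max_comm, max_left_comm])
      (fun q => by
        simp only [lap3, et, ez1, ez2, swap13, ContinuousLinearMap.prod_apply]
        simp only [ContinuousLinearMap.comp_apply, ContinuousLinearMap.coe_fst',
          ContinuousLinearMap.coe_snd']
        ring)
    simpa [swap13, et, ez2] using this

lemma clm_comp_fderiv_apply {f : P3 → E} {p : P3} (ℓ : E →L[ℝ] ℝ) (hf : DifferentiableAt ℝ f p)
    (e : P3) : pdR e (fun q => ℓ (f q)) p = ℓ (fderiv ℝ f p e) := by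
  have := (ℓ.hasFDerivAt (x := f p)).comp p hf.hasFDerivAt
  unfold pdR
  rw [show (fun q => ℓ (f q)) = ℓ ∘ f from rfl, this.fderiv]; rfl

lemma lap3_clm_comp {f : P3 → E} {p : P3} (ℓ : E →L[ℝ] ℝ) (hf : ContDiffAt ℝ 2 f p) :
    lap3 (fun q => ℓ (f q)) p = ℓ (lapE f p) := by
  have h : ∀ e : P3, pdR e (fun q' => pdR e (fun q => ℓ (f q)) q') p
      = ℓ (fderiv ℝ (fun q => fderiv ℝ f q e) p e) := by
    intro e
    have h1 : (fun q' => pdR e (fun q => ℓ (f q)) q') =ᶠ[𝓝 p] fun q' => ℓ (fderiv ℝ f q' e) := by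
      filter_upwards [hf.eventually (by simp)] with q hq
      exact clm_comp_fderiv_apply ℓ (hq.differentiableAt (by norm_num)) e
    rw [← clm_comp_fderiv_apply ℓ (hf.fderiv_apply_differentiableAt e) e]
    unfold pdR at h1 ⊢
    rw [h1.fderiv_eq]
  simp only [lap3, lapE, h, map_add]

/-- Interior gradient estimate for the flat Laplacian on a cube. -/
lemma norm_fderiv_le_of_lapE {f : P3 → E} {p : P3} {r M N : ℝ} (hr : 0 < r)
    (hf : ∀ q ∈ Metric.closedBall p r, ContDiffAt ℝ 2 f q)
    (hM : ∀ q ∈ Metric.closedBall p r, ‖f q‖ ≤ M)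
    (hN : ∀ q ∈ Metric.closedBall p r, ‖lapE f q‖ ≤ N) :
    ‖fderiv ℝ f p‖ ≤ 9 * M / r + 2 * r * N := by
  have hM0 : 0 ≤ M := (norm_nonneg _).trans (hM p (by simp [hr.le]))
  have hN0 : 0 ≤ N := (norm_nonneg _).trans (hN p (by simp [hr.le]))
  have hfp := hf p (by simp [hr.le])
  have hcoord : ∀ δ > 0, ∀ e ∈ ({et, ez1, ez2} : Set P3),
      ‖fderiv ℝ f p e‖ ≤ 3 * M / r + r * (N + δ) / 2 := by
    intro δ hδ e he
    obtain ⟨ℓ, hℓ, hℓe⟩ := exists_dual_vector'' ℝ (fderiv ℝ f p e)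
    have hbound : ∀ y : E, |ℓ y| ≤ ‖y‖ := fun y => by
      have := ℓ.le_of_opNorm_le hℓ y
      simpa using this
    have := pdR_coord_le (f := fun q => ℓ (f q)) (M := M) (N := N + δ) hr
      (fun q hq => ℓ.contDiff.contDiffAt.comp q (hf q hq))
      (fun q hq => (hbound _).trans (hM q hq))
      (fun q hq => by
        rw [lap3_clm_comp ℓ (hf q hq)]
        exact ((hbound _).trans (hN q hq)).trans_lt (by linarith))
    simp only [clm_comp_fderiv_apply ℓ (hfp.differentiableAt (by norm_num))] at this
    have hℓe' : ℓ (fderiv ℝ f p e) = ‖fderiv ℝ f p e‖ := by simpa using hℓe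
    rw [← hℓe']
    rcases he with rfl | rfl | rfl
    exacts [this.1, this.2.1, this.2.2]
  have hcoord' : ∀ e ∈ ({et, ez1, ez2} : Set P3),
      ‖fderiv ℝ f p e‖ ≤ 3 * M / r + r * N / 2 := by
    intro e he
    refine le_of_forall_pos_le_add fun δ hδ => ?_
    have := hcoord (2 * δ / r) (by positivity) e he
    refine this.trans (le_of_eq ?_)
    field_simp
    ring
  refine ContinuousLinearMap.opNorm_le_bound _ (by positivity) fun x => ?_
  have hx : x = x.1 • et + x.2.1 • ez1 + x.2.2 • ez2 := by
    ext <;> simp [et, ez1, ez2]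
  have hx1 : |x.1| ≤ ‖x‖ := norm_fst_le x
  have hx2 : |x.2.1| ≤ ‖x‖ := (norm_fst_le x.2).trans (norm_snd_le x)
  have hx3 : |x.2.2| ≤ ‖x‖ := (norm_snd_le x.2).trans (norm_snd_le x)
  set c := 3 * M / r + r * N / 2 with hc
  have hc0 : 0 ≤ c := by positivity
  calc ‖fderiv ℝ f p x‖
      = ‖x.1 • fderiv ℝ f p et + x.2.1 • fderiv ℝ f p ez1 + x.2.2 • fderiv ℝ f p ez2‖ := by
        conv_lhs => rw [hx]
        simp only [map_add, map_smul]
    _ ≤ |x.1| * ‖fderiv ℝ f p et‖ + |x.2.1| * ‖fderiv ℝ f p ez1‖ + |x.2.2| * ‖fderiv ℝ f p ez2‖ := by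
        refine (norm_add₃_le).trans (le_of_eq ?_)
        simp [norm_smul]
    _ ≤ ‖x‖ * c + ‖x‖ * c + ‖x‖ * c := by
        gcongr
        exacts [hcoord' _ (by simp), hcoord' _ (by simp), hcoord' _ (by simp)]
    _ ≤ (9 * M / r + 2 * r * N) * ‖x‖ := by
        have h1 : 0 ≤ r * N := by positivity
        have : 3 * c ≤ 9 * M / r + 2 * r * N := by
          rw [hc, show 9 * M / r = 3 * (3 * M / r) by ring]; linarith
        nlinarith [norm_nonneg x]

end GradientEstimate

/-! ### A sup bound for subsolutions on the half-space -/

section Subsolution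

lemma hasDerivAt_max_zero_pow (n : ℕ) (x : ℝ) :
    HasDerivAt (fun x : ℝ => (max x 0) ^ (n + 2)) ((n + 2) * (max x 0) ^ (n + 1)) x := by
  rcases lt_trichotomy x 0 with h | h | h
  · have : (fun x : ℝ => (max x 0) ^ (n + 2)) =ᶠ[𝓝 x] fun _ => 0 := by
      filter_upwards [Iio_mem_nhds h] with y hy
      simp [max_eq_right (le_of_lt (mem_Iio.1 hy))]
    rw [max_eq_right h.le]
    simpa using (hasDerivAt_const x (0:ℝ)).congr_of_eventuallyEq this
  · subst h
    simp only [max_self, ne_eq, Nat.add_eq_zero_iff, one_ne_zero, and_false, not_false_eq_true,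
      zero_pow, mul_zero]
    rw [hasDerivAt_iff_isLittleO_nhds_zero]
    simp only [zero_add, max_self, ne_eq, Nat.add_eq_zero_iff, OfNat.ofNat_ne_zero, and_false,
      not_false_eq_true, zero_pow, sub_zero, smul_zero]
    have h1 : (fun h : ℝ => (max h 0) ^ (n + 2)) =O[𝓝 0] fun h : ℝ => h ^ (n + 2) := by
      refine Asymptotics.IsBigO.of_bound 1 (Eventually.of_forall fun y => ?_)
      rw [one_mul, norm_pow, norm_pow]
      gcongr
      rw [Real.norm_of_nonneg (le_max_right _ _)]
      exact max_le (le_abs_self y) (abs_nonneg y)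
    refine h1.trans_isLittleO ?_
    simpa using Asymptotics.isLittleO_pow_pow (𝕜 := ℝ) (m := 1) (n := n + 2) (by omega)
  · have : (fun x : ℝ => (max x 0) ^ (n + 2)) =ᶠ[𝓝 x] fun y => y ^ (n + 2) := by
      filter_upwards [Ioi_mem_nhds h] with y hy
      simp [max_eq_left (le_of_lt (mem_Ioi.1 hy))]
    rw [max_eq_left h.le]
    have h2 := (hasDerivAt_pow (n + 2) x).congr_of_eventuallyEq this
    refine h2.congr_deriv ?_
    push_cast
    simp

lemma contDiff_max_zero_pow_three : ContDiff ℝ 2 (fun x : ℝ => (max x 0) ^ 3) := by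
  have h1 : ContDiff ℝ 1 (fun x : ℝ => 3 * (max x 0) ^ 2) := by
    refine ContDiff.mul contDiff_const ?_
    rw [contDiff_one_iff_deriv]
    refine ⟨fun x => (hasDerivAt_max_zero_pow 0 x).differentiableAt, ?_⟩
    have : deriv (fun x : ℝ => (max x 0) ^ 2) = fun x => 2 * (max x 0) ^ 1 := by
      ext x
      simpa using (hasDerivAt_max_zero_pow 0 x).deriv
    rw [this]; fun_prop
  rw [show (2 : WithTop ℕ∞) = 1 + 1 by norm_num, contDiff_succ_iff_deriv]
  refine ⟨fun x => (hasDerivAt_max_zero_pow 1 x).differentiableAt, by simp, ?_⟩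
  have : deriv (fun x : ℝ => (max x 0) ^ 3) = fun x => 3 * (max x 0) ^ 2 := by
    ext x
    have := (hasDerivAt_max_zero_pow 1 x).deriv
    norm_num at this
    simpa using this
  rw [this]; exact h1

lemma isAddHaarMeasure_volume_P3 : (volume : Measure P3).IsAddHaarMeasure := by
  have : (volume : Measure (ℝ × ℝ)).IsAddHaarMeasure := by
    rw [Measure.volume_eq_prod]; infer_instance
  rw [Measure.volume_eq_prod]; infer_instance

attribute [local instance] isAddHaarMeasure_volume_P3

lemma integral_mul_pdR {f g : P3 → ℝ} (e : P3) (hf : ContDiff ℝ 1 f) (hg : ContDiff ℝ 1 g)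
    (hgc : HasCompactSupport g) : ∫ x, f x * pdR e g x = -∫ x, pdR e f x * g x := by
  have hf' : Continuous (fun x => pdR e f x) :=
    (hf.continuous_fderiv (by norm_num)).clm_apply continuous_const
  have hg' : Continuous (fun x => pdR e g x) :=
    (hg.continuous_fderiv (by norm_num)).clm_apply continuous_const
  have hgc' : HasCompactSupport (fun x => pdR e g x) := hgc.fderiv_apply ℝ e
  exact integral_mul_fderiv_eq_neg_fderiv_mul_of_integrable
    ((hf'.mul hg.continuous).integrable_of_hasCompactSupport hgc.mul_left)
    ((hf.continuous.mul hg').integrable_of_hasCompactSupport hgc'.mul_left)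
    ((hf.continuous.mul hg.continuous).integrable_of_hasCompactSupport hgc.mul_left)
    (fun x _ => (hf.differentiable (by norm_num)).differentiableAt)
    (fun x _ => (hg.differentiable (by norm_num)).differentiableAt)

lemma contDiff_pdR {f : P3 → ℝ} (e : P3) (hf : ContDiff ℝ 2 f) : ContDiff ℝ 1 (fun q => pdR e f q) :=
  (hf.fderiv_right (by norm_num)).clm_apply contDiff_const

lemma integral_mul_lap3 {f g : P3 → ℝ} (hf : ContDiff ℝ 2 f) (hg : ContDiff ℝ 2 g)
    (hgc : HasCompactSupport g) : ∫ x, f x * lap3 g x = ∫ x, lap3 f x * g x := by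
  have key : ∀ e : P3, ∫ x, f x * pdR e (fun q => pdR e g q) x
      = ∫ x, pdR e (fun q => pdR e f q) x * g x := by
    intro e
    have h1 : HasCompactSupport (fun x => pdR e g x) := hgc.fderiv_apply ℝ e
    rw [integral_mul_pdR e (hf.of_le (by norm_num)) (contDiff_pdR e hg) h1,
      integral_mul_pdR e (contDiff_pdR e hf) (hg.of_le (by norm_num)) hgc, neg_neg]
  have hc : ∀ {f : P3 → ℝ} (e : P3), ContDiff ℝ 2 f →
      Continuous (fun x => pdR e (fun q => pdR e f q) x) := fun e hf =>
    ((contDiff_pdR e hf).continuous_fderiv (by norm_num)).clm_apply continuous_const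
  have hs : ∀ e : P3, HasCompactSupport (fun x => pdR e (fun q => pdR e g q) x) := fun e =>
    HasCompactSupport.fderiv_apply ℝ (hgc.fderiv_apply ℝ e) e
  have hi1 : ∀ e : P3, Integrable (fun x => f x * pdR e (fun q => pdR e g q) x) := fun e =>
    (hf.continuous.mul (hc e hg)).integrable_of_hasCompactSupport (hs e).mul_left
  have hi2 : ∀ e : P3, Integrable (fun x => pdR e (fun q => pdR e f q) x * g x) := fun e =>
    ((hc e hf).mul hg.continuous).integrable_of_hasCompactSupport hgc.mul_left
  simp only [lap3, mul_add, add_mul]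
  rw [integral_add (by exact (hi1 _).add (hi1 _)) (hi1 _), integral_add (hi1 _) (hi1 _),
    integral_add (by exact (hi2 _).add (hi2 _)) (hi2 _), integral_add (hi2 _) (hi2 _),
    key, key, key]

/-- The squared Euclidean norm. -/
def sqE (x : P3) : ℝ := x.1 ^ 2 + x.2.1 ^ 2 + x.2.2 ^ 2

lemma sqE_nonneg (x : P3) : 0 ≤ sqE x := by unfold sqE; positivity

lemma sqE_smul (c : ℝ) (x : P3) : sqE (c • x) = c ^ 2 * sqE x := by
  simp [sqE]; ring

lemma sq_norm_le_sqE (x : P3) : ‖x‖ ^ 2 ≤ sqE x := by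
  have : ‖x‖ = max |x.1| (max |x.2.1| |x.2.2|) := by simp [Prod.norm_def]
  rw [this]; unfold sqE
  rcases max_choice |x.1| (max |x.2.1| |x.2.2|) with h | h <;> rw [h]
  · rw [sq_abs]; nlinarith [sq_nonneg x.2.1, sq_nonneg x.2.2]
  rcases max_choice |x.2.1| |x.2.2| with h | h <;> rw [h] <;> rw [sq_abs] <;>
    nlinarith [sq_nonneg x.1, sq_nonneg x.2.2, sq_nonneg x.2.1]

lemma contDiff_sqE : ContDiff ℝ 2 sqE := by unfold sqE; fun_prop

lemma pdR_one_add_sqE_rpow (r : ℝ) (x e : P3) :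
    pdR e (fun x => (1 + sqE x) ^ r) x
      = 2 * r * (x.1 * e.1 + x.2.1 * e.2.1 + x.2.2 * e.2.2) * (1 + sqE x) ^ (r - 1) := by
  have hpos : 0 < 1 + sqE x := by have := sqE_nonneg x; linarith
  have hd : DifferentiableAt ℝ (fun x => (1 + sqE x) ^ r) x :=
    (((contDiff_sqE.differentiable (by norm_num)).differentiableAt).const_add 1).rpow_const
      (Or.inl hpos.ne')
  have h1 := hasDerivAt_line (f := fun x => (1 + sqE x) ^ r) (p := x) (e := e) (τ := 0)
    (by simpa using hd)
  have h2 : HasDerivAt (fun τ : ℝ => 1 + sqE (x + τ • e))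
      (2 * (x.1 * e.1 + x.2.1 * e.2.1 + x.2.2 * e.2.2)) 0 := by
    have hx : ∀ a b : ℝ, HasDerivAt (fun τ : ℝ => (a + τ * b) ^ 2) (2 * (a * b)) 0 := by
      intro a b
      have := (((hasDerivAt_id (0:ℝ)).mul_const b).const_add a).pow 2
      refine HasDerivAt.congr_deriv (f := fun τ : ℝ => (a + τ * b) ^ 2) this ?_
      simp; ring
    have := (((hx x.1 e.1).add (hx x.2.1 e.2.1)).add (hx x.2.2 e.2.2)).const_add 1
    refine HasDerivAt.congr_deriv (f := fun τ : ℝ => 1 + sqE (x + τ • e)) this ?_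
    ring
  have h3 := h2.rpow_const (p := r) (Or.inl (by simpa using hpos.ne'))
  have := h1.unique h3
  simp only [zero_smul, add_zero] at this
  unfold pdR
  rw [this]; ring

/-- The kernel `(1+|x|²)^{-1/2}`. -/
def kerK (x : P3) : ℝ := (1 + sqE x) ^ (-(1/2) : ℝ)

/-- The mass density `3(1+|x|²)^{-5/2} = -Δ (1+|x|²)^{-1/2}`. -/
def kerRho (x : P3) : ℝ := 3 * (1 + sqE x) ^ (-(5/2) : ℝ)

lemma one_add_sqE_pos (x : P3) : 0 < 1 + sqE x := by have := sqE_nonneg x; linarith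

lemma contDiff_kerK : ContDiff ℝ 2 kerK := by
  unfold kerK
  rw [contDiff_iff_contDiffAt]
  intro x
  exact (contDiffAt_const.add contDiff_sqE.contDiffAt).rpow_const_of_ne (one_add_sqE_pos x).ne'

lemma lap3_kerK (x : P3) : lap3 kerK x = -kerRho x := by
  have h0 := one_add_sqE_pos x
  have hpd : ∀ e q : P3, pdR e kerK q =
      -(q.1 * e.1 + q.2.1 * e.2.1 + q.2.2 * e.2.2) * (1 + sqE q) ^ (-(3/2) : ℝ) := by
    intro e q
    unfold kerK
    rw [pdR_one_add_sqE_rpow]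
    norm_num
  have hmul : ∀ e : P3, pdR e (fun q => pdR e kerK q) x
      = -(e.1 ^ 2 + e.2.1 ^ 2 + e.2.2 ^ 2) * (1 + sqE x) ^ (-(3/2) : ℝ)
        + 3 * (x.1 * e.1 + x.2.1 * e.2.1 + x.2.2 * e.2.2) ^ 2 * (1 + sqE x) ^ (-(5/2) : ℝ) := by
    intro e
    simp only [hpd]
    let ℓ : P3 →ₗ[ℝ] ℝ :=
      { toFun := fun q => -(q.1 * e.1 + q.2.1 * e.2.1 + q.2.2 * e.2.2)
        map_add' := by intro a b; simp; ring
        map_smul' := by intro a b; simp; ring }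
    have hl : HasFDerivAt (fun q : P3 => -(q.1 * e.1 + q.2.1 * e.2.1 + q.2.2 * e.2.2))
        (LinearMap.toContinuousLinearMap ℓ) x := (LinearMap.toContinuousLinearMap ℓ).hasFDerivAt
    have hr : DifferentiableAt ℝ (fun x => (1 + sqE x) ^ (-(3/2) : ℝ)) x :=
      (((contDiff_sqE.differentiable (by norm_num)).differentiableAt).const_add 1).rpow_const
        (Or.inl h0.ne')
    have hr' := pdR_one_add_sqE_rpow (-(3/2)) x e
    unfold pdR at hr' ⊢
    have := (hl.mul hr.hasFDerivAt).fderiv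
    rw [show (fun q : P3 => -(q.1 * e.1 + q.2.1 * e.2.1 + q.2.2 * e.2.2) * (1 + sqE q) ^ (-(3/2) : ℝ))
      = (fun q : P3 => -(q.1 * e.1 + q.2.1 * e.2.1 + q.2.2 * e.2.2)) *
        (fun q => (1 + sqE q) ^ (-(3/2) : ℝ)) from rfl, this]
    simp [hr', ℓ]
    norm_num
    ring
  have hsplit : (1 + sqE x) ^ (-(3/2) : ℝ) = (1 + sqE x) * (1 + sqE x) ^ (-(5/2) : ℝ) := by
    rw [show (-(3/2) : ℝ) = 1 + -(5/2) by norm_num, Real.rpow_add h0, Real.rpow_one]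
  simp only [lap3, hmul, et, ez1, ez2, kerRho]
  rw [hsplit]
  unfold sqE
  ring

lemma kerRho_pos (x : P3) : 0 < kerRho x :=
  mul_pos (by norm_num) (Real.rpow_pos_of_pos (one_add_sqE_pos x) _)

lemma kerRho_le (x : P3) : kerRho x ≤ 3 * (1 + ‖x‖ ^ 2) ^ (-5 / 2 : ℝ) := by
  unfold kerRho
  rw [show (-(5/2) : ℝ) = -5/2 by norm_num]
  gcongr 3 * ?_
  exact Real.rpow_le_rpow_of_nonpos (by positivity) (by linarith [sq_norm_le_sqE x]) (by norm_num)

lemma continuous_kerRho : Continuous kerRho := by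
  unfold kerRho
  refine continuous_const.mul ?_
  exact (continuous_const.add contDiff_sqE.continuous).rpow_const
    (fun x => Or.inl (one_add_sqE_pos x).ne')

lemma integrable_kerRho : Integrable kerRho := by
  have h := (integrable_rpow_neg_one_add_norm_sq (E := P3) (μ := volume) (r := 5)
    (by simp; norm_num)).const_mul 3
  refine h.mono' continuous_kerRho.aestronglyMeasurable (Eventually.of_forall fun x => ?_)
  rw [Real.norm_of_nonneg (kerRho_pos x).le]
  exact kerRho_le x

lemma integral_kerRho_pos : 0 < ∫ x, kerRho x := by
  rw [integral_pos_iff_support_of_nonneg (fun x => (kerRho_pos x).le) integrable_kerRho]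
  have : Function.support kerRho = univ := by
    ext x; simp [(kerRho_pos x).ne']
  rw [this]; simp

lemma tendsto_integral_kerRho {g : P3 → ℝ} (hg : Integrable g) {x₀ : P3} (h'g : ContinuousAt g x₀) :
    Tendsto (fun c : ℝ => ∫ x, c ^ 3 * kerRho (c • (x₀ - x)) * g x) atTop
      (𝓝 ((∫ x, kerRho x) * g x₀)) := by
  set κ := ∫ x, kerRho x with hκ
  have hκ0 : 0 < κ := integral_kerRho_pos
  have h1 := tendsto_integral_comp_smul_smul_of_integrable' (μ := (volume : Measure P3))
    (φ := fun x => kerRho x / κ) (g := g) (x₀ := x₀)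
    (fun x => (div_pos (kerRho_pos x) hκ0).le)
    (by rw [integral_div]; exact div_self hκ0.ne') ?_ hg h'g
  · have h2 := h1.const_mul κ
    simp only [smul_eq_mul] at h2
    refine h2.congr fun c => ?_
    rw [← integral_const_mul]
    congr 1; ext x
    have : Module.finrank ℝ P3 = 3 := by simp
    rw [this]; field_simp
  · have hfr : Module.finrank ℝ P3 = 3 := by simp
    rw [hfr]
    have hlim : Tendsto (fun x : P3 => 3 / κ * ‖x‖ ^ (-2 : ℝ)) (Bornology.cobounded P3) (𝓝 0) := by
      have := ((tendsto_rpow_neg_atTop (y := 2) (by norm_num)).comp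
        (tendsto_norm_cobounded_atTop (E := P3))).const_mul (3 / κ)
      simpa using this
    have hne : ∀ᶠ x : P3 in Bornology.cobounded P3, 0 < ‖x‖ :=
      tendsto_norm_cobounded_atTop.eventually (eventually_gt_atTop 0)
    refine squeeze_zero' (Eventually.of_forall fun x => ?_) ?_ hlim
    · have := (kerRho_pos x).le; positivity
    · filter_upwards [hne] with x hx
      have h3 : kerRho x ≤ 3 * ‖x‖ ^ (-5 : ℝ) := by
        refine (kerRho_le x).trans ?_
        gcongr 3 * ?_
        calc (1 + ‖x‖ ^ 2) ^ (-5 / 2 : ℝ) ≤ (‖x‖ ^ 2) ^ (-5 / 2 : ℝ) :=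
              Real.rpow_le_rpow_of_nonpos (by positivity) (by linarith) (by norm_num)
          _ = ‖x‖ ^ (-5 : ℝ) := by
              rw [← Real.rpow_natCast, ← Real.rpow_mul hx.le]; norm_num
      calc ‖x‖ ^ 3 * (kerRho x / κ) ≤ ‖x‖ ^ 3 * (3 * ‖x‖ ^ (-5 : ℝ) / κ) := by gcongr
        _ = 3 / κ * (‖x‖ ^ (3 : ℝ) * ‖x‖ ^ (-5 : ℝ)) := by
            rw [show ‖x‖ ^ (3 : ℝ) = ‖x‖ ^ 3 by exact_mod_cast Real.rpow_natCast ‖x‖ 3]; ring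
        _ = 3 / κ * ‖x‖ ^ (-2 : ℝ) := by rw [← Real.rpow_add hx]; norm_num

end Subsolution

section SubsolutionBound

attribute [local instance] isAddHaarMeasure_volume_P3

lemma inv_sub_inv_le {α β t τ y : ℝ} (hα : 0 < α) (hy : 0 < y) (ht : 0 < t) (hτ : 0 < τ)
    (hβ : 0 < β) (hab : β ^ 2 = α ^ 2 + 4 * t * τ) (hyα : y ≤ α) (hτβ : τ ≤ β) :
    0 ≤ α⁻¹ - β⁻¹ ∧ α⁻¹ - β⁻¹ ≤ 4 * Real.sqrt (1 + t ^ 2) * (y * (1 + y))⁻¹ := by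
  have htτ : 0 < t * τ := mul_pos ht hτ
  have hle : α ≤ β := by
    refine (pow_le_pow_iff_left₀ hα.le hβ.le two_ne_zero).1 ?_
    nlinarith
  set w := Real.sqrt (1 + t ^ 2) with hw
  have hw1 : 1 ≤ w := by
    rw [hw]; apply Real.one_le_sqrt.2; nlinarith [sq_nonneg t]
  have hwt : t ≤ w := by
    rw [hw]; apply Real.le_sqrt_of_sq_le; linarith
  have hβi : 0 < β⁻¹ := by positivity
  refine ⟨sub_nonneg.2 (inv_anti₀ hα hle), ?_⟩
  rcases le_total y 1 with h1 | h1
  · calc α⁻¹ - β⁻¹ ≤ y⁻¹ := by linarith [inv_anti₀ hy hyα]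
      _ = (1 + y) * (y * (1 + y))⁻¹ := by field_simp
      _ ≤ 4 * w * (y * (1 + y))⁻¹ := by gcongr; linarith
  · have h2 : (β - α) * α ≤ 2 * t * β := by
      have h3 : (β - α) * (β + α) = 4 * (t * τ) := by nlinarith
      have h4 : t * τ ≤ t * β := by gcongr
      have h5 : (β - α) * (2 * α) ≤ (β - α) * (β + α) := by
        apply mul_le_mul_of_nonneg_left _ (sub_nonneg.2 hle); linarith
      linarith
    calc α⁻¹ - β⁻¹ = ((β - α) * α) / (α ^ 2 * β) := by field_simp
      _ ≤ (2 * t * β) / (α ^ 2 * β) := by gcongr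
      _ = 2 * t / α ^ 2 := by field_simp
      _ ≤ 2 * w / y ^ 2 := by gcongr
      _ ≤ 4 * w * (y * (1 + y))⁻¹ := by
        rw [← div_eq_mul_inv, div_le_div_iff₀ (by positivity) (by positivity)]
        nlinarith [mul_nonneg (mul_nonneg (by linarith : (0:ℝ) ≤ w) hy.le) (sub_nonneg.2 h1)]

lemma mul_kerK_smul {c : ℝ} (hc : 0 < c) (x : P3) :
    c * kerK (c • x) = (Real.sqrt (sqE x + (c ^ 2)⁻¹))⁻¹ := by
  have h1 : sqE x + (c ^ 2)⁻¹ = (1 + sqE (c • x)) / c ^ 2 := by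
    rw [sqE_smul]; field_simp; ring
  rw [h1, Real.sqrt_div (one_add_sqE_pos _).le, Real.sqrt_sq hc.le, kerK,
    Real.rpow_neg (one_add_sqE_pos _).le, ← Real.sqrt_eq_rpow, inv_div]
  rfl

/-- A smoothed Dirichlet Green kernel of the half-space with pole at `p`. -/
def greenS (c : ℝ) (p q : P3) : ℝ := c * kerK (c • (p - q)) - c * kerK (c • (reflT p - q))

lemma greenS_bounds {c : ℝ} (hc : 0 < c) {p q : P3} (hp : 0 < p.1) (hq : 0 < q.1) (hpq : p ≠ q) :
    0 ≤ greenS c p q ∧ greenS c p q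
      ≤ 4 * Real.sqrt (1 + q.1 ^ 2) * (‖p - q‖ * (1 + ‖p - q‖))⁻¹ := by
  have hc2 : 0 < (c ^ 2)⁻¹ := by positivity
  have h1 : 0 < sqE (p - q) + (c ^ 2)⁻¹ := by have := sqE_nonneg (p - q); linarith
  have h2 : 0 < sqE (reflT p - q) + (c ^ 2)⁻¹ := by have := sqE_nonneg (reflT p - q); linarith
  have hs : sqE (reflT p - q) = sqE (p - q) + 4 * q.1 * p.1 := by
    simp [sqE, reflT]; ring
  unfold greenS
  rw [mul_kerK_smul hc, mul_kerK_smul hc]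
  refine inv_sub_inv_le (Real.sqrt_pos.2 h1) (norm_pos_iff.2 (sub_ne_zero.2 hpq)) hq hp
    (Real.sqrt_pos.2 h2) ?_ ?_ ?_
  · rw [Real.sq_sqrt h1.le, Real.sq_sqrt h2.le, hs]; ring
  · apply Real.le_sqrt_of_sq_le
    linarith [sq_norm_le_sqE (p - q)]
  · apply Real.le_sqrt_of_sq_le
    simp only [sqE, reflT, Prod.fst_sub, Prod.snd_sub]
    nlinarith [sq_nonneg (p.2.1 - q.2.1), sq_nonneg (p.2.2 - q.2.2)]

lemma contDiff_kerK_affine (c : ℝ) (p : P3) : ContDiff ℝ 2 (fun q => c * kerK (c • (p - q))) :=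
  contDiff_const.mul (contDiff_kerK.comp (by fun_prop))

lemma lap3_kerK_affine (c : ℝ) (p q : P3) :
    lap3 (fun q => c * kerK (c • (p - q))) q = -(c ^ 3 * kerRho (c • (p - q))) := by
  let L : P3 →L[ℝ] P3 := -c • ContinuousLinearMap.id ℝ P3
  have hfun : (fun q => c * kerK (c • (p - q))) = fun q => (fun y => c * kerK y) (c • p + L q) := by
    ext q; simp only [L]; congr 2; simp [sub_eq_add_neg]
  have hcd : ContDiff ℝ 2 (fun y => c * kerK y) := contDiff_const.mul contDiff_kerK
  have hpd : ∀ e : P3, pdR e (fun q' => pdR e (fun q => c * kerK (c • (p - q))) q') q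
      = c ^ 3 * pdR e (fun q' => pdR e kerK q') (c • (p - q)) := by
    intro e
    rw [hfun, pdR_pdR_comp_affine hcd.contDiffAt]
    have h1 : (fun y => pdR (L e) (fun y => c * kerK y) y) = fun y => (c * -c) * pdR e kerK y := by
      ext y
      unfold pdR
      rw [fderiv_const_mul (contDiff_kerK.differentiable (by norm_num)).differentiableAt]
      simp [L]
      ring
    rw [h1]
    have h3 := fderiv_const_mul (x := c • p + L q)
      ((contDiff_pdR e contDiff_kerK).differentiable (by norm_num)).differentiableAt (c * -c)
    unfold pdR at h3 ⊢
    rw [h3]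
    have h2 : c • p + L q = c • (p - q) := by simp [L, sub_eq_add_neg]
    rw [h2]
    simp [L]
    ring
  have := lap3_kerK (c • (p - q))
  simp only [lap3, hpd] at this ⊢
  rw [← mul_add, ← mul_add, this]; ring

lemma contDiff_greenS (c : ℝ) (p : P3) : ContDiff ℝ 2 (greenS c p) :=
  (contDiff_kerK_affine c p).sub (contDiff_kerK_affine c (reflT p))

lemma lap3_sub {f g : P3 → ℝ} (hf : ContDiff ℝ 2 f) (hg : ContDiff ℝ 2 g) (x : P3) :
    lap3 (fun q => f q - g q) x = lap3 f x - lap3 g x := by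
  have hpd : ∀ e : P3, pdR e (fun q' => pdR e (fun q => f q - g q) q') x
      = pdR e (fun q' => pdR e f q') x - pdR e (fun q' => pdR e g q') x := by
    intro e
    have h1 : (fun q' => pdR e (fun q => f q - g q) q') = fun q' => pdR e f q' - pdR e g q' := by
      ext q'
      unfold pdR
      rw [fderiv_fun_sub (hf.differentiable (by norm_num)).differentiableAt
        (hg.differentiable (by norm_num)).differentiableAt]
      rfl
    rw [h1]
    have h2 := fderiv_fun_sub ((contDiff_pdR e hf).differentiable (by norm_num)).differentiableAt
        ((contDiff_pdR e hg).differentiable (by norm_num)).differentiableAt (x := x)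
    unfold pdR at h2 ⊢
    rw [h2]; rfl
  simp only [lap3, hpd]; ring

lemma lap3_greenS (c : ℝ) (p q : P3) : lap3 (greenS c p) q
    = -(c ^ 3 * kerRho (c • (p - q)) - c ^ 3 * kerRho (c • (reflT p - q))) := by
  have := lap3_sub (contDiff_kerK_affine c p) (contDiff_kerK_affine c (reflT p)) q
  rw [lap3_kerK_affine, lap3_kerK_affine] at this
  exact this.trans (by ring)

lemma integrable_kernel_sq :
    Integrable (fun x : P3 => ((‖x‖ * (1 + ‖x‖))⁻¹) ^ 2) := by
  have h := integrable_fun_norm_addHaar (volume : Measure P3) (f := fun y : ℝ => ((y * (1 + y))⁻¹) ^ 2)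
  rw [h]
  have hfr : Module.finrank ℝ P3 = 3 := by simp
  rw [hfr]
  have h2 := integrableOn_add_rpow_Ioi_of_lt (a := -2) (c := 0) (m := 1) (by norm_num) (by norm_num)
  refine h2.congr_fun (fun y hy => ?_) measurableSet_Ioi
  have hy0 : 0 < y := hy
  simp only [smul_eq_mul]
  rw [show (-2 : ℝ) = -(2:ℕ) by norm_num, Real.rpow_neg (by positivity), Real.rpow_natCast]
  norm_num
  field_simp
  ring

lemma pdR_comp {q : P3 → ℝ} {χ : ℝ → ℝ} {χ' : ℝ} {p e : P3} (hq : DifferentiableAt ℝ q p)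
    (hχ : HasDerivAt χ χ' (q p)) : pdR e (fun x => χ (q x)) p = χ' * pdR e q p := by
  have := hχ.comp_hasFDerivAt p hq.hasFDerivAt
  unfold pdR
  rw [show (fun x => χ (q x)) = χ ∘ q from rfl, this.fderiv]; simp

lemma lap3_comp_ge {q : P3 → ℝ} {m : ℝ} {p : P3} (hq : ContDiffAt ℝ 2 q p) :
    3 * (max (q p - m) 0) ^ 2 * lap3 q p ≤ lap3 (fun x => (max (q x - m) 0) ^ 3) p := by
  have hev : ∀ᶠ y in 𝓝 p, ContDiffAt ℝ 2 q y := hq.eventually (by simp)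
  have h3 : ∀ x : ℝ, HasDerivAt (fun x : ℝ => (max (x - m) 0) ^ 3) (3 * (max (x - m) 0) ^ 2) x := by
    intro x
    have := (hasDerivAt_max_zero_pow 1 (x - m)).comp_sub_const x m
    norm_num at this
    exact this
  have h2 : ∀ x : ℝ, HasDerivAt (fun x : ℝ => 3 * (max (x - m) 0) ^ 2) (6 * (max (x - m) 0)) x := by
    intro x
    have := ((hasDerivAt_max_zero_pow 0 (x - m)).comp_sub_const x m).const_mul 3
    norm_num at this
    exact this.congr_deriv (by ring)
  have hpd : ∀ e : P3, 3 * (max (q p - m) 0) ^ 2 * pdR e (fun y => pdR e q y) p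
      ≤ pdR e (fun y => pdR e (fun x => (max (q x - m) 0) ^ 3) y) p := by
    intro e
    have h1 : (fun y => pdR e (fun x => (max (q x - m) 0) ^ 3) y) =ᶠ[𝓝 p]
        fun y => (3 * (max (q y - m) 0) ^ 2) * pdR e q y := by
      filter_upwards [hev] with y hy
      exact pdR_comp (hy.differentiableAt (by norm_num)) (h3 (q y))
    have hqd := hq.differentiableAt (by norm_num)
    have hA : DifferentiableAt ℝ (fun y => 3 * (max (q y - m) 0) ^ 2) p :=
      ((h2 (q p)).comp_hasFDerivAt p hqd.hasFDerivAt).differentiableAt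
    have hB : DifferentiableAt ℝ (fun y => pdR e q y) p := hq.fderiv_apply_differentiableAt e
    have hA' := pdR_comp (e := e) hqd (h2 (q p))
    have hAB := (hA.hasFDerivAt.mul hB.hasFDerivAt).fderiv
    have : pdR e (fun y => pdR e (fun x => (max (q x - m) 0) ^ 3) y) p
        = 3 * (max (q p - m) 0) ^ 2 * pdR e (fun y => pdR e q y) p
          + pdR e q p * (6 * (max (q p - m) 0) * pdR e q p) := by
      unfold pdR at h1 hA' ⊢
      rw [h1.fderiv_eq]
      refine (congrArg (fun L : P3 →L[ℝ] ℝ => L e) hAB).trans ?_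
      simp only [_root_.add_apply, _root_.smul_apply, smul_eq_mul]
      unfold pdR
      rw [hA']
    rw [this]
    have h0 : 0 ≤ max (q p - m) 0 := le_max_right _ _
    have : 0 ≤ pdR e q p * (6 * (max (q p - m) 0) * pdR e q p) := by
      have := mul_nonneg h0 (sq_nonneg (pdR e q p)); nlinarith
    linarith
  have := hpd et; have := hpd ez1; have := hpd ez2
  simp only [lap3]; linarith

end SubsolutionBound

lemma isOpen_Hsp : IsOpen Hsp := isOpen_lt continuous_const continuous_fst

section SubsolutionSup

attribute [local instance] isAddHaarMeasure_volume_P3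

/-- A nonnegative function on the half-space with compact superlevel sets whose Laplacian is
bounded below by `-2 e Xn √q` is bounded by a multiple of `e²` depending only on `Xn`. -/
lemma sqrt_le_of_lap3_ge {Xn : P3 → ℝ} (hX0 : ∀ p ∈ Hsp, 0 ≤ Xn p)
    (hXi : Integrable (Hsp.indicator fun p => (1 + p.1 ^ 2) * Xn p ^ 2)) :
    ∃ C : ℝ, 0 ≤ C ∧ ∀ (e : ℝ) (q : P3 → ℝ), 0 ≤ e → (∀ p ∈ Hsp, 0 ≤ q p) →
      (∀ p ∈ Hsp, ContDiffAt ℝ 2 q p) → (∀ ε > 0, IsCompact {p | p ∈ Hsp ∧ ε ≤ q p}) →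
      (∀ p ∈ Hsp, -(2 * e * Xn p * Real.sqrt (q p)) ≤ lap3 q p) →
      ∀ p ∈ Hsp, Real.sqrt (q p) ≤ C * e := by
  set κ := ∫ x, kerRho x with hκ
  have hκ0 : 0 < κ := integral_kerRho_pos
  set J := ∫ x : P3, ((‖x‖ * (1 + ‖x‖))⁻¹) ^ 2 with hJ
  set I := ∫ x : P3, Hsp.indicator (fun p => (1 + p.1 ^ 2) * Xn p ^ 2) x with hI
  have hJ0 : 0 ≤ J := integral_nonneg fun x => by positivity
  have hI0 : 0 ≤ I := integral_nonneg fun x => indicator_nonneg (fun p _ => by positivity) x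
  refine ⟨64 / 27 * (3 * (16 * J + I)) / κ, by positivity, ?_⟩
  intro e q he hq0 hqd hqc hlap p hp
  rcases (hq0 p hp).eq_or_lt with h0 | h0
  · rw [← h0, Real.sqrt_zero]; positivity
  -- the maximum point
  obtain ⟨x, hx, hxmax⟩ := (hqc (q p) h0).exists_isMaxOn ⟨p, hp, le_rfl⟩
    (f := q) (fun y hy => (hqd y hy.1).continuousAt.continuousWithinAt)
  have hmax : ∀ y ∈ Hsp, q y ≤ q x := by
    intro y hy
    rcases le_total (q p) (q y) with h | h
    · exact hxmax ⟨hy, h⟩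
    · exact h.trans hx.2
  have hxH : x ∈ Hsp := hx.1
  set M := Real.sqrt (q x) with hM
  have hqx : 0 < q x := h0.trans_le hx.2
  have hM0 : 0 < M := Real.sqrt_pos.2 hqx
  have hMsq : M ^ 2 = q x := Real.sq_sqrt hqx.le
  suffices hgoal : M ≤ 64 / 27 * (3 * (16 * J + I)) / κ * e from
    (Real.sqrt_le_sqrt (hmax p hp)).trans hgoal
  set m := q x / 4 with hm
  have hm0 : 0 < m := by positivity
  set K : Set P3 := {p | p ∈ Hsp ∧ m ≤ q p} with hK
  have hKc : IsCompact K := hqc m hm0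
  set ψ : P3 → ℝ := Hsp.indicator (fun y => (max (q y - m) 0) ^ 3) with hψ
  have hψK : ∀ y ∉ K, ψ y = 0 := by
    intro y hy
    by_cases hyH : y ∈ Hsp
    · have : q y < m := not_le.1 fun h => hy ⟨hyH, h⟩
      rw [hψ, indicator_of_mem hyH, max_eq_right (by linarith)]; norm_num
    · rw [hψ, indicator_of_notMem hyH]
  have hψH : ∀ y ∈ Hsp, ψ =ᶠ[𝓝 y] fun y => (max (q y - m) 0) ^ 3 := by
    intro y hy
    filter_upwards [isOpen_Hsp.mem_nhds hy] with z hz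
    rw [hψ, indicator_of_mem hz]
  have hψn : ∀ y ∉ Hsp, ψ =ᶠ[𝓝 y] fun _ => 0 := by
    intro y hy
    have : y ∈ Kᶜ := fun h => hy h.1
    filter_upwards [hKc.isClosed.isOpen_compl.mem_nhds this] with z hz using hψK z hz
  have hψ2 : ContDiff ℝ 2 ψ := by
    rw [contDiff_iff_contDiffAt]
    intro y
    by_cases hy : y ∈ Hsp
    · refine ContDiffAt.congr_of_eventuallyEq ?_ (hψH y hy)
      exact contDiff_max_zero_pow_three.contDiffAt.comp y ((hqd y hy).sub contDiffAt_const)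
    · exact contDiffAt_const.congr_of_eventuallyEq (hψn y hy)
  have hψc : HasCompactSupport ψ := HasCompactSupport.intro hKc hψK
  have hψcont : Continuous ψ := hψ2.continuous
  have hlapeq : ∀ {f g : P3 → ℝ} {y : P3}, f =ᶠ[𝓝 y] g → lap3 f y = lap3 g y := by
    intro f g y hfg
    have : ∀ e : P3, (fun z => pdR e f z) =ᶠ[𝓝 y] fun z => pdR e g z := by
      intro e
      filter_upwards [hfg.eventuallyEq_nhds] with z hz
      unfold pdR; rw [hz.fderiv_eq]
    have h2 : ∀ e : P3, pdR e (fun z => pdR e f z) y = pdR e (fun z => pdR e g z) y := by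
      intro e
      have := (this e).fderiv_eq (𝕜 := ℝ)
      unfold pdR at this ⊢; rw [this]
    simp only [lap3, h2]
  have hlapH : ∀ y ∈ Hsp, -lap3 ψ y ≤ 6 * M ^ 5 * e * Xn y := by
    intro y hy
    rw [hlapeq (hψH y hy)]
    have h1 := lap3_comp_ge (m := m) (hqd y hy)
    have h2 := hlap y hy
    set a := max (q y - m) 0 with ha
    have ha0 : 0 ≤ a := le_max_right _ _
    have haM : a ≤ M ^ 2 := by
      rw [hMsq]; exact max_le (by linarith [hmax y hy]) hqx.le
    have hs : Real.sqrt (q y) ≤ M := Real.sqrt_le_sqrt (hmax y hy)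
    have h3 : 3 * a ^ 2 * -(2 * e * Xn y * Real.sqrt (q y)) ≤ 3 * a ^ 2 * lap3 q y := by gcongr
    have hXy := hX0 y hy
    have h4 : 3 * a ^ 2 * (2 * e * Xn y * Real.sqrt (q y))
        ≤ 3 * (M ^ 2) ^ 2 * (2 * e * Xn y * M) := by gcongr
    nlinarith
  have hlapn : ∀ y ∉ Hsp, lap3 ψ y = 0 := by
    intro y hy
    rw [hlapeq (hψn y hy)]
    simp [lap3, pdR]
  -- pointwise bound of the Green potential
  have hbound : ∀ c > 0, ∫ y, greenS c x y * -lap3 ψ y ≤ 3 * M ^ 5 * e * (16 * J + I) := by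
    intro c hc
    have hgint : Integrable (fun y => greenS c x y * -lap3 ψ y) := by
      have hc2 : ∀ e : P3, Continuous (fun y => pdR e (fun z => pdR e ψ z) y) := fun e =>
        ((contDiff_pdR e hψ2).continuous_fderiv (by norm_num)).clm_apply continuous_const
      have hs2 : ∀ e : P3, HasCompactSupport (fun y => pdR e (fun z => pdR e ψ z) y) := fun e =>
        HasCompactSupport.fderiv_apply ℝ (hψc.fderiv_apply ℝ e) e
      have hl : Continuous (fun y => lap3 ψ y) := ((hc2 et).add (hc2 ez1)).add (hc2 ez2)
      have hls : HasCompactSupport (fun y => lap3 ψ y) := ((hs2 et).add (hs2 ez1)).add (hs2 ez2)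
      exact ((contDiff_greenS c x).continuous.mul hl.neg).integrable_of_hasCompactSupport
        (HasCompactSupport.mul_left (by exact hls.neg))
    have hk : Integrable (fun y : P3 => ((‖x - y‖ * (1 + ‖x - y‖))⁻¹) ^ 2) :=
      integrable_kernel_sq.comp_sub_left x
    have hkJ : ∫ y : P3, ((‖x - y‖ * (1 + ‖x - y‖))⁻¹) ^ 2 = J :=
      integral_sub_left_eq_self (fun y : P3 => ((‖y‖ * (1 + ‖y‖))⁻¹) ^ 2) volume x
    have hB : Integrable (fun y => 3 * M ^ 5 * e * (16 * ((‖x - y‖ * (1 + ‖x - y‖))⁻¹) ^ 2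
        + Hsp.indicator (fun p => (1 + p.1 ^ 2) * Xn p ^ 2) y)) :=
      ((hk.const_mul 16).add hXi).const_mul _
    refine (integral_mono_ae hgint hB ?_).trans (le_of_eq ?_)
    · have hne : ∀ᵐ y : P3, y ≠ x := by
        rw [ae_iff]; simp
      filter_upwards [hne] with y hyx
      by_cases hy : y ∈ Hsp
      · obtain ⟨hg0, hg1⟩ := greenS_bounds hc hxH hy hyx.symm
        rw [indicator_of_mem hy]
        have hXy := hX0 y hy
        set k := (‖x - y‖ * (1 + ‖x - y‖))⁻¹ with hkdef
        set w := Real.sqrt (1 + y.1 ^ 2) with hw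
        have hwsq : w ^ 2 = 1 + y.1 ^ 2 := Real.sq_sqrt (by positivity)
        have hk0 : 0 ≤ k := by positivity
        have hw0 : 0 ≤ w := Real.sqrt_nonneg _
        calc greenS c x y * -lap3 ψ y ≤ greenS c x y * (6 * M ^ 5 * e * Xn y) := by
              gcongr; exact hlapH y hy
          _ ≤ (4 * w * k) * (6 * M ^ 5 * e * Xn y) := by gcongr
          _ = 3 * M ^ 5 * e * (2 * (4 * k) * (w * Xn y)) := by ring
          _ ≤ 3 * M ^ 5 * e * ((4 * k) ^ 2 + (w * Xn y) ^ 2) := by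
              gcongr; exact two_mul_le_add_sq _ _
          _ = 3 * M ^ 5 * e * (16 * k ^ 2 + (1 + y.1 ^ 2) * Xn y ^ 2) := by
              rw [mul_pow, mul_pow, hwsq]; norm_num
      · rw [hlapn y hy, indicator_of_notMem hy]
        simp only [neg_zero, mul_zero, add_zero]
        positivity
    · rw [integral_const_mul, integral_add (hk.const_mul 16) hXi, integral_const_mul, hkJ]
  have hident : ∀ c : ℝ, ∫ y, greenS c x y * -lap3 ψ y
      = (∫ y, c ^ 3 * kerRho (c • (x - y)) * ψ y) - ∫ y, c ^ 3 * kerRho (c • (reflT x - y)) * ψ y := by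
    intro c
    have h1 := integral_mul_lap3 (contDiff_greenS c x) hψ2 hψc
    have hi : ∀ z : P3, Integrable (fun y => c ^ 3 * kerRho (c • (z - y)) * ψ y) := fun z =>
      ((continuous_const.mul (continuous_kerRho.comp (by fun_prop))).mul
        hψcont).integrable_of_hasCompactSupport hψc.mul_left
    simp only [mul_neg]
    rw [integral_neg, h1, ← integral_neg, ← integral_sub (hi _) (hi _)]
    congr 1; ext y
    rw [lap3_greenS]; ring
  have hψi : Integrable ψ := hψcont.integrable_of_hasCompactSupport hψc
  have hlim := (tendsto_integral_kerRho hψi hψcont.continuousAt (x₀ := x)).sub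
    (tendsto_integral_kerRho hψi hψcont.continuousAt (x₀ := reflT x))
  have hrefl : ψ (reflT x) = 0 := by
    rw [hψ, indicator_of_notMem]
    have : 0 < x.1 := hxH
    simp [Hsp, reflT, this.le]
  have hψx : ψ x = 27 / 64 * M ^ 6 := by
    rw [hψ, indicator_of_mem hxH, max_eq_left (by rw [hm]; linarith), hm, ← hMsq]
    ring
  rw [hrefl, hψx, mul_zero, sub_zero] at hlim
  have hfin : κ * (27 / 64 * M ^ 6) ≤ 3 * M ^ 5 * e * (16 * J + I) := by
    refine le_of_tendsto hlim ?_
    filter_upwards [eventually_gt_atTop 0] with c hc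
    rw [← hident c]; exact hbound c hc
  have h5 : 0 < M ^ 5 := by positivity
  have : κ * (27 / 64 * M) ≤ 3 * e * (16 * J + I) := by
    have : M ^ 5 * (κ * (27 / 64 * M)) ≤ M ^ 5 * (3 * e * (16 * J + I)) := by
      calc _ = κ * (27 / 64 * M ^ 6) := by ring
        _ ≤ _ := hfin
        _ = _ := by ring
    exact le_of_mul_le_mul_left this h5
  rw [div_mul_eq_mul_div, le_div_iff₀ hκ0]
  linarith

end SubsolutionSup

/-! ### The differential star-algebra of smooth algebra-valued functions -/

section SmoothAlgebra

variable {E : Type*} [NormedAddCommGroup E] [NormedSpace ℝ E]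
variable {𝔸 : Type*} [CStarAlgebra 𝔸]

lemma ContDiffOn.cstar {n : WithTop ℕ∞} {f : E → 𝔸} {W : Set E} (hf : ContDiffOn ℝ n f W) :
    ContDiffOn ℝ n (fun x => star (f x)) W :=
  (starL' ℝ : 𝔸 ≃L[ℝ] 𝔸).contDiff.comp_contDiffOn hf

variable (𝔸) in
/-- Smooth algebra-valued functions on `W`, as a star-algebra. -/
def smoothAlg (W : Set E) : StarSubalgebra ℂ (E → 𝔸) where
  carrier := {f | ContDiffOn ℝ (⊤:ℕ∞) f W}
  mul_mem' hf hg := ContDiffOn.mul hf hg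
  add_mem' hf hg := ContDiffOn.add hf hg
  algebraMap_mem' _ := contDiffOn_const
  star_mem' hf := ContDiffOn.cstar hf

/-- Domains on which derivatives within the set behave as on open sets. -/
structure GoodDom (W : Set E) : Prop where
  uniqueDiff : UniqueDiffOn ℝ W
  subset_closure : W ⊆ closure (interior W)

variable {W : Set E}

lemma smoothAlg.contDiffOn (f : smoothAlg 𝔸 W) : ContDiffOn ℝ (⊤:ℕ∞) f.1 W := f.2

lemma smoothAlg.diffWithinAt (f : smoothAlg 𝔸 W) {x : E} (hx : x ∈ W) :
    DifferentiableWithinAt ℝ f.1 W x :=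
  (smoothAlg.contDiffOn f).differentiableOn (by simp) x hx

open Classical in
/-- The directional derivative as a linear endomorphism of the algebra of smooth functions. -/
def smoothDer (hW : GoodDom W) (v : E) : smoothAlg 𝔸 W →ₗ[ℂ] smoothAlg 𝔸 W where
  toFun f := ⟨W.indicator fun x => fderivWithin ℝ f.1 W x v, by
    have h1 : ContDiffOn ℝ (⊤:ℕ∞) (fun x => fderivWithin ℝ f.1 W x v) W :=
      ((smoothAlg.contDiffOn f).fderivWithin hW.uniqueDiff (by simp)).clm_apply contDiffOn_const
    exact h1.congr fun x hx => indicator_of_mem hx _⟩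
  map_add' f g := by
    ext1; ext1 x
    by_cases hx : x ∈ W
    · simp only [AddMemClass.coe_add, Pi.add_apply, indicator_of_mem hx]
      rw [fderivWithin_add (hW.uniqueDiff x hx) (smoothAlg.diffWithinAt f hx)
        (smoothAlg.diffWithinAt g hx)]
      rfl
    · simp [indicator_of_notMem hx]
  map_smul' c f := by
    ext1; ext1 x
    by_cases hx : x ∈ W
    · simp only [SetLike.val_smul, Pi.smul_apply, indicator_of_mem hx, RingHom.id_apply]
      rw [fderivWithin_const_smul (hW.uniqueDiff x hx) (smoothAlg.diffWithinAt f hx)]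
      rfl
    · simp [indicator_of_notMem hx]

lemma smoothDer_apply (hW : GoodDom W) (v : E) (f : smoothAlg 𝔸 W) {x : E} (hx : x ∈ W) :
    (smoothDer hW v f).1 x = fderivWithin ℝ f.1 W x v :=
  indicator_of_mem hx fun x => fderivWithin ℝ f.1 W x v

lemma smoothDer_apply_notMem (hW : GoodDom W) (v : E) (f : smoothAlg 𝔸 W) {x : E} (hx : x ∉ W) :
    (smoothDer hW v f).1 x = 0 :=
  indicator_of_notMem hx fun x => fderivWithin ℝ f.1 W x v

lemma smoothDer_mul (hW : GoodDom W) (v : E) (f g : smoothAlg 𝔸 W) :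
    smoothDer hW v (f * g) = smoothDer hW v f * g + f * smoothDer hW v g := by
  ext1; ext1 x
  simp only [AddMemClass.coe_add, MulMemClass.coe_mul, Pi.add_apply, Pi.mul_apply]
  by_cases hx : x ∈ W
  · rw [smoothDer_apply hW v _ hx, smoothDer_apply hW v _ hx, smoothDer_apply hW v _ hx]
    simp only [MulMemClass.coe_mul]
    rw [fderivWithin_mul' (hW.uniqueDiff x hx) (smoothAlg.diffWithinAt f hx)
        (smoothAlg.diffWithinAt g hx)]
    simp [add_comm]
  · rw [smoothDer_apply_notMem hW v _ hx, smoothDer_apply_notMem hW v _ hx,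
      smoothDer_apply_notMem hW v _ hx]
    simp

lemma smoothDer_star (hW : GoodDom W) (v : E) (f : smoothAlg 𝔸 W) :
    smoothDer hW v (star f) = star (smoothDer hW v f) := by
  ext1; ext1 x
  by_cases hx : x ∈ W
  · rw [smoothDer_apply hW v _ hx]
    change fderivWithin ℝ (fun y => star (f.1 y)) W x v = star ((smoothDer hW v f).1 x)
    rw [fderivWithin_star (hW.uniqueDiff x hx), smoothDer_apply hW v _ hx]
    rfl
  · rw [smoothDer_apply_notMem hW v _ hx]
    change 0 = star ((smoothDer hW v f).1 x)
    rw [smoothDer_apply_notMem hW v _ hx, star_zero]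

lemma smoothDer_comm (hW : GoodDom W) (v w : E) (f : smoothAlg 𝔸 W) :
    smoothDer hW v (smoothDer hW w f) = smoothDer hW w (smoothDer hW v f) := by
  ext1; ext1 x
  by_cases hx : x ∈ W
  · have key : ∀ v w : E, (smoothDer hW v (smoothDer hW w f)).1 x
        = fderivWithin ℝ (fderivWithin ℝ f.1 W) W x v w := by
      intro v w
      rw [smoothDer_apply hW v _ hx]
      have h1 : EqOn (smoothDer hW w f).1 (fun y => fderivWithin ℝ f.1 W y w) W :=
        fun y hy => smoothDer_apply hW w f hy
      rw [fderivWithin_congr h1 (h1 hx)]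
      have h2 : DifferentiableWithinAt ℝ (fderivWithin ℝ f.1 W) W x :=
        ((smoothAlg.contDiffOn f).fderivWithin hW.uniqueDiff (m := 1)
          (by norm_cast)).differentiableOn (by norm_num) x hx
      rw [fderivWithin_clm_apply (hW.uniqueDiff x hx) h2 (differentiableWithinAt_const _)]
      simp
    rw [key, key]
    have := (smoothAlg.contDiffOn f x hx).isSymmSndFDerivWithinAt (n := (⊤:ℕ∞))
      (by simp; norm_cast) hW.uniqueDiff (hW.subset_closure hx) hx
    exact this.eq v w
  · rw [smoothDer_apply_notMem hW v _ hx, smoothDer_apply_notMem hW w _ hx]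

end SmoothAlgebra

/-! ### Identities in an algebra with commuting derivations -/

section Derivations

variable {R : Type*} [Ring R] [Algebra ℂ R]

/-- The Leibniz rule for a linear map. -/
def IsDer (d : R →ₗ[ℂ] R) : Prop := ∀ x y, d (x * y) = d x * y + x * d y

/-- The covariant derivative `d x + [b, x]`. -/
def cov (d : R →ₗ[ℂ] R) (b : R) (x : R) : R := d x + (b * x - x * b)

/-- The curvature `d b' - d' b + [b, b']`. -/
def curv (d d' : R →ₗ[ℂ] R) (b b' : R) : R := d b' - d' b + (b * b' - b' * b)

lemma IsDer.zero : IsDer (0 : R →ₗ[ℂ] R) := fun x y => by simp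

lemma IsDer.add {d d' : R →ₗ[ℂ] R} (h : IsDer d) (h' : IsDer d') : IsDer (d + d') := fun x y => by
  simp only [LinearMap.add_apply, h x y, h' x y]; noncomm_ring

lemma IsDer.smul {d : R →ₗ[ℂ] R} (h : IsDer d) (c : ℂ) : IsDer (c • d) := fun x y => by
  simp [h x y]

lemma IsDer.sub {d d' : R →ₗ[ℂ] R} (h : IsDer d) (h' : IsDer d') : IsDer (d - d') := fun x y => by
  simp only [LinearMap.sub_apply, h x y, h' x y]; noncomm_ring

lemma IsDer.map_one {d : R →ₗ[ℂ] R} (h : IsDer d) : d 1 = 0 := by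
  have := h 1 1
  simpa using this

lemma IsDer.map_inv {d : R →ₗ[ℂ] R} (h : IsDer d) {g γ : R} (h1 : g * γ = 1) (h2 : γ * g = 1) :
    d γ = -(γ * d g * γ) := by
  have h3 := h g γ
  rw [h1, h.map_one] at h3
  have h4 : γ * (d g * γ + g * d γ) = 0 := by rw [← h3, mul_zero]
  rw [mul_add, ← mul_assoc, ← mul_assoc, h2, one_mul] at h4
  exact eq_neg_of_add_eq_zero_right h4

lemma cov_mul {d : R →ₗ[ℂ] R} (h : IsDer d) (b x y : R) :
    cov d b (x * y) = cov d b x * y + x * cov d b y := by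
  simp only [cov, h x y]; noncomm_ring

/-- The commutator of two covariant derivatives is the curvature. -/
lemma cov_cov_sub {d d' : R →ₗ[ℂ] R} (h : IsDer d) (h' : IsDer d') (hc : ∀ x, d (d' x) = d' (d x))
    (b b' x : R) :
    cov d b (cov d' b' x) - cov d' b' (cov d b x) = curv d d' b b' * x - x * curv d d' b b' := by
  simp only [cov, curv, map_add, map_sub, h _ _, h' _ _, hc]; noncomm_ring

/-- Evolution of the curvature. -/
lemma der_curv {ds d d' : R →ₗ[ℂ] R} (hs : IsDer ds)
    (h : IsDer d) (h' : IsDer d') (hsd : ∀ x, ds (d x) = d (ds x))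
    (hsd' : ∀ x, ds (d' x) = d' (ds x)) {b b' u : R}
    (hb : ds b = -(Complex.I • cov d b u)) (hb' : ds b' = Complex.I • cov d' b' u) :
    ds (curv d d' b b') = Complex.I • (cov d b (cov d' b' u) + cov d' b' (cov d b u)) := by
  have : ds (curv d d' b b') = d (ds b') - d' (ds b) + (ds b * b' + b * ds b' -
      (ds b' * b + b' * ds b)) := by
    simp only [curv, map_add, map_sub, hs _ _, hsd, hsd']
  rw [this, hb, hb']
  simp only [cov, map_smul, map_neg, map_add, map_sub, h _ _, h' _ _, smul_add, smul_sub, neg_mul,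
    mul_neg, smul_mul_assoc, mul_smul_comm, mul_add, mul_sub, add_mul, sub_mul, mul_assoc]
  abel

/-- The complex gauge action on a connection component. -/
def gaugeC (d : R →ₗ[ℂ] R) (g γ b : R) : R := g * b * γ - d g * γ

/-- Evolution of a gauge transformed connection component. -/
lemma der_gaugeC {ds d : R →ₗ[ℂ] R} (hs : IsDer ds)
    (h : IsDer d) (hsd : ∀ x, ds (d x) = d (ds x)) {g γ u b : R} (h1 : g * γ = 1) (h2 : γ * g = 1)
    (hg : ds g = Complex.I • (u * g)) (hb : ds b = 0) :
    ds (gaugeC d g γ b) = -(Complex.I • cov d (gaugeC d g γ b) u) := by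
  have hγ : ds γ = -(Complex.I • (γ * u)) := by
    rw [hs.map_inv h1 h2, hg]
    simp [mul_assoc, h1]
  have e : ds (gaugeC d g γ b) = ds g * b * γ + g * ds b * γ + g * b * ds γ
      - (d (ds g) * γ + d g * ds γ) := by
    simp only [gaugeC, map_sub, hs _ _, hsd]; noncomm_ring
  rw [e, hγ, hg, hb]
  simp only [gaugeC, cov, map_smul, h _ _, smul_add, smul_sub, mul_zero, zero_mul,
    mul_neg, smul_mul_assoc, mul_smul_comm, mul_sub, add_mul, sub_mul, mul_assoc, h1, mul_one]
  abel

/-- Conjugating a covariant derivative. -/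
lemma cov_conj {d : R →ₗ[ℂ] R} (h : IsDer d) {g γ : R} (h1 : g * γ = 1) (h2 : γ * g = 1)
    (b ω : R) :
    cov d b (g * ω * γ) = g * cov d (γ * b * g + γ * d g) ω * γ := by
  have h1' : ∀ x, g * (γ * x) = x := fun x => by rw [← mul_assoc, h1, one_mul]
  simp only [cov, h _ _, h.map_inv h1 h2, mul_add, mul_sub, add_mul, sub_mul, mul_neg, mul_assoc,
    h1, h1', mul_one]
  abel

lemma cov_gaugeC {d : R →ₗ[ℂ] R} (h : IsDer d) {g γ : R} (h1 : g * γ = 1) (h2 : γ * g = 1)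
    (b ω : R) :
    cov d (gaugeC d g γ b) (g * ω * γ) = g * cov d b ω * γ := by
  rw [cov_conj h h1 h2]
  congr 3
  have h2' : ∀ x, γ * (g * x) = x := fun x => by rw [← mul_assoc, h2, one_mul]
  simp only [gaugeC, mul_sub, sub_mul, mul_assoc, h2, h2', mul_one]
  abel

lemma curv_gaugeC {d d' : R →ₗ[ℂ] R} (h : IsDer d) (h' : IsDer d')
    (hc : ∀ x, d (d' x) = d' (d x)) {g γ : R} (h1 : g * γ = 1) (h2 : γ * g = 1) (b b' : R) :
    curv d d' (gaugeC d g γ b) (gaugeC d' g γ b') = g * curv d d' b b' * γ := by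
  have h2' : ∀ x, γ * (g * x) = x := fun x => by rw [← mul_assoc, h2, one_mul]
  simp only [curv, gaugeC, map_sub, h _ _, h' _ _, h.map_inv h1 h2, h'.map_inv h1 h2, hc,
    mul_add, mul_sub, add_mul, sub_mul, mul_neg, mul_assoc, h2']
  abel

/-- The expression `𝔛`. -/
def rX (dt d1 d2 : R →ₗ[ℂ] R) (At A1 A2 a3 f fh : R) : R :=
  cov dt At a3 - curv d1 d2 A1 A2 - (Complex.I * (2:ℂ)⁻¹) • (f * fh - fh * f)

/-- The expression `Δ u`. -/
def rlap (dt d1 d2 : R →ₗ[ℂ] R) (At A1 A2 a3 f fh u : R) : R :=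
  -(cov dt At (cov dt At u) + cov d1 A1 (cov d1 A1 u) + cov d2 A2 (cov d2 A2 u))
  + cov 0 ((2:ℂ)⁻¹ • (f + fh)) (-cov 0 ((2:ℂ)⁻¹ • (f + fh)) u)
  + cov 0 ((Complex.I * (2:ℂ)⁻¹) • (f - fh)) (-cov 0 ((Complex.I * (2:ℂ)⁻¹) • (f - fh)) u)
  + cov 0 a3 (-cov 0 a3 u)

lemma two_I_rX (dt d1 d2 : R →ₗ[ℂ] R) (At A1 A2 a3 f fh : R) :
    (2 * Complex.I) • rX dt d1 d2 At A1 A2 a3 f fh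
      = curv dt dt (At - Complex.I • a3) (At + Complex.I • a3)
      + curv (d1 + Complex.I • d2) (d1 - Complex.I • d2) (A1 + Complex.I • A2) (A1 - Complex.I • A2)
      + curv 0 0 f fh := by
  simp only [rX, cov, curv, map_add, map_sub, map_smul, LinearMap.add_apply, LinearMap.sub_apply,
    LinearMap.smul_apply, LinearMap.zero_apply, smul_add, smul_sub, smul_smul, mul_add, mul_sub,
    add_mul, sub_mul, smul_mul_assoc, mul_smul_comm]
  match_scalars <;> (ring_nf; try simp only [Complex.I_sq]; try ring_nf)

lemma two_rlap {dt d1 d2 : R →ₗ[ℂ] R} (ht : IsDer dt) (h1 : IsDer d1) (h2 : IsDer d2)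
    (hc : ∀ x, d1 (d2 x) = d2 (d1 x)) (At A1 A2 a3 f fh u : R) :
    -((2 : ℂ) • rlap dt d1 d2 At A1 A2 a3 f fh u) =
      (cov dt (At - Complex.I • a3) (cov dt (At + Complex.I • a3) u)
        + cov dt (At + Complex.I • a3) (cov dt (At - Complex.I • a3) u))
      + (cov (d1 + Complex.I • d2) (A1 + Complex.I • A2)
          (cov (d1 - Complex.I • d2) (A1 - Complex.I • A2) u)
        + cov (d1 - Complex.I • d2) (A1 - Complex.I • A2)
          (cov (d1 + Complex.I • d2) (A1 + Complex.I • A2) u))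
      + (cov 0 f (cov 0 fh u) + cov 0 fh (cov 0 f u)) := by
  simp only [rlap, cov, map_add, map_sub, map_smul, LinearMap.add_apply, LinearMap.sub_apply,
    LinearMap.smul_apply, LinearMap.zero_apply, smul_add, smul_sub, smul_smul, mul_add, mul_sub,
    add_mul, sub_mul, smul_mul_assoc, mul_smul_comm, ht _ _, h1 _ _, h2 _ _, hc, mul_assoc, neg_mul,
    mul_neg, smul_neg, zero_add]
  match_scalars <;> (ring_nf; try simp only [Complex.I_sq]; try ring_nf)

end Derivations

section FlowIdentities

variable {R : Type*} [Ring R] [Algebra ℂ R]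

/-- Evolution of `𝔛` under the flow generated by `u`. -/
lemma der_rX {ds dt d1 d2 : R →ₗ[ℂ] R} (hs : IsDer ds) (ht : IsDer dt) (h1 : IsDer d1)
    (h2 : IsDer d2) (hc : ∀ x, d1 (d2 x) = d2 (d1 x))
    (hst : ∀ x, ds (dt x) = dt (ds x)) (hs1 : ∀ x, ds (d1 x) = d1 (ds x))
    (hs2 : ∀ x, ds (d2 x) = d2 (ds x)) {At A1 A2 a3 f fh u : R}
    (hb : ds (At - Complex.I • a3) = -(Complex.I • cov dt (At - Complex.I • a3) u))
    (hb' : ds (At + Complex.I • a3) = Complex.I • cov dt (At + Complex.I • a3) u)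
    (hc1 : ds (A1 + Complex.I • A2)
      = -(Complex.I • cov (d1 + Complex.I • d2) (A1 + Complex.I • A2) u))
    (hc2 : ds (A1 - Complex.I • A2)
      = Complex.I • cov (d1 - Complex.I • d2) (A1 - Complex.I • A2) u)
    (hf : ds f = -(Complex.I • cov 0 f u)) (hf' : ds fh = Complex.I • cov 0 fh u) :
    ds (rX dt d1 d2 At A1 A2 a3 f fh) = -rlap dt d1 d2 At A1 A2 a3 f fh u := by
  have hm : IsDer (d1 - Complex.I • d2) := h1.sub (h2.smul _)
  have key : (2 * Complex.I) • ds (rX dt d1 d2 At A1 A2 a3 f fh)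
      = (2 * Complex.I) • (-rlap dt d1 d2 At A1 A2 a3 f fh u) := by
    rw [← map_smul, two_I_rX, map_add, map_add, der_curv hs ht ht hst hst hb hb',
      der_curv hs (h1.add (h2.smul _)) hm (by simp [hs1, hs2]) (by simp [hs1, hs2]) hc1 hc2,
      der_curv hs IsDer.zero IsDer.zero (by simp) (by simp) hf hf', ← smul_add, ← smul_add,
      ← two_rlap ht h1 h2 hc]
    module
  exact (smul_right_injective R (by simp : (2 * Complex.I) ≠ 0)) key

/-- The operator `Δ` in terms of the twisted derivatives. -/
lemma neg_rlap {dt d1 d2 : R →ₗ[ℂ] R} (ht : IsDer dt) (h1 : IsDer d1)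
    (h2 : IsDer d2) (hc : ∀ x, d1 (d2 x) = d2 (d1 x)) (At A1 A2 a3 f fh u : R) :
    -rlap dt d1 d2 At A1 A2 a3 f fh u =
      cov dt (At + Complex.I • a3) (cov dt (At - Complex.I • a3) u)
      + cov (d1 - Complex.I • d2) (A1 - Complex.I • A2)
          (cov (d1 + Complex.I • d2) (A1 + Complex.I • A2) u)
      + cov 0 fh (cov 0 f u)
      + Complex.I • (rX dt d1 d2 At A1 A2 a3 f fh * u - u * rX dt d1 d2 At A1 A2 a3 f fh) := by
  have hm : IsDer (d1 - Complex.I • d2) := h1.sub (h2.smul _)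
  have e1 := cov_cov_sub ht ht (fun _ => rfl) (At - Complex.I • a3) (At + Complex.I • a3) u
  have e2 := cov_cov_sub (h1.add (h2.smul Complex.I)) hm
    (fun x => by
      simp only [LinearMap.add_apply, LinearMap.sub_apply, LinearMap.smul_apply, map_add, map_sub,
        map_smul, hc]
      module)
    (A1 + Complex.I • A2) (A1 - Complex.I • A2) u
  have e3 := cov_cov_sub (IsDer.zero (R := R)) IsDer.zero (fun _ => rfl) f fh u
  have e4 := two_I_rX dt d1 d2 At A1 A2 a3 f fh
  have e5 : (2 * Complex.I) • (rX dt d1 d2 At A1 A2 a3 f fh * u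
      - u * rX dt d1 d2 At A1 A2 a3 f fh)
      = ((2 * Complex.I) • rX dt d1 d2 At A1 A2 a3 f fh) * u
        - u * ((2 * Complex.I) • rX dt d1 d2 At A1 A2 a3 f fh) := by
    rw [smul_mul_assoc, mul_smul_comm, smul_sub]
  rw [e4] at e5
  apply smul_right_injective R (two_ne_zero : (2:ℂ) ≠ 0)
  beta_reduce
  rw [smul_neg, two_rlap ht h1 h2 hc, smul_add, smul_smul, e5]
  rw [sub_eq_iff_eq_add] at e1 e2 e3
  rw [e1, e2, e3]
  simp only [two_smul, mul_add, add_mul]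
  abel

/-- The equation satisfied by the conjugated generator `v = g⁻¹ u g`. -/
lemma lap_of_rlap_eq {dt d1 d2 : R →ₗ[ℂ] R} (ht : IsDer dt) (h1 : IsDer d1)
    (h2 : IsDer d2) (hc : ∀ x, d1 (d2 x) = d2 (d1 x)) {At A1 A2 a3 f fh u g γ b0 c0 f0 v Y : R}
    (hg : g * γ = 1) (hγ : γ * g = 1)
    (hb : At - Complex.I • a3 = gaugeC dt g γ b0)
    (hcz : A1 + Complex.I • A2 = gaugeC (d1 + Complex.I • d2) g γ c0)
    (hf : f = g * f0 * γ) (hu : u = g * v * γ)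
    (hY : rX dt d1 d2 At A1 A2 a3 f fh = g * Y * γ)
    (hlap : rlap dt d1 d2 At A1 A2 a3 f fh u = rX dt d1 d2 At A1 A2 a3 f fh) :
    dt (dt v) + d1 (d1 v) + d2 (d2 v) =
      -(Y + dt (b0 * v - v * b0)
        + cov 0 (γ * (At + Complex.I • a3) * g + γ * dt g) (cov dt b0 v)
        + (d1 - Complex.I • d2) (c0 * v - v * c0)
        + cov 0 (γ * (A1 - Complex.I • A2) * g + γ * (d1 - Complex.I • d2) g)
            (cov (d1 + Complex.I • d2) c0 v)
        + cov 0 (γ * fh * g) (cov 0 f0 v) + Complex.I • (Y * v - v * Y)) := by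
  have hm : IsDer (d1 - Complex.I • d2) := h1.sub (h2.smul _)
  have e := neg_rlap ht h1 h2 hc At A1 A2 a3 f fh u
  have hcf : cov 0 f u = g * cov 0 f0 v * γ := by
    have := cov_gaugeC (IsDer.zero (R := R)) hg hγ f0 v
    simp only [gaugeC, LinearMap.zero_apply, zero_mul, sub_zero] at this
    rw [hf, hu, this]
  rw [hlap, hcf, hb, hcz, hY, hu, cov_gaugeC ht hg hγ, cov_gaugeC (h1.add (h2.smul _)) hg hγ,
    cov_conj ht hg hγ, cov_conj hm hg hγ, cov_conj IsDer.zero hg hγ] at e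
  rw [LinearMap.zero_apply, mul_zero, add_zero] at e
  generalize γ * (At + Complex.I • a3) * g + γ * dt g = ct at e ⊢
  generalize γ * (A1 - Complex.I • A2) * g + γ * (d1 - Complex.I • d2) g = cz at e ⊢
  generalize γ * fh * g = w at e ⊢
  have hγ' : ∀ x, γ * (g * x) = x := fun x => by rw [← mul_assoc, hγ, one_mul]
  have e' : -Y = cov dt ct (cov dt b0 v) + cov (d1 - Complex.I • d2) cz
      (cov (d1 + Complex.I • d2) c0 v) + cov 0 w (cov 0 f0 v) + Complex.I • (Y * v - v * Y) := by
    generalize cov dt ct (cov dt b0 v) = x1 at e ⊢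
    generalize cov (d1 - Complex.I • d2) cz (cov (d1 + Complex.I • d2) c0 v) = x2 at e ⊢
    generalize cov 0 w (cov 0 f0 v) = x3 at e ⊢
    have e' := congrArg (fun x => γ * x * g) e
    simpa only [mul_add, add_mul, mul_sub, sub_mul, mul_assoc, hγ, hγ', mul_one, mul_neg, neg_mul,
      mul_smul_comm, smul_mul_assoc] using e'
  have split : ∀ (d d' : R →ₗ[ℂ] R) (b b' : R), cov d b (cov d' b' v)
      = d (d' v) + d (b' * v - v * b') + cov 0 b (cov d' b' v) := fun d d' b b' => by
    simp only [cov, map_add, LinearMap.zero_apply, zero_add]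
  have hdd : (d1 - Complex.I • d2) ((d1 + Complex.I • d2) v) = d1 (d1 v) + d2 (d2 v) := by
    simp only [LinearMap.add_apply, LinearMap.sub_apply, LinearMap.smul_apply, map_add, map_smul, hc]
    match_scalars <;> (ring_nf; try simp only [Complex.I_sq]; try ring_nf)
  rw [split dt, split (d1 - Complex.I • d2), hdd] at e'
  rw [eq_neg_iff_add_eq_zero]
  rw [← sub_eq_zero] at e'
  rw [← neg_eq_zero, ← e']
  abel

lemma curv_complex (dt d1 d2 : R →ₗ[ℂ] R) (At A1 A2 a3 : R) :
    curv dt (d1 + Complex.I • d2) (At - Complex.I • a3) (A1 + Complex.I • A2)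
      = (curv dt d1 At A1 - cov d2 A2 a3) + Complex.I • (curv dt d2 At A2 + cov d1 A1 a3) := by
  simp only [cov, curv, map_add, map_sub, map_smul, LinearMap.add_apply,
    LinearMap.smul_apply, smul_add, smul_sub, smul_smul, mul_add, mul_sub,
    add_mul, sub_mul, smul_mul_assoc, mul_smul_comm]
  match_scalars <;> (ring_nf; try simp only [Complex.I_sq]; try ring_nf)

lemma cov_complex_z (d1 d2 : R →ₗ[ℂ] R) (A1 A2 f : R) :
    cov (d1 + Complex.I • d2) (A1 + Complex.I • A2) f
      = cov d1 A1 f + Complex.I • cov d2 A2 f := by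
  simp only [cov, LinearMap.add_apply, LinearMap.smul_apply, smul_add, smul_sub, mul_add,
    add_mul, smul_mul_assoc, mul_smul_comm]
  abel

lemma cov_complex_t (dt : R →ₗ[ℂ] R) (At a3 f : R) :
    cov dt (At - Complex.I • a3) f = cov dt At f - Complex.I • (a3 * f - f * a3) := by
  simp only [cov, smul_sub, mul_sub, sub_mul, smul_mul_assoc, mul_smul_comm]
  abel

variable [StarRing R] [StarModule ℂ R]

lemma eq_zero_of_add_I_smul {P Q : R} (hP : star P = -P) (hQ : star Q = -Q)
    (h : P + Complex.I • Q = 0) : P = 0 ∧ Q = 0 := by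
  have h' := congrArg star h
  rw [star_add, star_smul, hP, hQ, star_zero] at h'
  have e : star Complex.I = -Complex.I := Complex.conj_I
  rw [e, neg_smul, smul_neg, neg_neg] at h'
  have hP0 : (2:ℂ) • P = 0 := by
    rw [two_smul]
    calc P + P = (P + Complex.I • Q) - (-P + Complex.I • Q) := by abel
      _ = 0 := by rw [h, h', sub_zero]
  have hP1 : P = 0 := (smul_eq_zero.mp hP0).resolve_left two_ne_zero
  refine ⟨hP1, ?_⟩
  rw [hP1, zero_add] at h
  exact (smul_eq_zero.mp h).resolve_left Complex.I_ne_zero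

end FlowIdentities

/-! ### Functions on the space-time domain of a flow -/

section FlowDomain

/-- The domain `[0, T) × H` of a flow. -/
def flowW (T : ℝ≥0∞) : Set (ℝ × P3) := flowDom T ×ˢ Hsp

/-- The interior `(0, T)` of the parameter domain of a flow. -/
def flowInt (T : ℝ≥0∞) : Set ℝ := {s : ℝ | 0 < s ∧ ENNReal.ofReal s < T}

variable {T : ℝ≥0∞}

lemma flowInt_subset : flowInt T ⊆ flowDom T := fun _ h => ⟨h.1.le, h.2⟩

lemma isOpen_flowInt : IsOpen (flowInt T) :=
  isOpen_Ioi.inter (isOpen_Iio.preimage ENNReal.continuous_ofReal)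

lemma flowInt_nonempty (hT : 0 < T) : (flowInt T).Nonempty := by
  obtain ⟨r, hr0, hr⟩ := ENNReal.lt_iff_exists_nnreal_btwn.mp hT
  exact ⟨r, by simpa using hr0, by simpa using hr⟩

lemma flowDom_mono {s s' : ℝ} (h0 : 0 ≤ s) (hss : s ≤ s') (hs : s' ∈ flowDom T) :
    s ∈ flowDom T := ⟨h0, (ENNReal.ofReal_le_ofReal hss).trans_lt hs.2⟩

lemma flowInt_mono {s s' : ℝ} (h0 : 0 < s) (hss : s ≤ s') (hs : s' ∈ flowDom T) :
    s ∈ flowInt T := ⟨h0, (ENNReal.ofReal_le_ofReal hss).trans_lt hs.2⟩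

lemma convex_flowDom : Convex ℝ (flowDom T) := by
  apply OrdConnected.convex
  exact ⟨fun x hx y hy z hz => flowDom_mono (hx.1.trans hz.1) hz.2 hy⟩

lemma convex_Hsp : Convex ℝ Hsp := by
  have : Hsp = (LinearMap.fst ℝ ℝ (ℝ × ℝ)) ⁻¹' Ioi 0 := rfl
  rw [this]
  exact (convex_Ioi 0).linear_preimage _

lemma flowInt_prod_subset_interior : flowInt T ×ˢ Hsp ⊆ interior (flowW T) :=
  interior_maximal (prod_mono_left flowInt_subset) (isOpen_flowInt.prod isOpen_Hsp)

lemma goodDom_flowW (hT : 0 < T) : GoodDom (flowW T) := by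
  have hc : Convex ℝ (flowW T) := convex_flowDom.prod convex_Hsp
  have hne : (interior (flowW T)).Nonempty := by
    obtain ⟨s, hs⟩ := flowInt_nonempty hT
    exact ⟨(s, (1, 0, 0)), flowInt_prod_subset_interior ⟨hs, (one_pos : (0:ℝ) < 1)⟩⟩
  refine ⟨uniqueDiffOn_convex hc hne, ?_⟩
  rw [hc.closure_interior_eq_closure_of_nonempty_interior hne]
  exact subset_closure

lemma flowW_subset_closure (hT : 0 < T) : flowW T ⊆ closure (flowInt T ×ˢ Hsp) := by
  rintro ⟨s, p⟩ ⟨hs, hp⟩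
  rw [closure_prod_eq]
  refine ⟨?_, subset_closure hp⟩
  obtain ⟨r, hr⟩ := flowInt_nonempty hT
  rcases hs.1.eq_or_lt with h | h
  · have : Ioo 0 r ⊆ flowInt T := fun x hx => flowInt_mono hx.1 hx.2.le (flowInt_subset hr)
    apply closure_mono this
    rw [closure_Ioo hr.1.ne, ← show (0:ℝ) = s from h]
    exact ⟨le_rfl, hr.1.le⟩
  · exact subset_closure ⟨h, hs.2⟩

variable {𝔸 : Type*} [CStarAlgebra 𝔸]

lemma slice_contDiffOn (F : smoothAlg 𝔸 (flowW T)) {s : ℝ} (hs : s ∈ flowDom T) :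
    ContDiffOn ℝ (⊤:ℕ∞) (fun q => F.1 (s, q)) Hsp :=
  (smoothAlg.contDiffOn F).comp (contDiff_prodMk_right s).contDiffOn fun _ hq => ⟨hs, hq⟩

lemma slice_contDiffAt (F : smoothAlg 𝔸 (flowW T)) {s : ℝ} (hs : s ∈ flowDom T) {p : P3}
    (hp : p ∈ Hsp) : ContDiffAt ℝ (⊤:ℕ∞) (fun q => F.1 (s, q)) p :=
  (slice_contDiffOn F hs).contDiffAt (isOpen_Hsp.mem_nhds hp)

lemma fderiv_slice (hW : GoodDom (flowW T)) (F : smoothAlg 𝔸 (flowW T)) {s : ℝ}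
    (hs : s ∈ flowDom T) {p : P3} (hp : p ∈ Hsp) (v : P3) :
    fderiv ℝ (fun q => F.1 (s, q)) p v = (smoothDer hW (0, v) F).1 (s, p) := by
  rw [smoothDer_apply hW _ _ (show (s, p) ∈ flowW T from ⟨hs, hp⟩)]
  have h1 := (smoothAlg.diffWithinAt F (show (s, p) ∈ flowW T from ⟨hs, hp⟩)).hasFDerivWithinAt
  have h2 : HasFDerivWithinAt (fun q : P3 => (s, q)) (ContinuousLinearMap.inr ℝ ℝ P3) Hsp p :=
    (hasFDerivAt_prodMk_right s p).hasFDerivWithinAt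
  have h3 := (h1.comp p h2 fun _ hq => show _ ∈ flowW T from ⟨hs, hq⟩).hasFDerivAt (isOpen_Hsp.mem_nhds hp)
  have h4 := h3.fderiv
  exact (congrArg (fun L => L v) h4).trans rfl

lemma hasDerivAt_slice (hW : GoodDom (flowW T)) (F : smoothAlg 𝔸 (flowW T)) {s : ℝ}
    (hs : s ∈ flowInt T) {p : P3} (hp : p ∈ Hsp) :
    HasDerivAt (fun s' => F.1 (s', p)) ((smoothDer hW (1, 0) F).1 (s, p)) s := by
  have hs' := flowInt_subset hs
  rw [smoothDer_apply hW _ _ (show (s, p) ∈ flowW T from ⟨hs', hp⟩)]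
  have h1 := (smoothAlg.diffWithinAt F (show (s, p) ∈ flowW T from ⟨hs', hp⟩)).hasFDerivWithinAt
  have h2 : HasFDerivWithinAt (fun r : ℝ => (r, p)) (ContinuousLinearMap.inl ℝ ℝ P3) (flowDom T) s :=
    (hasFDerivAt_prodMk_left s p).hasFDerivWithinAt
  have h3 := (h1.comp s h2 fun _ hq => show _ ∈ flowW T from ⟨hq, hp⟩).hasFDerivAt
    (mem_of_superset (isOpen_flowInt.mem_nhds hs) flowInt_subset)
  exact h3.hasDerivAt

end FlowDomain

/-! ### Matrices as a C⋆-algebra -/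

section Transfer

/-- The 2×2 complex matrices with their C⋆-algebra structure. -/
def N2 : Type := CStarMatrix (Fin 2) (Fin 2) ℂ

open scoped ComplexOrder in
instance : CStarAlgebra N2 := inferInstanceAs (CStarAlgebra (CStarMatrix (Fin 2) (Fin 2) ℂ))

/-- The identity map from matrices to the C⋆-algebra of matrices. -/
def toN (X : M2) : N2 := X

/-- The identification of matrices with the C⋆-algebra of matrices, as a linear map. -/
def toNₗ : M2 ≃ₗ[ℝ] N2 where
  toFun := toN
  map_add' _ _ := rfl
  map_smul' _ _ := rfl
  invFun X := X
  left_inv _ := rfl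
  right_inv _ := rfl

instance : FiniteDimensional ℝ N2 := toNₗ.finiteDimensional

/-- The identification of matrices with the C⋆-algebra of matrices. -/
def toNL : M2 ≃L[ℝ] N2 := toNₗ.toContinuousLinearEquiv

lemma toN_mul (X Y : M2) : toN (X * Y) = toN X * toN Y := rfl
lemma toN_add (X Y : M2) : toN (X + Y) = toN X + toN Y := rfl
lemma toN_sub (X Y : M2) : toN (X - Y) = toN X - toN Y := rfl
lemma toN_neg (X : M2) : toN (-X) = -toN X := rfl
lemma toN_smul (c : ℂ) (X : M2) : toN (c • X) = c • toN X := rfl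
lemma toN_star (X : M2) : toN Xᴴ = star (toN X) := rfl
lemma toN_one : toN 1 = 1 := rfl
lemma toN_zero : toN 0 = 0 := rfl
lemma toN_inj {X Y : M2} : toN X = toN Y ↔ X = Y := Iff.rfl

lemma contDiffOn_toN {E : Type*} [NormedAddCommGroup E] [NormedSpace ℝ E] {n : WithTop ℕ∞}
    {f : E → M2} {W : Set E} :
    ContDiffOn ℝ n (fun x => toN (f x)) W ↔ ContDiffOn ℝ n f W :=
  toNL.comp_contDiffOn_iff

lemma fderiv_toN {f : P3 → M2} {p v : P3} :
    fderiv ℝ (fun q => toN (f q)) p v = toN (pd v f p) := by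
  have := toNL.comp_fderiv (f := f) (x := p)
  exact congrArg (fun L => L v) this

lemma deriv_toN {f : ℝ → M2} {s : ℝ} : deriv (fun q => toN (f q)) s = toN (deriv f s) := by
  have := toNL.comp_fderiv (f := f) (x := s)
  exact congrArg (fun L => L 1) this

/-- The map `X ↦ tr X - X`, which inverts matrices of determinant one. -/
def adjL : N2 →L[ℝ] N2 :=
  LinearMap.toContinuousLinearMap (toNₗ.toLinearMap.comp
    (((Algebra.linearMap ℂ M2).comp (Matrix.traceLinearMap (Fin 2) ℂ ℂ)
      - LinearMap.id).restrictScalars ℝ |>.comp toNₗ.symm.toLinearMap))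

lemma adjL_toN (X : M2) : adjL (toN X) = toN X.adjugate := by
  have : adjL (toN X) = toN (algebraMap ℂ M2 X.trace - X) := rfl
  rw [this, Matrix.adjugate_fin_two]
  congr 1
  ext i j
  fin_cases i <;> fin_cases j <;> simp [Matrix.trace_fin_two, Matrix.algebraMap_matrix_apply]

end Transfer

section Representation

variable {T : ℝ≥0∞} {s : ℝ}

/-- The slice at `s` of the space-time function `F` is `h`. -/
def IsSlice (s : ℝ) (F : smoothAlg N2 (flowW T)) (h : P3 → M2) : Prop :=
  ∀ q ∈ Hsp, F.1 (s, q) = toN (h q)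

namespace IsSlice

variable {F G : smoothAlg N2 (flowW T)} {h k : P3 → M2}

lemma add (hF : IsSlice s F h) (hG : IsSlice s G k) : IsSlice s (F + G) (fun p => h p + k p) :=
  fun q hq => by rw [toN_add, ← hF q hq, ← hG q hq]; rfl

lemma sub (hF : IsSlice s F h) (hG : IsSlice s G k) : IsSlice s (F - G) (fun p => h p - k p) :=
  fun q hq => by rw [toN_sub, ← hF q hq, ← hG q hq]; rfl

lemma neg (hF : IsSlice s F h) : IsSlice s (-F) (fun p => -h p) :=
  fun q hq => by rw [toN_neg, ← hF q hq]; rfl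

lemma mul (hF : IsSlice s F h) (hG : IsSlice s G k) : IsSlice s (F * G) (fun p => h p * k p) :=
  fun q hq => by rw [toN_mul, ← hF q hq, ← hG q hq]; rfl

lemma smul (c : ℂ) (hF : IsSlice s F h) : IsSlice s (c • F) (fun p => c • h p) :=
  fun q hq => by rw [toN_smul, ← hF q hq]; rfl

lemma mstar (hF : IsSlice s F h) : IsSlice s (-star F) (fun p => mstar (h p)) :=
  fun q hq => by
    change _ = toN (-(h q)ᴴ)
    rw [toN_neg, toN_star, ← hF q hq]; rfl

lemma mcomm (hF : IsSlice s F h) (hG : IsSlice s G k) : IsSlice s (F * G - G * F) (fun p => mcomm (h p) (k p)) :=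
  (hF.mul hG).sub (hG.mul hF)

lemma pd (hW : GoodDom (flowW T)) (hs : s ∈ flowDom T) (v : P3) (hF : IsSlice s F h) :
    IsSlice s (smoothDer hW (0, v) F) (fun p => pd v h p) := fun q hq => by
  rw [← fderiv_slice hW F hs hq, ← fderiv_toN]
  congr 1
  apply EventuallyEq.fderiv_eq
  filter_upwards [isOpen_Hsp.mem_nhds hq] with q' hq' using hF q' hq'

lemma cd (hW : GoodDom (flowW T)) (hs : s ∈ flowDom T) (v : P3) (hF : IsSlice s F h)
    (hG : IsSlice s G k) : IsSlice s (cov (smoothDer hW (0, v)) F G) (cd h v k) :=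
  (hG.pd hW hs v).add (hF.mcomm hG)

end IsSlice

variable (hW : GoodDom (flowW T)) {At A1 A2 a3 f u : smoothAlg N2 (flowW T)}
  {hAt hA1 hA2 ha3 hf hu : P3 → M2}

lemma IsSlice.XOf (hs : s ∈ flowDom T) (rt : IsSlice s At hAt) (r1 : IsSlice s A1 hA1) (r2 : IsSlice s A2 hA2)
    (r3 : IsSlice s a3 ha3) (rf : IsSlice s f hf) :
    IsSlice s (rX (smoothDer hW (0, et)) (smoothDer hW (0, ez1)) (smoothDer hW (0, ez2)) At A1 A2 a3 f
      (-star f)) (XOf hAt hA1 hA2 ha3 hf) :=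
  ((rt.cd hW hs et r3).sub (((r2.pd hW hs ez1).sub (r1.pd hW hs ez2)).add (r1.mcomm r2))).sub
    ((rf.mcomm rf.mstar).smul _)

lemma IsSlice.neg_cov_zero (rt : IsSlice s At hAt) (ru : IsSlice s u hu) :
    IsSlice s (-cov 0 At u) (fun p => _root_.mcomm (hu p) (hAt p)) := by
  have : -cov 0 At u = u * At - At * u := by simp [cov]
  rw [this]
  exact ru.mcomm rt

lemma IsSlice.cov_zero (rt : IsSlice s At hAt) (ru : IsSlice s u hu) :
    IsSlice s (cov 0 At u) (fun p => _root_.mcomm (hAt p) (hu p)) := by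
  have : cov 0 At u = At * u - u * At := by simp [cov]
  rw [this]
  exact rt.mcomm ru

lemma IsSlice.lapOf (hs : s ∈ flowDom T) (rt : IsSlice s At hAt) (r1 : IsSlice s A1 hA1) (r2 : IsSlice s A2 hA2)
    (r3 : IsSlice s a3 ha3) (rf : IsSlice s f hf) (ru : IsSlice s u hu) :
    IsSlice s (rlap (smoothDer hW (0, et)) (smoothDer hW (0, ez1)) (smoothDer hW (0, ez2)) At A1 A2 a3 f
      (-star f) u) (lapOf hAt hA1 hA2 ha3 hf hu) :=
  have ra1 : IsSlice s ((2:ℂ)⁻¹ • (f + -star f)) (a1Of hf) := (rf.add rf.mstar).smul _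
  have ra2 : IsSlice s ((Complex.I * (2:ℂ)⁻¹) • (f - -star f)) (a2Of hf) := (rf.sub rf.mstar).smul _
  ((((((rt.cd hW hs et (rt.cd hW hs et ru)).add (r1.cd hW hs ez1 (r1.cd hW hs ez1 ru))).add
    (r2.cd hW hs ez2 (r2.cd hW hs ez2 ru))).neg).add (ra1.cov_zero (ra1.neg_cov_zero ru))).add
    (ra2.cov_zero (ra2.neg_cov_zero ru))).add (r3.cov_zero (r3.neg_cov_zero ru))

end Representation

/-! ### The space-time functions of a flow -/

section FlowElements

variable {T : ℝ≥0∞} {s : ℝ}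

open Classical in
/-- A function on `H` as a stationary space-time function. -/
def baseE (T : ℝ≥0∞) {h : P3 → M2} (hh : ContDiffOn ℝ (⊤:ℕ∞) h Hsp) : smoothAlg N2 (flowW T) :=
  ⟨(flowW T).indicator fun x => toN (h x.2), by
    have h1 : ContDiffOn ℝ (⊤:ℕ∞) (fun x : ℝ × P3 => toN (h x.2)) (flowW T) :=
      (contDiffOn_toN.mpr hh).comp contDiff_snd.contDiffOn fun _ hx => hx.2
    exact h1.congr fun x hx => indicator_of_mem hx _⟩

variable {h : P3 → M2} (hh : ContDiffOn ℝ (⊤:ℕ∞) h Hsp)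

lemma baseE_isSlice (hs : s ∈ flowDom T) : IsSlice s (baseE T hh) h := fun q hq =>
  indicator_of_mem (show (s, q) ∈ flowW T from ⟨hs, hq⟩) fun x : ℝ × P3 => toN (h x.2)

lemma baseE_notMem {x : ℝ × P3} (hx : x ∉ flowW T) : (baseE T hh).1 x = 0 :=
  indicator_of_notMem hx fun x : ℝ × P3 => toN (h x.2)

lemma der_baseE (hW : GoodDom (flowW T)) : smoothDer hW (1, 0) (baseE T hh) = 0 := by
  ext1; ext1 x
  by_cases hx : x ∈ flowW T
  · rw [smoothDer_apply hW _ _ hx]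
    have h1 : EqOn (baseE T hh).1 (fun x : ℝ × P3 => toN (h x.2)) (flowW T) :=
      fun y hy => indicator_of_mem hy fun x : ℝ × P3 => toN (h x.2)
    have h2 : DifferentiableWithinAt ℝ (fun p => toN (h p)) Hsp x.2 :=
      (contDiffOn_toN.mpr hh).differentiableOn (by simp) _ hx.2
    have h3 := (h2.hasFDerivWithinAt.comp x (hasFDerivWithinAt_snd (𝕜 := ℝ) (s := flowW T))
      fun y hy => hy.2)
    rw [fderivWithin_congr h1 (h1 hx)]
    erw [h3.fderivWithin (hW.uniqueDiff x hx)]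
    simp
  · rw [smoothDer_apply_notMem hW _ _ hx]; rfl

/-- Two smooth space-time functions which agree inside agree. -/
lemma smoothAlg_ext {𝔸 : Type*} [CStarAlgebra 𝔸] (hT : 0 < T) {F G : smoothAlg 𝔸 (flowW T)}
    (h1 : ∀ s ∈ flowInt T, ∀ p ∈ Hsp, F.1 (s, p) = G.1 (s, p))
    (h2 : ∀ x ∉ flowW T, F.1 x = G.1 x) : F = G := by
  ext1; ext1 x
  by_cases hx : x ∈ flowW T
  · have h3 : EqOn F.1 G.1 (flowInt T ×ˢ Hsp) := fun y hy => h1 y.1 hy.1 y.2 hy.2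
    exact h3.of_subset_closure (smoothAlg.contDiffOn F).continuousOn
      (smoothAlg.contDiffOn G).continuousOn (prod_mono_left flowInt_subset)
      (flowW_subset_closure hT) hx
  · exact h2 x hx

variable {D : DataSet Hsp}

namespace KWFlow

variable (F : KWFlow D T)

open Classical in
/-- The group-valued map of a flow as a space-time function. -/
def gE : smoothAlg N2 (flowW T) :=
  ⟨(flowW T).piecewise (fun x => toN (F.g x.1 x.2)) 1,
    (contDiffOn_toN.mpr F.smooth_g).congr fun _ hx => piecewise_eq_of_mem _ _ _ hx⟩

/-- The inverse of the group-valued map of a flow as a space-time function. -/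
def giE : smoothAlg N2 (flowW T) :=
  ⟨fun x => adjL (F.gE.1 x), adjL.contDiff.comp_contDiffOn (smoothAlg.contDiffOn F.gE)⟩

lemma gE_isSlice (hs : s ∈ flowDom T) : IsSlice s F.gE (F.g s) := fun q hq => by
  classical
  exact piecewise_eq_of_mem (flowW T) (fun x : ℝ × P3 => toN (F.g x.1 x.2)) 1
    (show (s, q) ∈ flowW T from ⟨hs, hq⟩)

lemma gE_notMem {x : ℝ × P3} (hx : x ∉ flowW T) : F.gE.1 x = 1 := by
  classical
  exact piecewise_eq_of_notMem (flowW T) (fun x : ℝ × P3 => toN (F.g x.1 x.2)) 1 hx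

lemma adjL_one : adjL 1 = 1 := by
  rw [← toN_one, adjL_toN, Matrix.adjugate_one]

lemma inv_g {p : P3} (hs : s ∈ flowDom T) (hp : p ∈ Hsp) : (F.g s p)⁻¹ = (F.g s p).adjugate := by
  rw [Matrix.inv_def, F.det_g s hs p hp, Ring.inverse_one, one_smul]

lemma giE_isSlice (hs : s ∈ flowDom T) : IsSlice s F.giE (fun p => (F.g s p)⁻¹) := fun q hq => by
  change adjL (F.gE.1 (s, q)) = toN (F.g s q)⁻¹
  rw [F.gE_isSlice hs q hq, adjL_toN, F.inv_g hs hq]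

lemma giE_notMem {x : ℝ × P3} (hx : x ∉ flowW T) : F.giE.1 x = 1 := by
  change adjL (F.gE.1 x) = _
  rw [F.gE_notMem hx, adjL_one]

lemma gE_mul_giE : F.gE * F.giE = 1 := by
  ext1; ext1 x
  change F.gE.1 x * F.giE.1 x = 1
  by_cases hx : x ∈ flowW T
  · rw [F.gE_isSlice hx.1 x.2 hx.2, F.giE_isSlice hx.1 x.2 hx.2, ← toN_mul,
      Matrix.mul_nonsing_inv _ (by rw [F.det_g _ hx.1 _ hx.2]; exact isUnit_one), toN_one]
  · rw [F.gE_notMem hx, F.giE_notMem hx, mul_one]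

lemma giE_mul_gE : F.giE * F.gE = 1 := by
  ext1; ext1 x
  change F.giE.1 x * F.gE.1 x = 1
  by_cases hx : x ∈ flowW T
  · rw [F.gE_isSlice hx.1 x.2 hx.2, F.giE_isSlice hx.1 x.2 hx.2, ← toN_mul,
      Matrix.nonsing_inv_mul _ (by rw [F.det_g _ hx.1 _ hx.2]; exact isUnit_one), toN_one]
  · rw [F.gE_notMem hx, F.giE_notMem hx, mul_one]

end KWFlow

end FlowElements

section FlowData

variable {T : ℝ≥0∞} {s : ℝ}

/-- The flow derivative of space-time functions. -/
abbrev dsE {𝔸 : Type*} [CStarAlgebra 𝔸] (hW : GoodDom (flowW T)) :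
    smoothAlg 𝔸 (flowW T) →ₗ[ℂ] smoothAlg 𝔸 (flowW T) := smoothDer hW (1, 0)

/-- The spatial derivatives of space-time functions. -/
abbrev dxE {𝔸 : Type*} [CStarAlgebra 𝔸] (hW : GoodDom (flowW T)) (v : P3) :
    smoothAlg 𝔸 (flowW T) →ₗ[ℂ] smoothAlg 𝔸 (flowW T) := smoothDer hW (0, v)

lemma isDer_smoothDer {E : Type*} [NormedAddCommGroup E] [NormedSpace ℝ E] {𝔸 : Type*}
    [CStarAlgebra 𝔸] {W : Set E} (hW : GoodDom W) (v : E) :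
    IsDer (smoothDer (𝔸 := 𝔸) hW v) := smoothDer_mul hW v

variable {D : DataSet Hsp}

lemma IsSlice.star {F : smoothAlg N2 (flowW T)} {h : P3 → M2} (hF : IsSlice s F h) :
    IsSlice s (star F) (fun p => (h p)ᴴ) :=
  fun q hq => by
    rw [toN_star, ← hF q hq]; rfl

lemma IsSlice.of_eq {F : smoothAlg N2 (flowW T)} {h k : P3 → M2} (hF : IsSlice s F h)
    (hk : ∀ p ∈ Hsp, h p = k p) : IsSlice s F k := fun q hq => by rw [hF q hq, hk q hq]

/-- The connection component `A_t - i a₃` of the base data set. -/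
def DataSet.bE (D : DataSet Hsp) (T : ℝ≥0∞) : smoothAlg N2 (flowW T) :=
  baseE T D.smooth_At - Complex.I • baseE T D.smooth_a3

/-- The connection component `A₁ + i A₂` of the base data set. -/
def DataSet.cE (D : DataSet Hsp) (T : ℝ≥0∞) : smoothAlg N2 (flowW T) :=
  baseE T D.smooth_A1 + Complex.I • baseE T D.smooth_A2

/-- The Higgs field of the base data set. -/
def DataSet.fE (D : DataSet Hsp) (T : ℝ≥0∞) : smoothAlg N2 (flowW T) := baseE T D.smooth_phi

lemma DataSet.bE_isSlice (hs : s ∈ flowDom T) :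
    IsSlice s (D.bE T) (fun p => D.At p - Complex.I • D.a3 p) :=
  (baseE_isSlice _ hs).sub ((baseE_isSlice _ hs).smul _)

lemma DataSet.cE_isSlice (hs : s ∈ flowDom T) :
    IsSlice s (D.cE T) (fun p => D.A1 p + Complex.I • D.A2 p) :=
  (baseE_isSlice _ hs).add ((baseE_isSlice _ hs).smul _)

lemma DataSet.fE_isSlice (hs : s ∈ flowDom T) : IsSlice s (D.fE T) D.phi := baseE_isSlice _ hs

namespace KWFlow

variable (F : KWFlow D T) (hW : GoodDom (flowW T))

/-- The connection component `A_t - i a₃` along the flow. -/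
def bE : smoothAlg N2 (flowW T) := gaugeC (dxE hW et) F.gE F.giE (D.bE T)

/-- The connection component `A₁ + i A₂` along the flow. -/
def cE : smoothAlg N2 (flowW T) :=
  gaugeC (dxE hW ez1 + Complex.I • dxE hW ez2) F.gE F.giE (D.cE T)

/-- The Higgs field along the flow. -/
def fE : smoothAlg N2 (flowW T) := F.gE * D.fE T * F.giE

/-- The component `A_t` along the flow. -/
def AtE : smoothAlg N2 (flowW T) := (2:ℂ)⁻¹ • (F.bE hW - star (F.bE hW))

/-- The component `a₃` along the flow. -/
def a3E : smoothAlg N2 (flowW T) := (Complex.I * (2:ℂ)⁻¹) • (F.bE hW + star (F.bE hW))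

/-- The component `A₁` along the flow. -/
def A1E : smoothAlg N2 (flowW T) := (2:ℂ)⁻¹ • (F.cE hW - star (F.cE hW))

/-- The component `A₂` along the flow. -/
def A2E : smoothAlg N2 (flowW T) := (-Complex.I * (2:ℂ)⁻¹) • (F.cE hW + star (F.cE hW))

/-- The generator of the flow. -/
def uE : smoothAlg N2 (flowW T) := -(Complex.I • (dsE hW F.gE * F.giE))

/-- The conjugated generator `g⁻¹ u g` of the flow. -/
def vE : smoothAlg N2 (flowW T) := F.giE * F.uE hW * F.gE

/-- The function `𝔛` along the flow. -/
def XE : smoothAlg N2 (flowW T) :=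
  rX (dxE hW et) (dxE hW ez1) (dxE hW ez2) (F.AtE hW) (F.A1E hW) (F.A2E hW) (F.a3E hW) F.fE
    (-star F.fE)

lemma bE_isSlice (hs : s ∈ flowDom T) :
    IsSlice s (F.bE hW) (fun p => (F.Ds s).At p - Complex.I • (F.Ds s).a3 p) := by
  have rg := F.gE_isSlice hs
  have ri := F.giE_isSlice hs
  refine (((rg.mul (D.bE_isSlice hs)).mul ri).sub ((rg.pd hW hs et).mul ri)).of_eq fun p hp => ?_
  have e := F.eq_t s hs p hp
  have hgi : F.g s p * (F.g s p)⁻¹ = 1 :=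
    Matrix.mul_nonsing_inv _ (by rw [F.det_g _ hs _ hp]; exact isUnit_one)
  have e2 : (F.Ds s).At p - Complex.I • (F.Ds s).a3 p
      = (((F.Ds s).At p - D.At p) - Complex.I • ((F.Ds s).a3 p - D.a3 p))
        + (D.At p - Complex.I • D.a3 p) * (F.g s p * (F.g s p)⁻¹) := by
    rw [hgi, mul_one, smul_sub]; abel
  rw [e2, e]
  simp only [cd, mcomm, mul_sub, sub_mul, add_mul, smul_sub, mul_assoc, smul_mul_assoc,
    mul_smul_comm]
  abel

lemma cE_isSlice (hs : s ∈ flowDom T) :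
    IsSlice s (F.cE hW) (fun p => (F.Ds s).A1 p + Complex.I • (F.Ds s).A2 p) := by
  have rg := F.gE_isSlice hs
  have ri := F.giE_isSlice hs
  refine (((rg.mul (D.cE_isSlice hs)).mul ri).sub
    (((rg.pd hW hs ez1).add ((rg.pd hW hs ez2).smul _)).mul ri)).of_eq fun p hp => ?_
  have e := F.eq_z s hs p hp
  have hgi : F.g s p * (F.g s p)⁻¹ = 1 :=
    Matrix.mul_nonsing_inv _ (by rw [F.det_g _ hs _ hp]; exact isUnit_one)
  have e2 : (F.Ds s).A1 p + Complex.I • (F.Ds s).A2 p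
      = (((F.Ds s).A1 p - D.A1 p) + Complex.I • ((F.Ds s).A2 p - D.A2 p))
        + (D.A1 p + Complex.I • D.A2 p) * (F.g s p * (F.g s p)⁻¹) := by
    rw [hgi, mul_one, smul_sub]; abel
  rw [e2, e]
  simp only [cd, mcomm, mul_add, sub_mul, add_mul, smul_sub, smul_add, mul_assoc,
    smul_mul_assoc, mul_smul_comm]
  abel

lemma fE_isSlice (hs : s ∈ flowDom T) : IsSlice s F.fE (F.Ds s).phi :=
  (((F.gE_isSlice hs).mul (D.fE_isSlice hs)).mul (F.giE_isSlice hs)).of_eq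
    fun p hp => (F.eq_phi s hs p hp).symm

end KWFlow

lemma half_sub_conj {A a : M2} (hA : IsSU2 A) (ha : IsSU2 a) :
    (2:ℂ)⁻¹ • ((A - Complex.I • a) - (A - Complex.I • a)ᴴ) = A := by
  rw [Matrix.conjTranspose_sub, Matrix.conjTranspose_smul, hA.2, ha.2, smul_neg,
    show star Complex.I = -Complex.I from Complex.conj_I]
  module

lemma half_add_conj {A a : M2} (hA : IsSU2 A) (ha : IsSU2 a) :
    (Complex.I * (2:ℂ)⁻¹) • ((A - Complex.I • a) + (A - Complex.I • a)ᴴ) = a := by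
  rw [Matrix.conjTranspose_sub, Matrix.conjTranspose_smul, hA.2, ha.2, smul_neg,
    show star Complex.I = -Complex.I from Complex.conj_I]
  match_scalars <;> (ring_nf; try simp only [Complex.I_sq]; try ring_nf)

namespace KWFlow

variable (F : KWFlow D T) (hW : GoodDom (flowW T))

lemma AtE_isSlice (hs : s ∈ flowDom T) : IsSlice s (F.AtE hW) (F.Ds s).At :=
  (((F.bE_isSlice hW hs).sub (F.bE_isSlice hW hs).star).smul _).of_eq fun p hp =>
    half_sub_conj ((F.Ds s).su2_At p hp) ((F.Ds s).su2_a3 p hp)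

lemma a3E_isSlice (hs : s ∈ flowDom T) : IsSlice s (F.a3E hW) (F.Ds s).a3 :=
  (((F.bE_isSlice hW hs).add (F.bE_isSlice hW hs).star).smul _).of_eq fun p hp =>
    half_add_conj ((F.Ds s).su2_At p hp) ((F.Ds s).su2_a3 p hp)

lemma A1E_isSlice (hs : s ∈ flowDom T) : IsSlice s (F.A1E hW) (F.Ds s).A1 :=
  (((F.cE_isSlice hW hs).sub (F.cE_isSlice hW hs).star).smul _).of_eq fun p hp => by
    have h1 := (F.Ds s).su2_A1 p hp
    have h2 := (F.Ds s).su2_A2 p hp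
    rw [Matrix.conjTranspose_add, Matrix.conjTranspose_smul, h1.2, h2.2, smul_neg,
      show star Complex.I = -Complex.I from Complex.conj_I]
    module

lemma A2E_isSlice (hs : s ∈ flowDom T) : IsSlice s (F.A2E hW) (F.Ds s).A2 :=
  (((F.cE_isSlice hW hs).add (F.cE_isSlice hW hs).star).smul _).of_eq fun p hp => by
    have h1 := (F.Ds s).su2_A1 p hp
    have h2 := (F.Ds s).su2_A2 p hp
    rw [Matrix.conjTranspose_add, Matrix.conjTranspose_smul, h1.2, h2.2, smul_neg,
      show star Complex.I = -Complex.I from Complex.conj_I]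
    match_scalars <;> (ring_nf; try simp only [Complex.I_sq]; try ring_nf)

lemma XE_isSlice (hs : s ∈ flowDom T) : IsSlice s (F.XE hW) (F.Ds s).X :=
  IsSlice.XOf hW hs (F.AtE_isSlice hW hs) (F.A1E_isSlice hW hs) (F.A2E_isSlice hW hs)
    (F.a3E_isSlice hW hs) (F.fE_isSlice hs)

lemma dsE_gE_isSlice (hs : s ∈ flowInt T) :
    IsSlice s (dsE hW F.gE) (fun p => deriv (fun s' => F.g s' p) s) := fun p hp => by
  rw [← deriv_toN, ← (hasDerivAt_slice hW F.gE hs hp).deriv]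
  apply EventuallyEq.deriv_eq
  filter_upwards [isOpen_flowInt.mem_nhds hs] with s' hs'
  exact F.gE_isSlice (flowInt_subset hs') p hp

lemma uE_isSlice (hs : s ∈ flowInt T) : IsSlice s (F.uE hW) (F.u s) :=
  (((F.dsE_gE_isSlice hW hs).mul (F.giE_isSlice (flowInt_subset hs))).smul Complex.I).neg.of_eq
    fun p hp => by rw [F.u_def s (flowInt_subset hs) p hp, neg_smul]

end KWFlow

end FlowData

section FlowEvolution

variable {T : ℝ≥0∞} {s : ℝ} {D : DataSet Hsp}

lemma smoothAlg.neg_mul {E : Type*} [NormedAddCommGroup E] [NormedSpace ℝ E] {𝔸 : Type*}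
    [CStarAlgebra 𝔸] {W : Set E} (a b : smoothAlg 𝔸 W) : -a * b = -(a * b) := _root_.neg_mul a b

lemma smoothAlg.mul_neg {E : Type*} [NormedAddCommGroup E] [NormedSpace ℝ E] {𝔸 : Type*}
    [CStarAlgebra 𝔸] {W : Set E} (a b : smoothAlg 𝔸 W) : a * -b = -(a * b) := _root_.mul_neg a b

lemma star_cov {E : Type*} [NormedAddCommGroup E] [NormedSpace ℝ E] {𝔸 : Type*}
    [CStarAlgebra 𝔸] {W : Set E} (d d' : smoothAlg 𝔸 W →ₗ[ℂ] smoothAlg 𝔸 W)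
    (hd : ∀ x, d' (star x) = star (d x)) (b u : smoothAlg 𝔸 W) (hu : star u = -u) :
    star (cov d b u) = -cov d' (-star b) u := by
  have h1 : star (d u) = -d' u := by rw [← hd, hu, map_neg]
  simp only [cov, star_add, star_sub, star_mul, hu, h1, smoothAlg.neg_mul, smoothAlg.mul_neg, neg_add, neg_sub]

lemma der_neg_star {E : Type*} [NormedAddCommGroup E] [NormedSpace ℝ E] {𝔸 : Type*}
    [CStarAlgebra 𝔸] {W : Set E} (ds d d' : smoothAlg 𝔸 W →ₗ[ℂ] smoothAlg 𝔸 W)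
    (hs : ∀ x, ds (star x) = star (ds x))
    (hd : ∀ x, d' (star x) = star (d x)) {b u : smoothAlg 𝔸 W} (hu : star u = -u)
    (hb : ds b = -(Complex.I • cov d b u)) :
    ds (-star b) = Complex.I • cov d' (-star b) u := by
  rw [map_neg, hs, hb, star_neg, star_smul, star_cov d d' hd b u hu,
    show star Complex.I = -Complex.I from Complex.conj_I]
  module

namespace KWFlow

variable (F : KWFlow D T) (hW : GoodDom (flowW T))

lemma dsE_gE : dsE hW F.gE = Complex.I • (F.uE hW * F.gE) := by
  simp only [uE, smoothAlg.neg_mul, smul_neg, smul_mul_assoc, smul_smul, mul_assoc, F.giE_mul_gE, mul_one,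
    Complex.I_mul_I, neg_one_smul, neg_neg]

lemma dsE_gE' : dsE hW F.gE = Complex.I • (F.gE * F.vE hW) := by
  rw [dsE_gE, vE, ← mul_assoc, ← mul_assoc, F.gE_mul_giE, one_mul]

lemma uE_eq : F.uE hW = F.gE * F.vE hW * F.giE := by
  rw [vE, ← mul_assoc, ← mul_assoc, F.gE_mul_giE, one_mul, mul_assoc, F.gE_mul_giE, mul_one]

lemma uE_notMem {x : ℝ × P3} (hx : x ∉ flowW T) : (F.uE hW).1 x = 0 := by
  change -(Complex.I • ((dsE hW F.gE).1 x * F.giE.1 x)) = 0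
  rw [smoothDer_apply_notMem hW _ _ hx, zero_mul, smul_zero, neg_zero]

lemma star_uE (hT : 0 < T) : star (F.uE hW) = -F.uE hW := by
  apply smoothAlg_ext hT
  · intro s hs p hp
    have h1 := (F.uE_isSlice hW hs).star p hp
    have h2 := (F.uE_isSlice hW hs).neg p hp
    rw [h1, h2]
    exact congrArg toN (F.su2_u s (flowInt_subset hs) p hp).2
  · intro x hx
    change star ((F.uE hW).1 x) = -(F.uE hW).1 x
    rw [F.uE_notMem hW hx, star_zero, neg_zero]

lemma bE_notMem {x : ℝ × P3} (hx : x ∉ flowW T) : (F.bE hW).1 x = 0 := by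
  change F.gE.1 x * ((baseE T D.smooth_At).1 x - Complex.I • (baseE T D.smooth_a3).1 x)
    * F.giE.1 x - (dxE hW et F.gE).1 x * F.giE.1 x = 0
  rw [smoothDer_apply_notMem hW _ _ hx, baseE_notMem _ hx, baseE_notMem _ hx]
  simp

lemma cE_notMem {x : ℝ × P3} (hx : x ∉ flowW T) : (F.cE hW).1 x = 0 := by
  change F.gE.1 x * ((baseE T D.smooth_A1).1 x + Complex.I • (baseE T D.smooth_A2).1 x)
    * F.giE.1 x - ((dxE hW ez1 F.gE).1 x + Complex.I • (dxE hW ez2 F.gE).1 x) * F.giE.1 x = 0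
  rw [smoothDer_apply_notMem hW _ _ hx, smoothDer_apply_notMem hW _ _ hx, baseE_notMem _ hx,
    baseE_notMem _ hx]
  simp

lemma fE_notMem {x : ℝ × P3} (hx : x ∉ flowW T) : F.fE.1 x = 0 := by
  change F.gE.1 x * (baseE T D.smooth_phi).1 x * F.giE.1 x = 0
  rw [baseE_notMem _ hx]
  simp

end KWFlow

/-- Evaluation of a space-time function at a point. -/
def evalE {E : Type*} [NormedAddCommGroup E] [NormedSpace ℝ E] (𝔸 : Type*)
    [CStarAlgebra 𝔸] (W : Set E) (x : E) : smoothAlg 𝔸 W →ₐ[ℂ] 𝔸 where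
  toFun f := f.1 x
  map_one' := rfl
  map_mul' _ _ := rfl
  map_zero' := rfl
  map_add' _ _ := rfl
  commutes' _ := rfl

namespace KWFlow

variable (F : KWFlow D T) (hW : GoodDom (flowW T))

lemma rlap_uE (hT : 0 < T) :
    rlap (dxE hW et) (dxE hW ez1) (dxE hW ez2) (F.AtE hW) (F.A1E hW) (F.A2E hW) (F.a3E hW) F.fE
      (-star F.fE) (F.uE hW) = F.XE hW := by
  apply smoothAlg_ext hT
  · intro s hs p hp
    have hs' := flowInt_subset hs
    have h1 := IsSlice.lapOf hW hs' (F.AtE_isSlice hW hs') (F.A1E_isSlice hW hs')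
      (F.A2E_isSlice hW hs') (F.a3E_isSlice hW hs') (F.fE_isSlice hs') (F.uE_isSlice hW hs) p hp
    rw [h1, F.XE_isSlice hW hs' p hp]
    exact congrArg toN (F.lap_eq s hs' p hp)
  · intro x hx
    let ev := evalE N2 (flowW T) x
    have hd : ∀ (v : P3) (f : smoothAlg N2 (flowW T)), ev (dxE hW v f) = 0 :=
      fun v f => smoothDer_apply_notMem hW _ _ hx
    have hu : ev (F.uE hW) = 0 := F.uE_notMem hW hx
    have hb : ev (F.bE hW) = 0 := F.bE_notMem hW hx
    have hc : ev (F.cE hW) = 0 := F.cE_notMem hW hx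
    have hf : ev F.fE = 0 := F.fE_notMem hx
    have hbs : ev (star (F.bE hW)) = 0 := by
      change star ((F.bE hW).1 x) = 0; rw [F.bE_notMem hW hx, star_zero]
    have hcs : ev (star (F.cE hW)) = 0 := by
      change star ((F.cE hW).1 x) = 0; rw [F.cE_notMem hW hx, star_zero]
    have ht : ev (F.AtE hW) = 0 := by simp [AtE, hb, hbs]
    have h3 : ev (F.a3E hW) = 0 := by simp [a3E, hb, hbs]
    have h1 : ev (F.A1E hW) = 0 := by simp [A1E, hc, hcs]
    have h2 : ev (F.A2E hW) = 0 := by simp [A2E, hc, hcs]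
    change ev (rlap _ _ _ _ _ _ _ _ _ _) = ev (F.XE hW)
    simp only [rlap, XE, rX, cov, curv, map_add, map_sub, map_neg, map_mul, map_smul, hd, hu, ht,
      h1, h2, h3, hf, LinearMap.zero_apply, map_zero, zero_mul, mul_zero, sub_zero,
      add_zero, neg_zero, smul_zero]

lemma AtE_sub : F.AtE hW - Complex.I • F.a3E hW = F.bE hW := by
  rw [AtE, a3E]
  match_scalars <;> (ring_nf; try simp only [Complex.I_sq]; try ring_nf)

lemma AtE_add : F.AtE hW + Complex.I • F.a3E hW = -star (F.bE hW) := by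
  rw [AtE, a3E]
  match_scalars <;> (ring_nf; try simp only [Complex.I_sq]; try ring_nf)

lemma A1E_add : F.A1E hW + Complex.I • F.A2E hW = F.cE hW := by
  rw [A1E, A2E]
  match_scalars <;> (ring_nf; try simp only [Complex.I_sq]; try ring_nf)

lemma A1E_sub : F.A1E hW - Complex.I • F.A2E hW = -star (F.cE hW) := by
  rw [A1E, A2E]
  match_scalars <;> (ring_nf; try simp only [Complex.I_sq]; try ring_nf)

lemma dsE_XE (hT : 0 < T) : dsE hW (F.XE hW) = -F.XE hW := by
  have hc : ∀ v w x, smoothDer hW v (smoothDer hW w x)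
    = smoothDer (𝔸 := N2) hW w (smoothDer hW v x) := fun v w x => smoothDer_comm hW v w x
  have hst := smoothDer_star (𝔸 := N2) hW (1, 0)
  have hb0 : dsE hW (D.bE T) = 0 := by
    rw [DataSet.bE, map_sub, map_smul, der_baseE, der_baseE, smul_zero, sub_zero]
  have hc0 : dsE hW (D.cE T) = 0 := by
    rw [DataSet.cE, map_add, map_smul, der_baseE, der_baseE, smul_zero, add_zero]
  have hf0 : dsE hW (D.fE T) = 0 := der_baseE _ hW
  have hb := der_gaugeC (isDer_smoothDer hW (1, 0)) (isDer_smoothDer hW (0, et)) (hc _ _)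
    F.gE_mul_giE F.giE_mul_gE (F.dsE_gE hW) hb0
  have hcz := der_gaugeC (isDer_smoothDer hW (1, 0))
    ((isDer_smoothDer hW (0, ez1)).add ((isDer_smoothDer hW (0, ez2)).smul Complex.I))
    (fun x => by simp [hc (1, 0)]) F.gE_mul_giE F.giE_mul_gE (F.dsE_gE hW) hc0
  have hf := der_gaugeC (isDer_smoothDer hW (1, 0)) IsDer.zero (fun x => by simp)
    F.gE_mul_giE F.giE_mul_gE (F.dsE_gE hW) hf0
  simp only [gaugeC, LinearMap.zero_apply, zero_mul, sub_zero] at hf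
  have hu := F.star_uE hW hT
  have hb1 : dsE hW (F.AtE hW - Complex.I • F.a3E hW)
      = -(Complex.I • cov (dxE hW et) (F.AtE hW - Complex.I • F.a3E hW) (F.uE hW)) := by
    rw [F.AtE_sub hW]; exact hb
  have hb2 : dsE hW (F.AtE hW + Complex.I • F.a3E hW)
      = Complex.I • cov (dxE hW et) (F.AtE hW + Complex.I • F.a3E hW) (F.uE hW) := by
    rw [F.AtE_add hW]
    exact der_neg_star _ _ _ hst (smoothDer_star hW (0, et)) hu hb
  have hc1 : dsE hW (F.A1E hW + Complex.I • F.A2E hW) = -(Complex.I •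
      cov (dxE hW ez1 + Complex.I • dxE hW ez2) (F.A1E hW + Complex.I • F.A2E hW) (F.uE hW)) := by
    rw [F.A1E_add hW]; exact hcz
  have hc2 : dsE hW (F.A1E hW - Complex.I • F.A2E hW) = Complex.I •
      cov (dxE hW ez1 - Complex.I • dxE hW ez2) (F.A1E hW - Complex.I • F.A2E hW) (F.uE hW) := by
    rw [F.A1E_sub hW]
    refine der_neg_star _ _ _ hst (fun x => ?_) hu hcz
    simp only [LinearMap.add_apply, LinearMap.sub_apply, LinearMap.smul_apply, smoothDer_star,
      star_add, star_smul, show star Complex.I = -Complex.I from Complex.conj_I]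
    module
  have hf2 : dsE hW (-star F.fE) = Complex.I • cov 0 (-star F.fE) (F.uE hW) :=
    der_neg_star _ _ _ hst (by simp) hu hf
  have key := der_rX (isDer_smoothDer hW (1, 0)) (isDer_smoothDer hW (0, et))
    (isDer_smoothDer hW (0, ez1)) (isDer_smoothDer hW (0, ez2)) (hc _ _) (hc _ _) (hc _ _) (hc _ _)
    hb1 hb2 hc1 hc2 hf hf2
  exact key.trans (congrArg Neg.neg (F.rlap_uE hW hT))

end KWFlow

end FlowEvolution

section FlowX

variable {T : ℝ≥0∞} {s : ℝ} {D : DataSet Hsp}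

lemma hasDerivWithinAt_slice {𝔸 : Type*} [CStarAlgebra 𝔸] (hW : GoodDom (flowW T))
    (F : smoothAlg 𝔸 (flowW T)) (hs : s ∈ flowDom T) {p : P3} (hp : p ∈ Hsp) :
    HasDerivWithinAt (fun s' => F.1 (s', p)) ((smoothDer hW (1, 0) F).1 (s, p)) (flowDom T) s := by
  rw [smoothDer_apply hW _ _ (show (s, p) ∈ flowW T from ⟨hs, hp⟩)]
  have h1 := (smoothAlg.diffWithinAt F (show (s, p) ∈ flowW T from ⟨hs, hp⟩)).hasFDerivWithinAt
  have h2 : HasFDerivWithinAt (fun r : ℝ => (r, p)) (ContinuousLinearMap.inl ℝ ℝ P3)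
      (flowDom T) s := (hasFDerivAt_prodMk_left s p).hasFDerivWithinAt
  exact (h1.comp s h2 fun _ hq => show _ ∈ flowW T from ⟨hq, hp⟩).hasDerivWithinAt

lemma Icc_subset_flowDom (hs : s ∈ flowDom T) : Icc 0 s ⊆ flowDom T :=
  fun _ hr => flowDom_mono hr.1 hr.2 hs

namespace KWFlow

variable (F : KWFlow D T) (hW : GoodDom (flowW T))

lemma eq_of_sub_I_smul_eq {A a A' a' : M2} (hA : IsSU2 A) (ha : IsSU2 a) (hA' : IsSU2 A')
    (ha' : IsSU2 a') (h : A - Complex.I • a = A' - Complex.I • a') : A = A' ∧ a = a' := by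
  constructor
  · rw [← half_sub_conj hA ha, h, half_sub_conj hA' ha']
  · rw [← half_add_conj hA ha, h, half_add_conj hA' ha']

lemma IsSU2.neg' {A : M2} (hA : IsSU2 A) : IsSU2 (-A) :=
  ⟨by rw [Matrix.trace_neg, hA.1, neg_zero], by rw [Matrix.conjTranspose_neg, hA.2]⟩

lemma pd_g_zero {p : P3} (hp : p ∈ Hsp) (v : P3) : pd v (F.g 0) p = 0 := by
  have : F.g 0 =ᶠ[𝓝 p] fun _ => 1 := by
    filter_upwards [isOpen_Hsp.mem_nhds hp] with q hq using F.g_zero q hq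
  rw [pd, this.fderiv_eq, fderiv_fun_const]
  rfl

lemma Ds_zero (h0 : 0 ∈ flowDom T) {p : P3} (hp : p ∈ Hsp) :
    (F.Ds 0).At p = D.At p ∧ (F.Ds 0).A1 p = D.A1 p ∧ (F.Ds 0).A2 p = D.A2 p
      ∧ (F.Ds 0).a3 p = D.a3 p ∧ (F.Ds 0).phi p = D.phi p := by
  have et' := F.eq_t 0 h0 p hp
  have ez' := F.eq_z 0 h0 p hp
  have ep := F.eq_phi 0 h0 p hp
  simp only [cd, mcomm, F.pd_g_zero hp, F.g_zero p hp, mul_one, one_mul, sub_self, add_zero,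
    smul_zero, neg_zero, inv_one] at et' ez' ep
  obtain ⟨h1, h2⟩ := eq_of_sub_I_smul_eq ((F.Ds 0).su2_At p hp) ((F.Ds 0).su2_a3 p hp)
    (D.su2_At p hp) (D.su2_a3 p hp) (by rw [← sub_eq_zero, ← et', smul_sub]; abel)
  obtain ⟨h3, h4⟩ := eq_of_sub_I_smul_eq ((F.Ds 0).su2_A1 p hp)
    (IsSU2.neg' ((F.Ds 0).su2_A2 p hp)) (D.su2_A1 p hp) (IsSU2.neg' (D.su2_A2 p hp))
    (by rw [← sub_eq_zero, ← ez', smul_sub, smul_neg, smul_neg]; abel)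
  exact ⟨h1, h3, neg_injective h4, h2, ep⟩

lemma XE_isSlice_zero (h0 : 0 ∈ flowDom T) : IsSlice 0 (F.XE hW) D.X :=
  IsSlice.XOf hW h0 ((F.AtE_isSlice hW h0).of_eq fun _ hp => (F.Ds_zero h0 hp).1)
    ((F.A1E_isSlice hW h0).of_eq fun _ hp => (F.Ds_zero h0 hp).2.1)
    ((F.A2E_isSlice hW h0).of_eq fun _ hp => (F.Ds_zero h0 hp).2.2.1)
    ((F.a3E_isSlice hW h0).of_eq fun _ hp => (F.Ds_zero h0 hp).2.2.2.1)
    ((F.fE_isSlice h0).of_eq fun _ hp => (F.Ds_zero h0 hp).2.2.2.2)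

lemma XE_eq (hT : 0 < T) (hs : s ∈ flowDom T) {p : P3} (hp : p ∈ Hsp) :
    (F.XE hW).1 (s, p) = Real.exp (-s) • toN (D.X p) := by
  have hsub := Icc_subset_flowDom hs
  have hder : ∀ r ∈ Icc 0 s, HasDerivWithinAt (fun r => Real.exp r • (F.XE hW).1 (r, p)) 0
      (Icc 0 s) r := fun r hr => by
    have h1 := (hasDerivWithinAt_slice hW (F.XE hW) (hsub hr) hp).mono hsub
    have h2 := ((Real.hasDerivAt_exp r).hasDerivWithinAt (s := Icc 0 s)).smul h1
    have e : (smoothDer hW (1, 0) (F.XE hW)).1 (r, p) = -(F.XE hW).1 (r, p) :=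
      congrFun (congrArg Subtype.val (F.dsE_XE hW hT)) (r, p)
    rw [e, smul_neg, neg_add_cancel] at h2
    exact h2
  have hc := constant_of_derivWithin_zero (fun r hr => (hder r hr).differentiableWithinAt)
    (fun r hr => (hder r (Ico_subset_Icc_self hr)).derivWithin
      (uniqueDiffOn_Icc (hr.1.trans_lt hr.2) r (Ico_subset_Icc_self hr))) s
    (right_mem_Icc.mpr hs.1)
  have h0 := F.XE_isSlice_zero hW (hsub (left_mem_Icc.mpr hs.1)) p hp
  rw [Real.exp_zero, one_smul, h0] at hc
  rw [← hc, smul_smul, ← Real.exp_add, neg_add_cancel, Real.exp_zero, one_smul]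

lemma Ds_X (hT : 0 < T) (hs : s ∈ flowDom T) {p : P3} (hp : p ∈ Hsp) :
    (F.Ds s).X p = Real.exp (-s) • D.X p :=
  (F.XE_isSlice (goodDom_flowW hT) hs p hp).symm.trans (F.XE_eq (goodDom_flowW hT) hT hs hp)

/-- The equation satisfied by the conjugated generator `v = g⁻¹ u g` of the flow. -/
lemma lap_vE (hT : 0 < T) :
    dxE hW et (dxE hW et (F.vE hW)) + dxE hW ez1 (dxE hW ez1 (F.vE hW))
      + dxE hW ez2 (dxE hW ez2 (F.vE hW)) =
      -(F.giE * F.XE hW * F.gE + dxE hW et (D.bE T * F.vE hW - F.vE hW * D.bE T)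
        + cov 0 (F.giE * -star (F.bE hW) * F.gE + F.giE * dxE hW et F.gE)
            (cov (dxE hW et) (D.bE T) (F.vE hW))
        + (dxE hW ez1 (D.cE T * F.vE hW - F.vE hW * D.cE T)
          - Complex.I • dxE hW ez2 (D.cE T * F.vE hW - F.vE hW * D.cE T))
        + cov 0 (F.giE * -star (F.cE hW) * F.gE
              + F.giE * (dxE hW ez1 F.gE - Complex.I • dxE hW ez2 F.gE))
            (cov (dxE hW ez1 + Complex.I • dxE hW ez2) (D.cE T) (F.vE hW))
        + cov 0 (F.giE * -star F.fE * F.gE) (cov 0 (D.fE T) (F.vE hW))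
        + Complex.I • (F.giE * F.XE hW * F.gE * F.vE hW
            - F.vE hW * (F.giE * F.XE hW * F.gE))) := by
  have hY : F.XE hW = F.gE * (F.giE * F.XE hW * F.gE) * F.giE := by
    rw [← mul_assoc, ← mul_assoc, F.gE_mul_giE, one_mul, mul_assoc, F.gE_mul_giE, mul_one]
  have key := lap_of_rlap_eq (f := F.fE) (fh := -star F.fE) (u := F.uE hW) (Y := F.giE * F.XE hW * F.gE)
    (isDer_smoothDer hW (0, et))
    (isDer_smoothDer hW (0, ez1)) (isDer_smoothDer hW (0, ez2))
    (fun x => smoothDer_comm hW _ _ x) F.gE_mul_giE F.giE_mul_gE (F.AtE_sub hW)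
    (F.A1E_add hW) rfl (F.uE_eq hW) hY (F.rlap_uE hW hT)
  rw [F.AtE_add hW, F.A1E_sub hW] at key
  exact key

end KWFlow

end FlowX

/-! ### The pointwise bound for the generator -/

section TraceIdentities

lemma trace_commutator_left {R : Type*} [Ring R] {τ : R →+ ℝ}
    (hτ : ∀ x y, τ (x * y) = τ (y * x)) (u a w : R) :
    τ (u * (a * w - w * a)) = -τ ((a * u - u * a) * w) := by
  have h1 : τ (u * (w * a)) = τ (a * u * w) := by rw [← mul_assoc, hτ, mul_assoc]
  rw [mul_sub, sub_mul, map_sub, map_sub, h1, mul_assoc u a w]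
  ring

variable {R : Type*} [Ring R] [Algebra ℂ R] {τ : R →+ ℝ}

lemma trace_der_der_sq (hτ : ∀ x y, τ (x * y) = τ (y * x)) {d : R →ₗ[ℂ] R} (h : IsDer d)
    (A u : R) : τ (d (d (u * u)))
      = 2 * τ (u * cov d A (cov d A u)) + 2 * τ (cov d A u * cov d A u) := by
  have hc : ∀ x y : R, τ (d (x * y - y * x)) = 0 := fun x y => by
    rw [map_sub, h, h, map_sub, map_add, map_add, hτ (d x), hτ x]; ring
  have h1 : ∀ x, τ (d (d x)) = τ (cov d A (cov d A x)) := fun x => by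
    have e : cov d A (cov d A x) = d (d x) + d (A * x - x * A)
      + (A * (cov d A x) - cov d A x * A) := by rw [cov, cov, map_add]
    rw [e, map_add, map_add, hc, map_sub, hτ A]; ring
  have hadd : ∀ x y, cov d A (x + y) = cov d A x + cov d A y := fun x y => by
    simp only [cov, map_add, mul_add, add_mul]; abel
  rw [h1, cov_mul h, hadd, cov_mul h, cov_mul h, map_add, map_add, map_add, hτ (cov d A _) u]
  ring

lemma trace_lap_sq (hτ : ∀ x y, τ (x * y) = τ (y * x)) {dt d1 d2 : R →ₗ[ℂ] R} (ht : IsDer dt)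
    (h1 : IsDer d1) (h2 : IsDer d2) (At A1 A2 a3 f fh u : R) :
    τ (dt (dt (u * u)) + d1 (d1 (u * u)) + d2 (d2 (u * u)))
      = -2 * τ (u * rlap dt d1 d2 At A1 A2 a3 f fh u)
        + 2 * (τ (cov dt At u * cov dt At u) + τ (cov d1 A1 u * cov d1 A1 u)
          + τ (cov d2 A2 u * cov d2 A2 u)
          + τ (cov 0 ((2:ℂ)⁻¹ • (f + fh)) u * cov 0 ((2:ℂ)⁻¹ • (f + fh)) u)
          + τ (cov 0 ((Complex.I * (2:ℂ)⁻¹) • (f - fh)) u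
              * cov 0 ((Complex.I * (2:ℂ)⁻¹) • (f - fh)) u)
          + τ (cov 0 a3 u * cov 0 a3 u)) := by
  have hz : ∀ a : R, τ (u * cov 0 a (-cov 0 a u)) = τ (cov 0 a u * cov 0 a u) := fun a => by
    have e : cov 0 a (-cov 0 a u) = -(a * cov 0 a u - cov 0 a u * a) := by
      simp only [cov, LinearMap.zero_apply, zero_add]; noncomm_ring
    rw [e, mul_neg, map_neg, trace_commutator_left hτ, neg_neg]
    congr 2
    simp [cov]
  rw [map_add, map_add, trace_der_der_sq hτ ht At, trace_der_der_sq hτ h1 A1,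
    trace_der_der_sq hτ h2 A2, rlap]
  simp only [mul_add, mul_neg, map_add, map_neg, hz]
  ring

end TraceIdentities

section MatrixNorm

lemma trace_mul_conjTranspose_re (X : M2) :
    (Matrix.trace (X * Xᴴ)).re = ∑ ij : Fin 2 × Fin 2, ‖X ij.1 ij.2‖ ^ 2 := by
  rw [Fintype.sum_prod_type, Matrix.trace, Complex.re_sum]
  refine Finset.sum_congr rfl fun i _ => ?_
  rw [Matrix.diag_apply, Matrix.mul_apply, Complex.re_sum]
  refine Finset.sum_congr rfl fun j _ => ?_
  rw [Matrix.conjTranspose_apply, Complex.star_def, Complex.mul_conj, Complex.normSq_eq_norm_sq]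
  exact Complex.ofReal_re _

lemma mnorm_nonneg (X : M2) : 0 ≤ mnorm X := Real.sqrt_nonneg _

lemma mnorm_sq (X : M2) : mnorm X ^ 2 = (Matrix.trace (X * Xᴴ)).re / 2 :=
  Real.sq_sqrt (by rw [trace_mul_conjTranspose_re]; positivity)

lemma abs_trace_mul_re_le (U X : M2) :
    |(Matrix.trace (U * X)).re| ≤ 2 * (mnorm U * mnorm X) := by
  have h1 : Matrix.trace (U * X) = ∑ ij : Fin 2 × Fin 2, U ij.1 ij.2 * X ij.2 ij.1 := by
    rw [Fintype.sum_prod_type]; rfl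
  have h2 : |(Matrix.trace (U * X)).re|
      ≤ ∑ ij : Fin 2 × Fin 2, ‖U ij.1 ij.2‖ * ‖X ij.2 ij.1‖ := by
    refine (Complex.abs_re_le_norm _).trans ?_
    rw [h1]
    exact (norm_sum_le _ _).trans (Finset.sum_le_sum fun ij _ => (norm_mul _ _).le)
  have h3 : ∑ ij : Fin 2 × Fin 2, ‖X ij.2 ij.1‖ ^ 2 = ∑ ij : Fin 2 × Fin 2, ‖X ij.1 ij.2‖ ^ 2 :=
    (Equiv.prodComm (Fin 2) (Fin 2)).sum_comp fun ij => ‖X ij.1 ij.2‖ ^ 2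
  refine h2.trans ((Real.sum_mul_le_sqrt_mul_sqrt _ _ _).trans (le_of_eq ?_))
  rw [h3, ← trace_mul_conjTranspose_re, ← trace_mul_conjTranspose_re, mnorm, mnorm,
    Real.sqrt_div' _ (by norm_num), Real.sqrt_div' _ (by norm_num), div_mul_div_comm,
    Real.mul_self_sqrt (by norm_num)]
  ring

lemma mnorm_smul (c : ℝ) (X : M2) : mnorm (c • X) = |c| * mnorm X := by
  have e : (Matrix.trace ((c • X) * (c • X)ᴴ)).re / 2
      = c ^ 2 * ((Matrix.trace (X * Xᴴ)).re / 2) := by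
    rw [trace_mul_conjTranspose_re, trace_mul_conjTranspose_re]
    simp only [Matrix.smul_apply, norm_smul, mul_pow, Real.norm_eq_abs, sq_abs, ← Finset.mul_sum]
    ring
  rw [mnorm, e, Real.sqrt_mul (sq_nonneg c), Real.sqrt_sq_eq_abs, mnorm]

lemma continuous_mnorm : Continuous mnorm := by
  unfold mnorm
  fun_prop

/-- The functional `-(1/2) Re tr`. -/
def trH : N2 →L[ℝ] ℝ := LinearMap.toContinuousLinearMap
  { toFun := fun X => -((Matrix.trace (show M2 from X)).re / 2)
    map_add' := fun X Y => by
      change -((Matrix.trace ((show M2 from X) + (show M2 from Y))).re / 2) = _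
      rw [Matrix.trace_add, Complex.add_re]; ring
    map_smul' := fun c X => by
      change -((Matrix.trace (c • (show M2 from X))).re / 2) = _
      rw [Matrix.trace_smul, Complex.smul_re]; simp only [smul_eq_mul, RingHom.id_apply]; ring }

lemma trH_toN (X : M2) : trH (toN X) = -((Matrix.trace X).re / 2) := rfl

lemma trH_mul_comm (x y : N2) : trH (x * y) = trH (y * x) := by
  obtain ⟨X, rfl⟩ : ∃ X, toN X = x := ⟨x, rfl⟩
  obtain ⟨Y, rfl⟩ : ∃ Y, toN Y = y := ⟨y, rfl⟩
  rw [← toN_mul, ← toN_mul, trH_toN, trH_toN, Matrix.trace_mul_comm]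

lemma trH_mul_self {X : M2} (h : Xᴴ = -X) : trH (toN X * toN X) = mnorm X ^ 2 := by
  rw [← toN_mul, trH_toN, mnorm_sq, h, mul_neg, Matrix.trace_neg, Complex.neg_re]
  ring

lemma trH_mul_self_nonneg {x : N2} (h : star x = -x) : 0 ≤ trH (x * x) := by
  obtain ⟨X, rfl⟩ : ∃ X, toN X = x := ⟨x, rfl⟩
  have h' : Xᴴ = -X := h
  rw [trH_mul_self h']; positivity

end MatrixNorm

section GeneratorBound

variable {T : ℝ≥0∞} {s : ℝ} {D : DataSet Hsp}

lemma two_le_top : (2 : WithTop ℕ∞) ≤ ((⊤:ℕ∞) : WithTop ℕ∞) :=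
  WithTop.coe_le_coe.mpr (le_top (a := (2:ℕ∞)))

lemma lapE_slice {𝔸 : Type*} [CStarAlgebra 𝔸] (hW : GoodDom (flowW T))
    (F : smoothAlg 𝔸 (flowW T)) (hs : s ∈ flowDom T) {p : P3} (hp : p ∈ Hsp) :
    lapE (fun q => F.1 (s, q)) p
      = (dxE hW et (dxE hW et F) + dxE hW ez1 (dxE hW ez1 F) + dxE hW ez2 (dxE hW ez2 F)).1
          (s, p) := by
  have h : ∀ v, fderiv ℝ (fun q => fderiv ℝ (fun q => F.1 (s, q)) q v) p v
      = (dxE hW v (dxE hW v F)).1 (s, p) := fun v => by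
    rw [← fderiv_slice hW _ hs hp]
    congr 1
    apply Filter.EventuallyEq.fderiv_eq
    filter_upwards [isOpen_Hsp.mem_nhds hp] with q hq using fderiv_slice hW F hs hq v
  rw [lapE, h, h, h]
  rfl

lemma isCompact_of_uAsymp {u : P3 → M2} (hu : UAsymp u) {q : P3 → ℝ} (hq : ContinuousOn q Hsp)
    (hqu : ∀ p ∈ Hsp, q p = mnorm (u p) ^ 2) {ε : ℝ} (hε : 0 < ε) :
    IsCompact {p | p ∈ Hsp ∧ ε ≤ q p} := by
  obtain ⟨δ, hδ, h1⟩ := hu.1 (√ε) (Real.sqrt_pos.mpr hε)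
  obtain ⟨K, h2⟩ := hu.2.1 (√ε) (Real.sqrt_pos.mpr hε)
  obtain ⟨δ', hδ', h3⟩ := hu.2.2 (√ε) (Real.sqrt_pos.mpr hε)
  set B : Set P3 := Icc δ K ×ˢ (Icc (-(K / δ')) (K / δ') ×ˢ Icc (-(K / δ')) (K / δ'))
  have hB : IsCompact B := isCompact_Icc.prod (isCompact_Icc.prod isCompact_Icc)
  have hBH : B ⊆ Hsp := fun p hp => hδ.trans_le hp.1.1
  have e : {p | p ∈ Hsp ∧ ε ≤ q p} = {p ∈ B | ε ≤ q p} := by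
    ext p
    refine ⟨fun ⟨hp, hpε⟩ => ⟨?_, hpε⟩, fun ⟨hp, hpε⟩ => ⟨hBH hp, hpε⟩⟩
    have hm : √ε ≤ mnorm (u p) := by
      rw [hqu p hp] at hpε
      exact Real.sqrt_le_iff.mpr ⟨mnorm_nonneg _, hpε⟩
    have g1 : δ ≤ p.1 := not_lt.mp fun h => absurd (h1 p hp h) (not_lt.mpr hm)
    have g2 : p.1 ≤ K := not_lt.mp fun h => absurd (h2 p hp h) (not_lt.mpr hm)
    have g3 : δ' * znorm p ≤ p.1 := not_lt.mp fun h => absurd (h3 p hp h) (not_lt.mpr hm)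
    have g4 : znorm p ≤ K / δ' := by rw [le_div_iff₀ hδ']; linarith
    have g5 : |p.2.1| ≤ znorm p := by
      rw [← Real.sqrt_sq_eq_abs]; exact Real.sqrt_le_sqrt (by nlinarith [sq_nonneg p.2.2])
    have g6 : |p.2.2| ≤ znorm p := by
      rw [← Real.sqrt_sq_eq_abs]; exact Real.sqrt_le_sqrt (by nlinarith [sq_nonneg p.2.1])
    exact ⟨⟨g1, g2⟩, abs_le.mp (g5.trans g4), abs_le.mp (g6.trans g4)⟩
  rw [e]
  exact hB.of_isClosed_subset
    ((hq.mono hBH).preimage_isClosed_of_isClosed hB.isClosed isClosed_Ici) inter_subset_left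

namespace KWFlow

variable (F : KWFlow D T) (hW : GoodDom (flowW T))

lemma lap3_trH_sq (hT : 0 < T) (hs : s ∈ flowInt T) {p : P3} (hp : p ∈ Hsp) :
    -(2 * Real.exp (-s) * mnorm (D.X p) * √(trH ((F.uE hW * F.uE hW).1 (s, p))))
      ≤ lap3 (fun q => trH ((F.uE hW * F.uE hW).1 (s, q))) p := by
  have hs' := flowInt_subset hs
  have hu := F.uE_isSlice hW hs p hp
  have hsu := F.su2_u s hs' p hp
  let τ : smoothAlg N2 (flowW T) →+ ℝ :=
    (trH : N2 →+ ℝ).comp (evalE N2 (flowW T) (s, p) : smoothAlg N2 (flowW T) →+ N2)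
  have hτ : ∀ x y, τ (x * y) = τ (y * x) := fun x y => trH_mul_comm _ _
  have key := trace_lap_sq hτ (isDer_smoothDer hW (0, et)) (isDer_smoothDer hW (0, ez1))
    (isDer_smoothDer hW (0, ez2)) (F.AtE hW) (F.A1E hW) (F.A2E hW) (F.a3E hW) F.fE (-star F.fE)
    (F.uE hW)
  have hstar : ∀ (d : smoothAlg N2 (flowW T) →ₗ[ℂ] smoothAlg N2 (flowW T)) (b),
      (∀ x, d (star x) = star (d x)) → star b = -b →
      0 ≤ τ (cov d b (F.uE hW) * cov d b (F.uE hW)) := fun d b hd hb => by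
    have h1 := star_cov d d hd b (F.uE hW) (F.star_uE hW hT)
    rw [hb, neg_neg] at h1
    exact trH_mul_self_nonneg (congrFun (congrArg Subtype.val h1) (s, p))
  have hI : star Complex.I = -Complex.I := Complex.conj_I
  have hcv : ∀ c : ℂ, star c = -c → ∀ x : smoothAlg N2 (flowW T), star (c • (x + star x))
      = -(c • (x + star x)) := fun c hc x => by
    rw [star_smul, hc, star_add, star_star, add_comm, neg_smul]
  have hcr : ∀ c : ℂ, star c = c → ∀ x : smoothAlg N2 (flowW T), star (c • (x - star x))
      = -(c • (x - star x)) := fun c hc x => by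
    rw [star_smul, hc, star_sub, star_star, ← smul_neg, neg_sub]
  have h2r : star (2:ℂ)⁻¹ = (2:ℂ)⁻¹ := by simp
  have h2i : star (Complex.I * (2:ℂ)⁻¹) = -(Complex.I * (2:ℂ)⁻¹) := by simp
  have h2i' : star (-Complex.I * (2:ℂ)⁻¹) = -(-Complex.I * (2:ℂ)⁻¹) := by simp
  have t1 := hstar (dxE hW et) (F.AtE hW) (smoothDer_star hW _) (hcr _ h2r _)
  have t2 := hstar (dxE hW ez1) (F.A1E hW) (smoothDer_star hW _) (hcr _ h2r _)
  have t3 := hstar (dxE hW ez2) (F.A2E hW) (smoothDer_star hW _) (hcv _ h2i' _)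
  have t4 := hstar 0 ((2:ℂ)⁻¹ • (F.fE + -star F.fE)) (by simp)
    (by rw [← sub_eq_add_neg]; exact hcr _ h2r _)
  have t5 := hstar 0 ((Complex.I * (2:ℂ)⁻¹) • (F.fE - -star F.fE)) (by simp)
    (by rw [sub_neg_eq_add]; exact hcv _ h2i _)
  have t6 := hstar 0 (F.a3E hW) (by simp) (hcv _ h2i _)
  rw [F.rlap_uE hW hT] at key
  have hl : lap3 (fun q => trH ((F.uE hW * F.uE hW).1 (s, q))) p
      = τ (dxE hW et (dxE hW et (F.uE hW * F.uE hW)) + dxE hW ez1 (dxE hW ez1 (F.uE hW * F.uE hW))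
        + dxE hW ez2 (dxE hW ez2 (F.uE hW * F.uE hW))) := by
    rw [lap3_clm_comp trH ((slice_contDiffAt (F.uE hW * F.uE hW) hs' hp).of_le two_le_top),
      lapE_slice hW _ hs' hp]
    rfl
  have hq : trH ((F.uE hW * F.uE hW).1 (s, p)) = mnorm (F.u s p) ^ 2 := by
    change trH ((F.uE hW).1 (s, p) * (F.uE hW).1 (s, p)) = _
    rw [hu, trH_mul_self hsu.2]
  have hX : τ (F.uE hW * F.XE hW)
      = -(Real.exp (-s) * ((Matrix.trace (F.u s p * D.X p)).re / 2)) := by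
    change trH ((F.uE hW).1 (s, p) * (F.XE hW).1 (s, p)) = _
    rw [hu, F.XE_eq hW hT hs' hp, mul_smul_comm, map_smul, ← toN_mul, trH_toN, smul_eq_mul,
      mul_neg]
  rw [hq, Real.sqrt_sq (mnorm_nonneg _), hl, key, hX]
  have hCS := (abs_le.mp (abs_trace_mul_re_le (F.u s p) (D.X p))).1
  have := mul_le_mul_of_nonneg_left hCS (Real.exp_pos (-s)).le
  nlinarith [this]

lemma integrable_X (F : KWFlow D T) (hW : GoodDom (flowW T)) (h0 : 0 ∈ flowDom T) (hX : XnormSqInt D < ⊤) :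
    Integrable (Hsp.indicator fun p => (1 + p.1 ^ 2) * mnorm (D.X p) ^ 2) := by
  rw [integrable_indicator_iff isOpen_Hsp.measurableSet]
  have hc : ContinuousOn D.X Hsp := by
    have h1 : ContDiffOn ℝ (⊤:ℕ∞) (fun q => toN (D.X q)) Hsp :=
      (slice_contDiffOn (F.XE hW) h0).congr fun q hq => (F.XE_isSlice_zero hW h0 q hq).symm
    exact (contDiffOn_toN.mp h1).continuousOn
  have hc' : ContinuousOn (fun p : P3 => (1 + p.1 ^ 2) * mnorm (D.X p) ^ 2) Hsp :=
    ContinuousOn.mul (by fun_prop) ((continuous_mnorm.comp_continuousOn hc).pow 2)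
  refine ⟨hc'.aestronglyMeasurable isOpen_Hsp.measurableSet, ?_⟩
  rw [hasFiniteIntegral_iff_ofReal (Eventually.of_forall fun p => by positivity)]
  exact hX

/-- The pointwise bound for the generator of the flow. -/
lemma exists_mnorm_u_le (hT : 0 < T) (hX : XnormSqInt D < ⊤) :
    ∃ C, 0 ≤ C ∧ ∀ s ∈ flowInt T, ∀ p ∈ Hsp, mnorm (F.u s p) ≤ C * Real.exp (-s) := by
  have hW := goodDom_flowW hT
  obtain ⟨C, hC, h⟩ := sqrt_le_of_lap3_ge (Xn := fun p => mnorm (D.X p))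
    (fun p _ => mnorm_nonneg _) (F.integrable_X hW ⟨le_rfl, by simpa using hT⟩ hX)
  refine ⟨C, hC, fun s hs p hp => ?_⟩
  have hs' := flowInt_subset hs
  have hq : ∀ p ∈ Hsp, trH ((F.uE hW * F.uE hW).1 (s, p)) = mnorm (F.u s p) ^ 2 := fun p hp => by
    change trH ((F.uE hW).1 (s, p) * (F.uE hW).1 (s, p)) = _
    rw [F.uE_isSlice hW hs p hp, trH_mul_self (F.su2_u s hs' p hp).2]
  have hd : ∀ p ∈ Hsp, ContDiffAt ℝ 2 (fun q => trH ((F.uE hW * F.uE hW).1 (s, q))) p :=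
    fun p hp => trH.contDiff.contDiffAt.comp p
      ((slice_contDiffAt (F.uE hW * F.uE hW) hs' hp).of_le two_le_top)
  have := h (Real.exp (-s)) (fun q => trH ((F.uE hW * F.uE hW).1 (s, q))) (Real.exp_pos _).le
    (fun p hp => by rw [hq p hp]; positivity) hd
    (fun ε hε => isCompact_of_uAsymp (F.asymp_u s hs')
      (fun p hp => (hd p hp).continuousAt.continuousWithinAt) hq hε)
    (fun p hp => F.lap3_trH_sq hW hT hs hp) p hp
  rwa [hq p hp, Real.sqrt_sq (mnorm_nonneg _)] at this

end KWFlow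

end GeneratorBound

section WeightedBounds

variable {T : ℝ≥0∞} {𝔸 : Type*} [CStarAlgebra 𝔸]

/-- The coordinate directions of the half-space. -/
def eb : Fin 3 → P3 := ![et, ez1, ez2]

/-- The iterated spatial derivative of a space-time function along a list of coordinate
directions. -/
def dword (hW : GoodDom (flowW T)) : List (Fin 3) → smoothAlg 𝔸 (flowW T) → smoothAlg 𝔸 (flowW T)
  | [], F => F
  | i :: w, F => dword hW w (dxE hW (eb i) F)

/-- The sum of the norms of all spatial derivatives of order `k`. -/
def ordNorm (hW : GoodDom (flowW T)) : ℕ → smoothAlg 𝔸 (flowW T) → ℝ × P3 → ℝ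
  | 0, F, x => ‖F.1 x‖
  | k + 1, F, x => ∑ i, ordNorm hW k (dxE hW (eb i) F) x

/-- All spatial derivatives up to order `k` are bounded on `Z` by a multiple of the weight `β`. -/
def Bd (hW : GoodDom (flowW T)) (Z : Set (ℝ × P3)) (β : ℝ × P3 → ℝ) :
    ℕ → smoothAlg 𝔸 (flowW T) → Prop
  | 0, F => ∃ C, 0 ≤ C ∧ ∀ x ∈ Z, ‖F.1 x‖ ≤ C * β x
  | k + 1, F => (∃ C, 0 ≤ C ∧ ∀ x ∈ Z, ‖F.1 x‖ ≤ C * β x)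
      ∧ ∀ i, Bd hW Z β k (dxE hW (eb i) F)

variable {hW : GoodDom (flowW T)} {Z : Set (ℝ × P3)} {β γ : ℝ × P3 → ℝ} {k : ℕ}
  {F G : smoothAlg 𝔸 (flowW T)}

lemma ordNorm_nonneg (x : ℝ × P3) : 0 ≤ ordNorm hW k F x := by
  induction k generalizing F with
  | zero => exact norm_nonneg _
  | succ k ih => exact Finset.sum_nonneg fun i _ => ih

lemma norm_dword_le (w : List (Fin 3)) (x : ℝ × P3) :
    ‖(dword hW w F).1 x‖ ≤ ordNorm hW w.length F x := by
  induction w generalizing F with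
  | nil => exact le_rfl
  | cons i w ih =>
    exact ih.trans (Finset.single_le_sum (f := fun i => ordNorm hW w.length (dxE hW (eb i) F) x)
      (fun _ _ => ordNorm_nonneg x) (Finset.mem_univ i))

lemma ordNorm_le {x : ℝ × P3} {M : ℝ}
    (h : ∀ w : List (Fin 3), w.length = k → ‖(dword hW w F).1 x‖ ≤ M) :
    ordNorm hW k F x ≤ 3 ^ k * M := by
  induction k generalizing F with
  | zero => simpa [ordNorm, dword] using h [] rfl
  | succ k ih =>
    calc ordNorm hW (k + 1) F x ≤ ∑ _i : Fin 3, 3 ^ k * M :=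
          Finset.sum_le_sum fun i _ => ih fun w hw => h (i :: w) (by simp [hw])
      _ = 3 ^ (k + 1) * M := by
          rw [Finset.sum_const, Finset.card_univ, Fintype.card_fin, nsmul_eq_mul]; push_cast; ring

lemma dword_add (w : List (Fin 3)) : dword hW w (F + G) = dword hW w F + dword hW w G := by
  induction w generalizing F G with
  | nil => rfl
  | cons i w ih => rw [dword, map_add, ih]; rfl

lemma dword_smoothDer (w : List (Fin 3)) (v : ℝ × P3) :
    dword hW w (smoothDer hW v F) = smoothDer hW v (dword hW w F) := by
  induction w generalizing F with
  | nil => rfl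
  | cons i w ih => rw [dword, dxE, smoothDer_comm, ih]; rfl

namespace Bd

lemma zero_order (h : Bd hW Z β k F) : ∃ C, 0 ≤ C ∧ ∀ x ∈ Z, ‖F.1 x‖ ≤ C * β x := by
  cases k with
  | zero => exact h
  | succ k => exact h.1

lemma of_succ (h : Bd hW Z β (k + 1) F) : Bd hW Z β k F := by
  induction k generalizing F with
  | zero => exact h.1
  | succ k ih => exact ⟨h.1, fun i => ih (h.2 i)⟩

lemma der (h : Bd hW Z β (k + 1) F) (i : Fin 3) : Bd hW Z β k (dxE hW (eb i) F) := h.2 i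

lemma mono (h : Bd hW Z β k F) (hβ : ∃ C, 0 ≤ C ∧ ∀ x ∈ Z, β x ≤ C * γ x) : Bd hW Z γ k F := by
  obtain ⟨C', hC', hβ⟩ := hβ
  have key : ∀ F : smoothAlg 𝔸 (flowW T), (∃ C, 0 ≤ C ∧ ∀ x ∈ Z, ‖F.1 x‖ ≤ C * β x) →
      ∃ C, 0 ≤ C ∧ ∀ x ∈ Z, ‖F.1 x‖ ≤ C * γ x := by
    rintro F ⟨C, hC, h⟩
    refine ⟨C * C', mul_nonneg hC hC', fun x hx => (h x hx).trans ?_⟩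
    rw [mul_assoc]
    exact mul_le_mul_of_nonneg_left (hβ x hx) hC
  induction k generalizing F with
  | zero => exact key F h
  | succ k ih => exact ⟨key F h.1, fun i => ih (h.2 i)⟩

lemma mono_le (h : Bd hW Z β k F) (hβ : ∀ x ∈ Z, β x ≤ γ x) : Bd hW Z γ k F :=
  h.mono ⟨1, zero_le_one, fun x hx => (hβ x hx).trans_eq (one_mul _).symm⟩

lemma subset {Z' : Set (ℝ × P3)} (h : Bd hW Z β k F) (hZ : Z' ⊆ Z) : Bd hW Z' β k F := by
  induction k generalizing F with
  | zero => obtain ⟨C, hC, h⟩ := h; exact ⟨C, hC, fun x hx => h x (hZ hx)⟩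
  | succ k ih =>
    obtain ⟨C, hC, h'⟩ := h.1
    exact ⟨⟨C, hC, fun x hx => h' x (hZ hx)⟩, fun i => ih (h.2 i)⟩

lemma add (hF : Bd hW Z β k F) (hG : Bd hW Z β k G) : Bd hW Z β k (F + G) := by
  have key : ∀ F G : smoothAlg 𝔸 (flowW T), (∃ C, 0 ≤ C ∧ ∀ x ∈ Z, ‖F.1 x‖ ≤ C * β x) →
      (∃ C, 0 ≤ C ∧ ∀ x ∈ Z, ‖G.1 x‖ ≤ C * β x) →
      ∃ C, 0 ≤ C ∧ ∀ x ∈ Z, ‖(F + G).1 x‖ ≤ C * β x := by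
    rintro F G ⟨C, hC, h⟩ ⟨C', hC', h'⟩
    refine ⟨C + C', add_nonneg hC hC', fun x hx => ?_⟩
    rw [add_mul]
    exact (norm_add_le _ _).trans (add_le_add (h x hx) (h' x hx))
  induction k generalizing F G with
  | zero => exact key F G hF hG
  | succ k ih => exact ⟨key F G hF.1 hG.1, fun i => by rw [map_add]; exact ih (hF.2 i) (hG.2 i)⟩

lemma smul (c : ℂ) (hF : Bd hW Z β k F) : Bd hW Z β k (c • F) := by
  have key : ∀ F : smoothAlg 𝔸 (flowW T), (∃ C, 0 ≤ C ∧ ∀ x ∈ Z, ‖F.1 x‖ ≤ C * β x) →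
      ∃ C, 0 ≤ C ∧ ∀ x ∈ Z, ‖(c • F).1 x‖ ≤ C * β x := by
    rintro F ⟨C, hC, h⟩
    refine ⟨‖c‖ * C, mul_nonneg (norm_nonneg _) hC, fun x hx => ?_⟩
    rw [mul_assoc]
    exact (norm_smul_le c (F.1 x)).trans (mul_le_mul_of_nonneg_left (h x hx) (norm_nonneg _))
  induction k generalizing F with
  | zero => exact key F hF
  | succ k ih => exact ⟨key F hF.1, fun i => by rw [map_smul]; exact ih (hF.2 i)⟩

lemma neg (hF : Bd hW Z β k F) : Bd hW Z β k (-F) := by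
  rw [← neg_one_smul ℂ F]; exact hF.smul _

lemma sub (hF : Bd hW Z β k F) (hG : Bd hW Z β k G) : Bd hW Z β k (F - G) := by
  rw [sub_eq_add_neg]; exact hF.add hG.neg

lemma star (hF : Bd hW Z β k F) : Bd hW Z β k (star F) := by
  have key : ∀ F : smoothAlg 𝔸 (flowW T), (∃ C, 0 ≤ C ∧ ∀ x ∈ Z, ‖F.1 x‖ ≤ C * β x) →
      ∃ C, 0 ≤ C ∧ ∀ x ∈ Z, ‖(Star.star F).1 x‖ ≤ C * β x := by
    rintro F ⟨C, hC, h⟩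
    exact ⟨C, hC, fun x hx => (norm_star (F.1 x)).trans_le (h x hx)⟩
  induction k generalizing F with
  | zero => exact key F hF
  | succ k ih => exact ⟨key F hF.1, fun i => by rw [dxE, smoothDer_star]; exact ih (hF.2 i)⟩

lemma mul_zero_order {δ : ℝ × P3 → ℝ} (hF : ∃ C, 0 ≤ C ∧ ∀ x ∈ Z, ‖F.1 x‖ ≤ C * β x)
    (hG : ∃ C, 0 ≤ C ∧ ∀ x ∈ Z, ‖G.1 x‖ ≤ C * γ x) (hδ : ∀ x ∈ Z, β x * γ x ≤ δ x) :
    ∃ C, 0 ≤ C ∧ ∀ x ∈ Z, ‖(F * G).1 x‖ ≤ C * δ x := by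
  obtain ⟨C, hC, h⟩ := hF
  obtain ⟨C', hC', h'⟩ := hG
  refine ⟨C * C', mul_nonneg hC hC', fun x hx => ?_⟩
  calc ‖(F * G).1 x‖ ≤ ‖F.1 x‖ * ‖G.1 x‖ := norm_mul_le (F.1 x) (G.1 x)
    _ ≤ (C * β x) * (C' * γ x) :=
        mul_le_mul (h x hx) (h' x hx) (norm_nonneg _) ((norm_nonneg _).trans (h x hx))
    _ = C * C' * (β x * γ x) := by ring
    _ ≤ C * C' * δ x := mul_le_mul_of_nonneg_left (hδ x hx) (mul_nonneg hC hC')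

lemma mul (hF : Bd hW Z β k F) (hG : Bd hW Z γ k G) :
    Bd hW Z (fun x => β x * γ x) k (F * G) := by
  induction k generalizing F G with
  | zero => exact mul_zero_order hF hG fun _ _ => le_rfl
  | succ k ih =>
    refine ⟨mul_zero_order hF.1 hG.1 fun _ _ => le_rfl, fun i => ?_⟩
    rw [dxE, smoothDer_mul]
    exact (ih (hF.2 i) hG.of_succ).add (ih hF.of_succ (hG.2 i))

lemma ordNorm_le (hF : Bd hW Z β k F) :
    ∃ C, 0 ≤ C ∧ ∀ x ∈ Z, ordNorm hW k F x ≤ C * β x := by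
  induction k generalizing F with
  | zero => exact hF
  | succ k ih =>
    choose C hC h using fun i => ih (hF.2 i)
    refine ⟨∑ i, C i, Finset.sum_nonneg fun i _ => hC i, fun x hx => ?_⟩
    rw [Finset.sum_mul]
    exact Finset.sum_le_sum fun i _ => h i x hx

lemma zero_of_le (hβ : ∀ x ∈ Z, ‖F.1 x‖ ≤ β x) : ∃ C, 0 ≤ C ∧ ∀ x ∈ Z, ‖F.1 x‖ ≤ C * β x :=
  ⟨1, zero_le_one, fun x hx => (hβ x hx).trans_eq (one_mul _).symm⟩

lemma succ_of_ordNorm_le (hF : Bd hW Z β k F) (hn : ∃ C, 0 ≤ C ∧ ∀ x ∈ Z,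
    ordNorm hW (k + 1) F x ≤ C * β x) : Bd hW Z β (k + 1) F := by
  obtain ⟨C, hC, hn⟩ := hn
  induction k generalizing F with
  | zero =>
    refine ⟨hF, fun i => ⟨C, hC, fun x hx => le_trans ?_ (hn x hx)⟩⟩
    exact Finset.single_le_sum (f := fun i => ordNorm hW 0 (dxE hW (eb i) F) x)
      (fun _ _ => ordNorm_nonneg x) (Finset.mem_univ i)
  | succ k ih =>
    refine ⟨hF.1, fun i => ih (hF.2 i) fun x hx => le_trans ?_ (hn x hx)⟩
    exact Finset.single_le_sum (f := fun i => ordNorm hW (k + 1) (dxE hW (eb i) F) x)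
      (fun _ _ => ordNorm_nonneg x) (Finset.mem_univ i)

lemma succ_add_ordNorm (hβ : ∀ x ∈ Z, 0 ≤ β x) (hF : Bd hW Z β k F) :
    Bd hW Z (fun x => β x + ordNorm hW (k + 1) F x) (k + 1) F :=
  (hF.mono_le fun x _ => le_add_of_nonneg_right (ordNorm_nonneg x)).succ_of_ordNorm_le
    ⟨1, zero_le_one, fun x hx => by rw [one_mul]; exact le_add_of_nonneg_left (hβ x hx)⟩

/-- The top order derivatives of a product, controlled by the product of top order derivatives of
one factor with the other factor. -/
lemma mul_succ (hβ : ∀ x ∈ Z, 0 ≤ β x) (hγ : ∀ x ∈ Z, 0 ≤ γ x) (hF : Bd hW Z β k F)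
    (hG : Bd hW Z γ k G) :
    Bd hW Z (fun x => β x * γ x + ordNorm hW (k + 1) F x * γ x + β x * ordNorm hW (k + 1) G x)
      (k + 1) (F * G) := by
  have h0 : ∀ x ∈ Z, ∀ a b, 0 ≤ a → 0 ≤ b → 0 ≤ a * γ x ∧ 0 ≤ β x * b :=
    fun x hx a b ha hb => ⟨mul_nonneg ha (hγ x hx), mul_nonneg (hβ x hx) hb⟩
  have hle : ∀ n (F : smoothAlg 𝔸 (flowW T)) (i : Fin 3) (x : ℝ × P3),
      ordNorm hW n (dxE hW (eb i) F) x ≤ ordNorm hW (n + 1) F x := fun n F i x =>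
    Finset.single_le_sum (f := fun i => ordNorm hW n (dxE hW (eb i) F) x)
      (fun _ _ => ordNorm_nonneg x) (Finset.mem_univ i)
  induction k generalizing F G with
  | zero =>
    refine ⟨mul_zero_order hF hG fun x hx => ?_, fun i => ?_⟩
    · have := h0 x hx _ _ (ordNorm_nonneg (hW := hW) (k := 1) (F := F) x)
        (ordNorm_nonneg (hW := hW) (k := 1) (F := G) x)
      simp only [zero_add]
      linarith
    · rw [dxE, smoothDer_mul]
      refine add (k := 0) ?_ ?_
      · refine mul_zero_order (zero_of_le (hle 0 F i · |> fun h => fun _ => h)) hG fun x hx => ?_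
        have := h0 x hx _ _ zero_le_one (ordNorm_nonneg (hW := hW) (k := 1) (F := G) x)
        have := mul_nonneg (hβ x hx) (hγ x hx)
        simp only [zero_add]
        linarith
      · refine mul_zero_order hF (zero_of_le (hle 0 G i · |> fun h => fun _ => h)) fun x hx => ?_
        have := h0 x hx _ _ (ordNorm_nonneg (hW := hW) (k := 1) (F := F) x) zero_le_one
        have := mul_nonneg (hβ x hx) (hγ x hx)
        simp only [zero_add]
        linarith
  | succ k ih =>
    refine ⟨mul_zero_order hF.1 hG.1 fun x hx => ?_, fun i => ?_⟩
    · have := h0 x hx _ _ (ordNorm_nonneg (hW := hW) (k := k + 1 + 1) (F := F) x)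
        (ordNorm_nonneg (hW := hW) (k := k + 1 + 1) (F := G) x)
      linarith
    · rw [dxE, smoothDer_mul]
      obtain ⟨CF, hCF, hF'⟩ := hF.ordNorm_le
      obtain ⟨CG, hCG, hG'⟩ := hG.ordNorm_le
      refine add ((ih (hF.2 i) hG.of_succ).mono ⟨1 + CG, by positivity, fun x hx => ?_⟩)
        ((ih hF.of_succ (hG.2 i)).mono ⟨1 + CF, by positivity, fun x hx => ?_⟩)
      · have h1 := h0 x hx _ _ (ordNorm_nonneg (hW := hW) (k := k + 1 + 1) (F := F) x)
          (ordNorm_nonneg (hW := hW) (k := k + 1 + 1) (F := G) x)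
        have h2 := mul_le_mul_of_nonneg_left (hG' x hx) (hβ x hx)
        have h3 := mul_le_mul_of_nonneg_right (hle (k + 1) F i x) (hγ x hx)
        have h4 := mul_nonneg hCG h1.1
        have h5 := mul_nonneg hCG h1.2
        linarith
      · have h1 := h0 x hx _ _ (ordNorm_nonneg (hW := hW) (k := k + 1 + 1) (F := F) x)
          (ordNorm_nonneg (hW := hW) (k := k + 1 + 1) (F := G) x)
        have h2 := mul_le_mul_of_nonneg_right (hF' x hx) (hγ x hx)
        have h3 := mul_le_mul_of_nonneg_left (hle (k + 1) G i x) (hβ x hx)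
        have h4 := mul_nonneg hCF h1.1
        have h5 := mul_nonneg hCF h1.2
        linarith

lemma inv (hF : Bd hW Z (fun _ => 1) k F) (hFG : F * G = 1) (hGF : G * F = 1)
    (hG : ∃ C, 0 ≤ C ∧ ∀ x ∈ Z, ‖G.1 x‖ ≤ C * 1) : Bd hW Z (fun _ => 1) k G := by
  induction k with
  | zero => exact hG
  | succ k ih =>
    refine ⟨hG, fun i => ?_⟩
    rw [(isDer_smoothDer hW _).map_inv hFG hGF]
    have h := (((ih hF.of_succ).mul (hF.2 i)).mul (ih hF.of_succ)).neg
    simpa only [one_mul] using h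

end Bd

/-- Space-time functions that separate into a function of the flow parameter and a function of
the point. -/
def Separates (χ : ℝ → ℝ) (F : smoothAlg 𝔸 (flowW T)) : Prop :=
  ∀ s ∈ flowDom T, ∀ p ∈ Hsp, F.1 (s, p) = χ s • F.1 (0, p)

lemma Separates.der {χ : ℝ → ℝ} (hF : Separates χ F) (h0 : 0 ∈ flowDom T) (v : P3) :
    Separates χ (dxE hW v F) := fun s hs p hp => by
  rw [← fderiv_slice hW F hs hp, ← fderiv_slice hW F h0 hp]
  have : (fun q => F.1 (s, q)) =ᶠ[𝓝 p] fun q => χ s • F.1 (0, q) := by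
    filter_upwards [isOpen_Hsp.mem_nhds hp] with q hq using hF s hs q hq
  rw [this.fderiv_eq, fderiv_fun_const_smul
    ((slice_contDiffAt F h0 hp).differentiableAt (by norm_num))]
  rfl

lemma Separates.bd {χ : ℝ → ℝ} (hF : Separates χ F) (h0 : 0 ∈ flowDom T) (hχ : ∀ s, 0 ≤ χ s)
    {S : Set ℝ} {B : Set P3} (hS : S ⊆ flowDom T) (hB : IsCompact B) (hBH : B ⊆ Hsp) (k : ℕ) :
    Bd hW (S ×ˢ B) (fun x => χ x.1) k F := by
  have key : ∀ F : smoothAlg 𝔸 (flowW T), Separates χ F →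
      ∃ C, 0 ≤ C ∧ ∀ x ∈ S ×ˢ B, ‖F.1 x‖ ≤ C * χ x.1 := fun F hF => by
    obtain ⟨C, hC⟩ := hB.exists_bound_of_continuousOn
      ((slice_contDiffOn F h0).continuousOn.mono hBH)
    refine ⟨max C 0, le_max_right _ _, fun x hx => ?_⟩
    rw [← Prod.mk.eta (p := x), hF x.1 (hS hx.1) x.2 (hBH hx.2), norm_smul, mul_comm,
      Real.norm_of_nonneg (hχ _)]
    exact mul_le_mul_of_nonneg_right ((hC x.2 hx.2).trans (le_max_left _ _)) (hχ _)
  induction k generalizing F with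
  | zero => exact key F hF
  | succ k ih => exact ⟨key F hF, fun i => ih (hF.der h0 _)⟩

end WeightedBounds

section AnalyticBounds

variable {ι E : Type*} [NormedAddCommGroup E] [NormedSpace ℝ E]

/-- A Gronwall inequality for families whose growth rate decays exponentially and is controlled by
the size of the whole family. -/
lemma norm_le_of_deriv_le_exp_neg {f f' : ι → ℝ → E} {s₀ s₁ C N₀ : ℝ} (hs₀ : 0 ≤ s₀) (hC : 0 ≤ C)
    (hN₀ : 0 ≤ N₀) (hd : ∀ i, ∀ s ∈ Icc s₀ s₁, HasDerivAt (f i) (f' i s) s)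
    (hb : ∃ M, ∀ i, ∀ s ∈ Icc s₀ s₁, ‖f i s‖ ≤ M) (h0 : ∀ i, ‖f i s₀‖ ≤ N₀)
    (hf' : ∀ s ∈ Icc s₀ s₁, ∀ N, 0 ≤ N → (∀ i, ‖f i s‖ ≤ N) →
      ∀ i, ‖f' i s‖ ≤ C * Real.exp (-s) * (1 + N)) (i : ι) {s : ℝ} (hs : s ∈ Icc s₀ s₁) :
    ‖f i s‖ ≤ 2 * ((1 + N₀) * Real.exp (2 * C)) := by
  obtain ⟨M, hM⟩ := hb
  set w : ℝ → ℝ := fun s => Real.exp (-(2 * C * Real.exp (-s))) with hw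
  have hwpos : ∀ s, 0 < w s := fun s => Real.exp_pos _
  have hwinv : ∀ s, s₀ ≤ s → (w s)⁻¹ ≤ Real.exp (2 * C) := fun s h => by
    rw [hw, ← Real.exp_neg, neg_neg]
    refine Real.exp_le_exp.2 (mul_le_of_le_one_right (by positivity) ?_)
    exact Real.exp_le_one_iff.2 (by linarith)
  have hwd : ∀ s, HasDerivAt w (w s * (2 * C * Real.exp (-s))) s := fun s => by
    have h1 : HasDerivAt (fun s : ℝ => Real.exp (-s)) (Real.exp (-s) * -1) s :=
      (hasDerivAt_neg s).exp
    refine ((h1.const_mul (2 * C)).fun_neg.exp).congr_deriv ?_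
    simp only [hw]
    ring
  set A : Set ℝ := {y | ∃ i, ∃ s ∈ Icc s₀ s₁, y = (1 + ‖f i s‖) * (w s)⁻¹} with hA
  have hAbdd : BddAbove A := ⟨(1 + M) * Real.exp (2 * C), by
    rintro y ⟨i, s, hs, rfl⟩
    have := hM i s hs
    exact mul_le_mul (by linarith) (hwinv s hs.1) (by have := hwpos s; positivity)
      (by have := norm_nonneg (f i s); linarith)⟩
  have hAne : A.Nonempty := ⟨_, i, s, hs, rfl⟩
  set Q := sSup A
  have hQ : ∀ i, ∀ s ∈ Icc s₀ s₁, (1 + ‖f i s‖) ≤ Q * w s := fun i s hs => by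
    have := le_csSup hAbdd ⟨i, s, hs, rfl⟩
    rwa [← div_eq_mul_inv, div_le_iff₀ (hwpos s)] at this
  have hQ0 : 0 ≤ Q := by
    have h1 := hQ i s hs
    have h2 := norm_nonneg (f i s)
    exact le_of_mul_le_mul_right (by linarith) (hwpos s)
  have hder : ∀ i, ∀ s ∈ Icc s₀ s₁, ‖f' i s‖ ≤ Q / 2 * (w s * (2 * C * Real.exp (-s))) :=
    fun j r hr => by
    have h1 := hQ i r hr
    have h2 := norm_nonneg (f i r)
    refine (hf' r hr (Q * w r - 1) (by linarith) (fun i => by linarith [hQ i r hr]) j).trans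
      (le_of_eq ?_)
    ring
  have hbd : ∀ i, ∀ s ∈ Icc s₀ s₁, ‖f i s‖ ≤ N₀ + Q / 2 * (w s - w s₀) := fun i s hs =>
    image_norm_le_of_norm_deriv_right_le_deriv_boundary
      (f := f i) (f' := f' i) (B := fun s => N₀ + Q / 2 * (w s - w s₀))
      (B' := fun s => Q / 2 * (w s * (2 * C * Real.exp (-s))))
      (fun s hs => (hd i s hs).continuousAt.continuousWithinAt)
      (fun s hs => (hd i s (Ico_subset_Icc_self hs)).hasDerivWithinAt)
      (by simpa using h0 i)
      (fun s => (((hwd s).sub_const _).const_mul _).const_add _)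
      (fun s hs => hder i s (Ico_subset_Icc_self hs)) hs
  have hQle : Q ≤ (1 + N₀) * Real.exp (2 * C) + Q / 2 := by
    refine csSup_le hAne ?_
    rintro y ⟨i, s, hs, rfl⟩
    have h1 := hbd i s hs
    have h2 : 1 + ‖f i s‖ ≤ (1 + N₀) + Q / 2 * w s := by
      have := mul_nonneg (half_pos one_pos).le (mul_nonneg hQ0 (hwpos s₀).le)
      linarith
    calc (1 + ‖f i s‖) * (w s)⁻¹ ≤ ((1 + N₀) + Q / 2 * w s) * (w s)⁻¹ :=
          mul_le_mul_of_nonneg_right h2 (inv_nonneg.2 (hwpos s).le)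
      _ = (1 + N₀) * (w s)⁻¹ + Q / 2 := by
          have := (hwpos s).ne'
          field_simp
      _ ≤ _ := by
          have := mul_le_mul_of_nonneg_left (hwinv s hs.1) (by linarith : 0 ≤ 1 + N₀)
          linarith
  have hw1 : w s ≤ 1 := Real.exp_le_one_iff.2 (neg_nonpos.2 (by positivity))
  have h1 := hQ i s hs
  have h2 := mul_le_mul_of_nonneg_left hw1 hQ0
  linarith

/-- An interior gradient bound for a family of functions whose Laplacians are controlled by the
gradients of the family, with a coefficient that may blow up at the boundary of the ball. -/
lemma dist_boundary_mul_grad_le {f : ι → P3 → E} {p₀ : P3} {R : ℝ} (hR1 : R ≤ 1)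
    {a b : P3 → ℝ} {C c e N : ℝ} (hC : 0 ≤ C) (hc : 0 ≤ c) (he : 0 ≤ e) (hN : 0 ≤ N)
    (ha0 : ∀ q, 0 ≤ a q) (hb0 : ∀ q, 0 ≤ b q)
    (hf : ∀ i, ∀ q ∈ Metric.closedBall p₀ R, ContDiffAt ℝ 2 (f i) q)
    (hfe : ∀ i, ∀ q ∈ Metric.closedBall p₀ R, ‖f i q‖ ≤ C * e)
    (haN : ∀ q ∈ Metric.closedBall p₀ R, (R - dist q p₀) * a q ≤ N)
    (hlap : ∀ i, ∀ q ∈ Metric.closedBall p₀ R, ‖lapE (f i) q‖ ≤ C * ((1 + a q) * (e + b q)))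
    (hbf : ∀ q ∈ Metric.closedBall p₀ R, ∀ M, (∀ i, ‖fderiv ℝ (f i) q‖ ≤ M) → b q ≤ c * M)
    (hbb : ∃ M, ∀ q ∈ Metric.closedBall p₀ R, b q ≤ M) {q : P3}
    (hq : q ∈ Metric.closedBall p₀ R) :
    (R - dist q p₀) * b q ≤ 2 * (c * (145 * C * (16 * (c * C + 1)))) * ((1 + N) * e) := by
  have hd0 : ∀ q ∈ Metric.closedBall p₀ R, 0 ≤ R - dist q p₀ := fun q hq =>
    sub_nonneg.2 (Metric.mem_closedBall.1 hq)
  have hd1 : ∀ q, R - dist q p₀ ≤ 1 := fun q => by linarith [dist_nonneg (x := q) (y := p₀)]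
  set A : Set ℝ := (fun q => (R - dist q p₀) * b q) '' Metric.closedBall p₀ R
  obtain ⟨M, hM⟩ := hbb
  have hAb : BddAbove A := ⟨1 * M, by
    rintro _ ⟨q, hq, rfl⟩
    exact mul_le_mul (hd1 q) (hM q hq) (hb0 q) zero_le_one⟩
  have hAne : A.Nonempty := ⟨_, q, hq, rfl⟩
  set n := sSup A
  have hn : ∀ q ∈ Metric.closedBall p₀ R, (R - dist q p₀) * b q ≤ n := fun q hq =>
    le_csSup hAb ⟨q, hq, rfl⟩
  have hn0 : 0 ≤ n := (mul_nonneg (hd0 q hq) (hb0 q)).trans (hn q hq)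
  set K := 16 * (c * C + 1) with hK
  have hcC : 0 ≤ c * C := mul_nonneg hc hC
  have hK16 : 16 ≤ K := by rw [hK]; linarith
  have hKpos : 0 < K := by linarith
  have key : ∀ p ∈ Metric.closedBall p₀ R,
      (R - dist p p₀) * b p ≤ c * (145 * C * K) * ((1 + N) * e) + n / 2 := fun p hp => by
    have hX : 0 ≤ c * (145 * C * K) * ((1 + N) * e) := by positivity
    rcases (hd0 p hp).eq_or_lt with h0 | hdpos
    · rw [← h0, zero_mul]; linarith
    set d := R - dist p p₀ with hd
    have hd1' : d ≤ 1 := hd1 p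
    have hN1 : 0 < 1 + N := by linarith
    set r := d / (K * (1 + N)) with hr
    have hrpos : 0 < r := by positivity
    have hrd : r ≤ d / 2 := by
      rw [hr]
      refine div_le_div_of_nonneg_left hdpos.le two_pos ?_
      nlinarith
    have hsub : ∀ q ∈ Metric.closedBall p r, q ∈ Metric.closedBall p₀ R ∧ d / 2 ≤ R - dist q p₀ :=
      fun q hq => by
      have h1 := dist_triangle q p p₀
      have h2 := Metric.mem_closedBall.1 hq
      have h3 : d / 2 ≤ R - dist q p₀ := by linarith
      exact ⟨Metric.mem_closedBall.2 (by linarith), h3⟩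
    have hlap' : ∀ i, ∀ q ∈ Metric.closedBall p r,
        ‖lapE (f i) q‖ ≤ C * ((2 * (1 + N) / d) * (e + 2 * n / d)) := fun i q hq => by
      obtain ⟨hqB, hdq⟩ := hsub q hq
      have h1 : a q ≤ 2 * N / d := by
        rw [le_div_iff₀ hdpos]
        have := haN q hqB
        have := mul_le_mul_of_nonneg_right hdq (ha0 q)
        linarith
      have h2 : b q ≤ 2 * n / d := by
        rw [le_div_iff₀ hdpos]
        have := hn q hqB
        have := mul_le_mul_of_nonneg_right hdq (hb0 q)
        linarith
      have h3 : 1 + a q ≤ 2 * (1 + N) / d := by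
        have : 1 ≤ 2 / d := by rw [le_div_iff₀ hdpos]; linarith
        calc 1 + a q ≤ 2 / d + 2 * N / d := add_le_add this h1
          _ = _ := by ring
      refine (hlap i q hqB).trans (mul_le_mul_of_nonneg_left ?_ hC)
      exact mul_le_mul h3 (by linarith) (add_nonneg he (hb0 q)) (by positivity)
    have hgrad : ∀ i, ‖fderiv ℝ (f i) p‖ ≤ 9 * (C * e) / r
        + 2 * r * (C * ((2 * (1 + N) / d) * (e + 2 * n / d))) := fun i =>
      norm_fderiv_le_of_lapE hrpos (fun q hq => hf i q (hsub q hq).1)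
        (fun q hq => hfe i q (hsub q hq).1) (hlap' i)
    have hb := mul_le_mul_of_nonneg_left (hbf p hp _ hgrad) hdpos.le
    refine hb.trans ?_
    have e1 : d * (c * (9 * (C * e) / r + 2 * r * (C * ((2 * (1 + N) / d) * (e + 2 * n / d))))) =
        c * (9 * C * K) * ((1 + N) * e) + 4 / K * (c * C) * (d * e)
          + 8 / K * (c * C) * n := by
      rw [hr]
      field_simp
      ring
    rw [e1]
    have h8 : 8 / K * (c * C) * n ≤ n / 2 := by
      have : 8 / K * (c * C) ≤ 1 / 2 := by
        rw [div_mul_eq_mul_div, div_le_div_iff₀ hKpos two_pos, hK]; linarith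
      calc _ ≤ 1 / 2 * n := mul_le_mul_of_nonneg_right this hn0
        _ = _ := by ring
    have h4 : 4 / K * (c * C) * (d * e) ≤ c * (136 * C * K) * ((1 + N) * e) := by
      have h41 : 4 / K ≤ 136 * K := by
        rw [div_le_iff₀ hKpos]; nlinarith
      have h42 : d * e ≤ (1 + N) * e := mul_le_mul_of_nonneg_right (by linarith) he
      calc 4 / K * (c * C) * (d * e) ≤ (136 * K) * (c * C) * ((1 + N) * e) :=
            mul_le_mul (mul_le_mul_of_nonneg_right h41 hcC) h42 (by positivity) (by positivity)
        _ = _ := by ring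
    nlinarith
  have hnle : n ≤ c * (145 * C * K) * ((1 + N) * e) + n / 2 := by
    refine csSup_le hAne ?_
    rintro _ ⟨p, hp, rfl⟩
    exact key p hp
  have := hn q hq
  linarith

end AnalyticBounds

section SliceBounds

variable {T : ℝ≥0∞} {s : ℝ} {𝔸 : Type*} [CStarAlgebra 𝔸] {hW : GoodDom (flowW T)}

lemma lapE_dword (F : smoothAlg 𝔸 (flowW T)) (w : List (Fin 3)) (hs : s ∈ flowDom T) {p : P3}
    (hp : p ∈ Hsp) :
    lapE (fun q => (dword hW w F).1 (s, q)) p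
      = (dword hW w (dxE hW et (dxE hW et F) + dxE hW ez1 (dxE hW ez1 F)
          + dxE hW ez2 (dxE hW ez2 F))).1 (s, p) := by
  rw [lapE_slice hW _ hs hp]
  simp only [dword_add, dxE, dword_smoothDer]

lemma ordNorm_succ_le (F : smoothAlg 𝔸 (flowW T)) (k : ℕ) (hs : s ∈ flowDom T) {p : P3}
    (hp : p ∈ Hsp) {M : ℝ} (h : ∀ w : {w : List (Fin 3) // w.length = k},
      ‖fderiv ℝ (fun q => (dword hW w.1 F).1 (s, q)) p‖ ≤ M) :
    ordNorm hW (k + 1) F (s, p) ≤ (∑ i, 3 ^ k * ‖eb i‖) * M := by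
  rw [Finset.sum_mul]
  refine Finset.sum_le_sum fun i _ => ?_
  rw [mul_assoc]
  refine ordNorm_le fun w hw => ?_
  rw [dxE, dword_smoothDer, ← fderiv_slice hW _ hs hp, mul_comm]
  exact (ContinuousLinearMap.le_opNorm _ _).trans
    (mul_le_mul_of_nonneg_right (h ⟨w, hw⟩) (norm_nonneg _))

lemma continuousOn_ordNorm (F : smoothAlg 𝔸 (flowW T)) (k : ℕ) :
    ContinuousOn (ordNorm hW k F) (flowW T) := by
  induction k generalizing F with
  | zero => exact (smoothAlg.contDiffOn F).continuousOn.norm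
  | succ k ih => exact continuousOn_finsetSum _ fun i _ => ih _

lemma exists_ordNorm_le (F : smoothAlg 𝔸 (flowW T)) (k : ℕ) {K : Set (ℝ × P3)} (hK : IsCompact K)
    (hKW : K ⊆ flowW T) : ∃ M, 0 ≤ M ∧ ∀ x ∈ K, ordNorm hW k F x ≤ M := by
  obtain ⟨M, hM⟩ := hK.exists_bound_of_continuousOn ((continuousOn_ordNorm (hW := hW) F k).mono hKW)
  exact ⟨max M 0, le_max_right _ _, fun x hx =>
    ((le_abs_self _).trans (hM x hx)).trans (le_max_left _ _)⟩

end SliceBounds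

section FlowBounds

variable {T : ℝ≥0∞} {s : ℝ} {D : DataSet Hsp} {hW : GoodDom (flowW T)} {S : Set ℝ} {B : Set P3}

lemma baseE_separates {h : P3 → M2} (hh : ContDiffOn ℝ (⊤:ℕ∞) h Hsp) (h0 : 0 ∈ flowDom T) :
    Separates (fun _ => 1) (baseE T hh) := fun s hs p hp => by
  rw [one_smul, baseE_isSlice hh hs p hp, baseE_isSlice hh h0 p hp]

lemma baseE_bd {h : P3 → M2} (hh : ContDiffOn ℝ (⊤:ℕ∞) h Hsp) (h0 : 0 ∈ flowDom T)
    (hS : S ⊆ flowDom T) (hB : IsCompact B) (hBH : B ⊆ Hsp) (k : ℕ) :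
    Bd hW (S ×ˢ B) (fun _ => 1) k (baseE T hh) :=
  (baseE_separates hh h0).bd h0 (fun _ => zero_le_one) hS hB hBH k

namespace KWFlow

variable (F : KWFlow D T)

lemma XE_bd (hT : 0 < T) (hS : S ⊆ flowDom T) (hB : IsCompact B) (hBH : B ⊆ Hsp) (k : ℕ) :
    Bd hW (S ×ˢ B) (fun x => Real.exp (-x.1)) k (F.XE hW) := by
  have h0 : 0 ∈ flowDom T := ⟨le_rfl, by simpa using hT⟩
  refine Separates.bd (χ := fun s => Real.exp (-s)) (fun s hs p hp => ?_) h0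
    (fun _ => (Real.exp_pos _).le) hS hB hBH k
  rw [F.XE_eq hW hT hs hp, F.XE_eq hW hT h0 hp, neg_zero, Real.exp_zero, one_smul]

lemma giE_bd {Z : Set (ℝ × P3)} {k : ℕ} (hg : Bd hW Z (fun _ => 1) k F.gE) :
    Bd hW Z (fun _ => 1) k F.giE := by
  refine hg.inv F.gE_mul_giE F.giE_mul_gE ?_
  obtain ⟨C, hC, h⟩ := hg.zero_order
  refine ⟨‖adjL‖ * C, by positivity, fun x hx => ?_⟩
  rw [mul_assoc]
  exact (adjL.le_opNorm _).trans (mul_le_mul_of_nonneg_left (h x hx) (norm_nonneg _))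

/-- The Laplacian of the conjugated generator of the flow is controlled by the derivatives of one
order more of the flow and of the generator. -/
lemma lap_vE_bd (hT : 0 < T) (hS : S ⊆ flowDom T) (hB : IsCompact B) (hBH : B ⊆ Hsp) {k : ℕ}
    (hg : Bd hW (S ×ˢ B) (fun _ => 1) k F.gE)
    (hv : Bd hW (S ×ˢ B) (fun x => Real.exp (-x.1)) k (F.vE hW)) :
    Bd hW (S ×ˢ B) (fun x => (1 + ordNorm hW (k + 1) F.gE x)
        * (Real.exp (-x.1) + ordNorm hW (k + 1) (F.vE hW) x)) k
      (dxE hW et (dxE hW et (F.vE hW)) + dxE hW ez1 (dxE hW ez1 (F.vE hW))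
        + dxE hW ez2 (dxE hW ez2 (F.vE hW))) := by
  have h0 : 0 ∈ flowDom T := ⟨le_rfl, by simpa using hT⟩
  set Z := S ×ˢ B
  set e : ℝ × P3 → ℝ := fun x => Real.exp (-x.1) with he
  set α : ℝ × P3 → ℝ := fun x => 1 + ordNorm hW (k + 1) F.gE x with hα
  set β : ℝ × P3 → ℝ := fun x => e x + ordNorm hW (k + 1) (F.vE hW) x with hβ
  have e0 : ∀ x, 0 ≤ e x := fun x => (Real.exp_pos _).le
  have e1 : ∀ x ∈ Z, e x ≤ 1 := fun x hx => by
    have := (hS hx.1).1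
    exact Real.exp_le_one_iff.2 (by linarith)
  have α1 : ∀ x, 1 ≤ α x := fun x => le_add_of_nonneg_right (ordNorm_nonneg x)
  have eβ : ∀ x, e x ≤ β x := fun x => le_add_of_nonneg_right (ordNorm_nonneg x)
  have β0 : ∀ x, 0 ≤ β x := fun x => (e0 x).trans (eβ x)
  have one_mul' : ∀ {γ : ℝ × P3 → ℝ} {k : ℕ} {F G : smoothAlg N2 (flowW T)},
      Bd hW Z (fun _ => 1) k F → Bd hW Z γ k G → Bd hW Z γ k (F * G) := fun hF hG =>
    (hF.mul hG).mono_le fun x _ => (one_mul _).le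
  have mul_one' : ∀ {γ : ℝ × P3 → ℝ} {k : ℕ} {F G : smoothAlg N2 (flowW T)},
      Bd hW Z γ k F → Bd hW Z (fun _ => 1) k G → Bd hW Z γ k (F * G) := fun hF hG =>
    (hF.mul hG).mono_le fun x _ => (mul_one _).le
  have hb : ∀ n, Bd hW Z (fun _ => 1) n (D.bE T) := fun n =>
    (baseE_bd _ h0 hS hB hBH n).sub ((baseE_bd _ h0 hS hB hBH n).smul _)
  have hc : ∀ n, Bd hW Z (fun _ => 1) n (D.cE T) := fun n =>
    (baseE_bd _ h0 hS hB hBH n).add ((baseE_bd _ h0 hS hB hBH n).smul _)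
  have hf : ∀ n, Bd hW Z (fun _ => 1) n (D.fE T) := fun n => baseE_bd _ h0 hS hB hBH n
  have hgi := F.giE_bd hg
  have hg' : Bd hW Z α (k + 1) F.gE := hg.succ_add_ordNorm fun _ _ => zero_le_one
  have hv' : Bd hW Z β (k + 1) (F.vE hW) := hv.succ_add_ordNorm fun x _ => e0 x
  have hX := F.XE_bd (hW := hW) hT hS hB hBH k
  have dg : ∀ i, Bd hW Z α k (dxE hW (eb i) F.gE) := fun i => hg'.der i
  have dv : ∀ i, Bd hW Z β k (dxE hW (eb i) (F.vE hW)) := fun i => hv'.der i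
  have toα : ∀ {G : smoothAlg N2 (flowW T)}, Bd hW Z (fun _ => 1) k G → Bd hW Z α k G :=
    fun h => h.mono_le fun x _ => α1 x
  have hbF : Bd hW Z α k (F.bE hW) :=
    (toα (one_mul' (one_mul' hg (hb k)) hgi)).sub (mul_one' (dg 0) hgi)
  have hcF : Bd hW Z α k (F.cE hW) :=
    (toα (one_mul' (one_mul' hg (hc k)) hgi)).sub
      (mul_one' ((dg 1).add ((dg 2).smul Complex.I)) hgi)
  have hfF : Bd hW Z (fun _ => 1) k F.fE := one_mul' (one_mul' hg (hf k)) hgi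
  have hY : Bd hW Z e k (F.giE * F.XE hW * F.gE) := mul_one' (one_mul' hgi hX) hg
  have toαβ : ∀ {G : smoothAlg N2 (flowW T)}, Bd hW Z β k G →
      Bd hW Z (fun x => α x * β x) k G := fun h => h.mono_le fun x _ =>
    le_mul_of_one_le_left (β0 x) (α1 x)
  have hbv : Bd hW Z β (k + 1) (D.bE T * F.vE hW - F.vE hW * D.bE T) :=
    (one_mul' (hb _) hv').sub (mul_one' hv' (hb _))
  have hcv : Bd hW Z β (k + 1) (D.cE T * F.vE hW - F.vE hW * D.cE T) :=
    (one_mul' (hc _) hv').sub (mul_one' hv' (hc _))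
  have hfv : Bd hW Z β k (cov 0 (D.fE T) (F.vE hW)) := by
    rw [cov, LinearMap.zero_apply, zero_add]
    exact (one_mul' (hf _) hv'.of_succ).sub (mul_one' hv'.of_succ (hf _))
  have cov0 : ∀ {G H : smoothAlg N2 (flowW T)}, Bd hW Z α k G → Bd hW Z β k H →
      Bd hW Z (fun x => α x * β x) k (cov 0 G H) := fun hG hH => by
    rw [cov, LinearMap.zero_apply, zero_add]
    exact (hG.mul hH).sub ((hH.mul hG).mono_le fun x _ => (mul_comm _ _).le)
  rw [F.lap_vE hW hT]
  refine Bd.neg (Bd.add (Bd.add (Bd.add (Bd.add (Bd.add (Bd.add ?_ ?_) ?_) ?_) ?_) ?_) ?_)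
  · exact toαβ (hY.mono_le fun x _ => eβ x)
  · exact toαβ (hbv.der 0)
  · refine cov0 ((mul_one' (one_mul' hgi hbF.star.neg) hg).add (one_mul' hgi (dg 0))) ?_
    exact (dv 0).add hbv.of_succ
  · exact toαβ ((hcv.der 1).sub ((hcv.der 2).smul _))
  · refine cov0 ((mul_one' (one_mul' hgi hcF.star.neg) hg).add
      (one_mul' hgi ((dg 1).sub ((dg 2).smul _)))) ?_
    exact ((dv 1).add ((dv 2).smul _)).add hcv.of_succ
  · exact cov0 (toα (one_mul' (one_mul' hgi hfF.star.neg) hg)) hfv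
  · have hv1 : Bd hW Z (fun _ => 1) k (F.vE hW) := hv.mono_le e1
    exact (toαβ (((mul_one' hY hv1).sub (one_mul' hv1 hY)).mono_le fun x _ => eβ x)).smul _

end KWFlow

end FlowBounds

section FlowEstimates

variable {T : ℝ≥0∞} {s s₀ : ℝ} {D : DataSet Hsp} {hW : GoodDom (flowW T)}

/-- The part of the flow interval from `s₀` on. -/
def flowTail (s₀ : ℝ) (T : ℝ≥0∞) : Set ℝ := {s | s₀ ≤ s ∧ ENNReal.ofReal s < T}

lemma flowTail_subset_flowInt (hs₀ : 0 < s₀) : flowTail s₀ T ⊆ flowInt T := fun _ h =>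
  ⟨hs₀.trans_le h.1, h.2⟩

lemma flowTail_subset_flowDom (hs₀ : 0 < s₀) : flowTail s₀ T ⊆ flowDom T :=
  (flowTail_subset_flowInt hs₀).trans flowInt_subset

lemma Icc_subset_flowTail {s₁ : ℝ} (h : s₁ ∈ flowTail s₀ T) : Icc s₀ s₁ ⊆ flowTail s₀ T :=
  fun _ hr => ⟨hr.1, (ENNReal.ofReal_le_ofReal hr.2).trans_lt h.2⟩

lemma norm_toN_le : ∃ C, 0 ≤ C ∧ ∀ X : M2, ‖toN X‖ ≤ C * mnorm X := by
  refine ⟨∑ i, ∑ j, √2 * ‖toN (Matrix.single i j 1)‖, by positivity, fun X => ?_⟩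
  have hX : toN X = ∑ i, ∑ j, X i j • toN (Matrix.single i j 1) := by
    have h : X = ∑ i, ∑ j, X i j • (Matrix.single i j (1:ℂ) : M2) := by
      simp only [Matrix.smul_single, smul_eq_mul, mul_one]
      exact Matrix.matrix_eq_sum_single X
    exact h
  have h0 : 0 ≤ √2 * mnorm X := mul_nonneg (Real.sqrt_nonneg _) (mnorm_nonneg X)
  have hle : ∀ i j, ‖X i j‖ ≤ √2 * mnorm X := fun i j => by
    refine abs_le_of_sq_le_sq' ?_ h0 |>.2
    rw [mul_pow, Real.sq_sqrt zero_le_two, mnorm_sq, trace_mul_conjTranspose_re,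
      mul_div_cancel₀ _ two_ne_zero]
    exact Finset.single_le_sum (f := fun ij : Fin 2 × Fin 2 => ‖X ij.1 ij.2‖ ^ 2)
      (fun _ _ => by positivity) (Finset.mem_univ (i, j))
  rw [hX, Finset.sum_mul]
  refine (norm_sum_le _ _).trans (Finset.sum_le_sum fun i _ => ?_)
  rw [Finset.sum_mul]
  refine (norm_sum_le _ _).trans (Finset.sum_le_sum fun j _ => ?_)
  rw [norm_smul, mul_right_comm]
  exact mul_le_mul_of_nonneg_right (hle i j) (norm_nonneg _)

namespace KWFlow

variable (F : KWFlow D T)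

lemma bd_zero (hT : 0 < T) (hX : XnormSqInt D < ⊤) (hs₀ : 0 < s₀) {B : Set P3} (hB : IsCompact B)
    (hBH : B ⊆ Hsp) : Bd hW (flowTail s₀ T ×ˢ B) (fun _ => 1) 0 F.gE
      ∧ Bd hW (flowTail s₀ T ×ˢ B) (fun x => Real.exp (-x.1)) 0 (F.vE hW) := by
  obtain ⟨C₁, hC₁, hN⟩ := norm_toN_le
  obtain ⟨C₂, hC₂, hu⟩ := F.exists_mnorm_u_le hT hX
  have hu' : ∀ s ∈ flowInt T, ∀ p ∈ Hsp, ‖(F.uE hW).1 (s, p)‖ ≤ C₁ * C₂ * Real.exp (-s) :=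
    fun s hs p hp => by
    rw [F.uE_isSlice hW hs p hp, mul_assoc]
    exact (hN _).trans (mul_le_mul_of_nonneg_left (hu s hs p hp) hC₁)
  have hSI := flowTail_subset_flowInt (T := T) hs₀
  by_cases hne : s₀ ∈ flowTail s₀ T
  swap
  · have hemp : ∀ x, x ∉ flowTail s₀ T ×ˢ B := fun x hx =>
      hne ⟨le_rfl, (ENNReal.ofReal_le_ofReal hx.1.1).trans_lt hx.1.2⟩
    exact ⟨⟨0, le_rfl, fun x hx => (hemp x hx).elim⟩, ⟨0, le_rfl, fun x hx => (hemp x hx).elim⟩⟩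
  obtain ⟨N₀, hN₀, h0⟩ := exists_ordNorm_le (hW := hW) F.gE 0
    ((isCompact_singleton (x := s₀)).prod hB)
    (prod_mono (singleton_subset_iff.2 (flowInt_subset (hSI hne))) hBH)
  have hg : Bd hW (flowTail s₀ T ×ˢ B) (fun _ => 1) 0 F.gE := by
    refine ⟨2 * ((1 + N₀) * Real.exp (2 * (C₁ * C₂))), by positivity, fun x hx => ?_⟩
    rw [mul_one]
    refine norm_le_of_deriv_le_exp_neg (ι := B) (f := fun p s => F.gE.1 (s, p.1))
      (f' := fun p s => (dsE hW F.gE).1 (s, p.1)) (s₁ := x.1) hs₀.le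
      (mul_nonneg hC₁ hC₂) hN₀
      (fun p s hs => hasDerivAt_slice hW F.gE (hSI (Icc_subset_flowTail hx.1 hs)) (hBH p.2))
      ?_ (fun p => h0 (s₀, p.1) ⟨rfl, p.2⟩) ?_ ⟨x.2, hx.2⟩ (s := x.1) ⟨hx.1.1, le_rfl⟩
    · obtain ⟨M, -, hM⟩ := exists_ordNorm_le (hW := hW) F.gE 0
        ((isCompact_Icc (a := s₀) (b := x.1)).prod hB)
        (prod_mono ((Icc_subset_flowTail hx.1).trans (hSI.trans flowInt_subset)) hBH)
      exact ⟨M, fun p s hs => hM (s, p.1) ⟨hs, p.2⟩⟩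
    · intro s hs N hN hf p
      rw [F.dsE_gE hW]
      calc ‖Complex.I • ((F.uE hW).1 (s, p.1) * F.gE.1 (s, p.1))‖
          ≤ 1 * (‖(F.uE hW).1 (s, p.1)‖ * ‖F.gE.1 (s, p.1)‖) := by
            rw [norm_smul, Complex.norm_I]
            exact mul_le_mul_of_nonneg_left (norm_mul_le _ _) zero_le_one
        _ ≤ _ := by
            rw [one_mul]
            refine mul_le_mul (hu' s (hSI (Icc_subset_flowTail hx.1 hs)) _ (hBH p.2)) ?_
              (norm_nonneg _) (by positivity)
            linarith [hf p]
  refine ⟨hg, ?_⟩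
  have huB : Bd hW (flowTail s₀ T ×ˢ B) (fun x => Real.exp (-x.1)) 0 (F.uE hW) :=
    ⟨C₁ * C₂, by positivity, fun x hx => hu' x.1 (hSI hx.1) x.2 (hBH hx.2)⟩
  refine (((F.giE_bd hg).mul huB).mul hg).mono_le fun x _ => ?_
  rw [one_mul, mul_one]

/-- The induction step of the interior estimates for the flow. -/
lemma bd_succ (hT : 0 < T) (hs₀ : s₀ ∈ flowInt T) {p₀ : P3} {R : ℝ} (hR : 0 < R) (hR1 : R ≤ 1)
    (hRH : Metric.closedBall p₀ R ⊆ Hsp) {k : ℕ}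
    (hg : Bd hW (flowTail s₀ T ×ˢ Metric.closedBall p₀ R) (fun _ => 1) k F.gE)
    (hv : Bd hW (flowTail s₀ T ×ˢ Metric.closedBall p₀ R) (fun x => Real.exp (-x.1)) k
      (F.vE hW)) :
    Bd hW (flowTail s₀ T ×ˢ Metric.closedBall p₀ (R / 2)) (fun _ => 1) (k + 1) F.gE
      ∧ Bd hW (flowTail s₀ T ×ˢ Metric.closedBall p₀ (R / 2)) (fun x => Real.exp (-x.1)) (k + 1)
        (F.vE hW) := by
  set B := Metric.closedBall p₀ R
  have hB : IsCompact B := isCompact_closedBall _ _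
  have hSI := flowTail_subset_flowInt (T := T) hs₀.1
  have hSD := hSI.trans flowInt_subset
  set a := ordNorm hW (k + 1) F.gE
  set b := ordNorm hW (k + 1) (F.vE hW)
  have ha0 : ∀ x, 0 ≤ a x := ordNorm_nonneg
  have hb0 : ∀ x, 0 ≤ b x := ordNorm_nonneg
  have hd0 : ∀ q ∈ B, 0 ≤ R - dist q p₀ := fun q hq =>
    sub_nonneg.2 (Metric.mem_closedBall.1 hq)
  have hd1 : ∀ q, R - dist q p₀ ≤ 1 := fun q => by linarith [dist_nonneg (x := q) (y := p₀)]
  obtain ⟨Cv, hCv, hv0⟩ := hv.ordNorm_le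
  obtain ⟨Cl, hCl, hl⟩ := (F.lap_vE_bd hT hSD hB hRH hg hv).ordNorm_le
  set c : ℝ := ∑ i, 3 ^ k * ‖eb i‖
  have hc : 0 ≤ c := Finset.sum_nonneg fun i _ => by positivity
  set C := Cv + Cl
  have hC : 0 ≤ C := add_nonneg hCv hCl
  set C' := 2 * (c * (145 * C * (16 * (c * C + 1))))
  have hC' : 0 ≤ C' := by positivity
  have grad : ∀ s ∈ flowTail s₀ T, ∀ N, 0 ≤ N → (∀ q ∈ B, (R - dist q p₀) * a (s, q) ≤ N) →
      ∀ q ∈ B, (R - dist q p₀) * b (s, q) ≤ C' * ((1 + N) * Real.exp (-s)) := by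
    intro s hs N hN haN q hq
    have hsD := hSD hs
    refine dist_boundary_mul_grad_le (ι := {w : List (Fin 3) // w.length = k})
      (f := fun w q => (dword hW w.1 (F.vE hW)).1 (s, q)) (a := fun q => a (s, q))
      (b := fun q => b (s, q)) hR1 hC hc (Real.exp_pos _).le hN (fun _ => ha0 _) (fun _ => hb0 _)
      ?_ ?_ haN ?_ ?_ ?_ hq
    · exact fun w q hq => (slice_contDiffAt _ hsD (hRH hq)).of_le two_le_top
    · rintro ⟨w, rfl⟩ q hq
      refine (norm_dword_le w _).trans ((hv0 (s, q) ⟨hs, hq⟩).trans ?_)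
      exact mul_le_mul_of_nonneg_right (le_add_of_nonneg_right hCl) (Real.exp_pos _).le
    · rintro ⟨w, rfl⟩ q hq
      simp only [lapE_dword _ w hsD (hRH hq)]
      refine (norm_dword_le w _).trans ((hl (s, q) ⟨hs, hq⟩).trans ?_)
      refine mul_le_mul_of_nonneg_right (le_add_of_nonneg_left hCv) (mul_nonneg ?_ ?_)
      · exact add_nonneg zero_le_one (ha0 _)
      · exact add_nonneg (Real.exp_pos _).le (hb0 _)
    · exact fun q hq M hM => ordNorm_succ_le _ k hsD (hRH hq) hM
    · obtain ⟨M, -, hM⟩ := exists_ordNorm_le (hW := hW) (F.vE hW) (k + 1)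
        ((isCompact_singleton (x := s)).prod hB)
        (prod_mono (singleton_subset_iff.2 hsD) hRH)
      exact ⟨M, fun q hq => hM (s, q) ⟨rfl, hq⟩⟩
  obtain ⟨Cp, hCp, hprod⟩ := ((hg.mul_succ (fun _ _ => zero_le_one)
    (fun x _ => (Real.exp_pos (-x.1)).le) hv).smul Complex.I).ordNorm_le
  rw [← F.dsE_gE' hW] at hprod
  obtain ⟨N₀, hN₀, h0⟩ := exists_ordNorm_le (hW := hW) F.gE (k + 1)
    ((isCompact_singleton (x := s₀)).prod hB)
    (prod_mono (singleton_subset_iff.2 (flowInt_subset hs₀)) hRH)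
  set K : ℝ := 3 ^ (k + 1)
  have hK1 : 1 ≤ K := one_le_pow₀ (by norm_num)
  set CG := Cp * (1 + K + C' * (1 + K))
  have hCG : 0 ≤ CG := by positivity
  set Q := 2 * ((1 + N₀) * Real.exp (2 * CG))
  have hQ : 0 ≤ Q := by positivity
  have hfam : ∀ x ∈ flowTail s₀ T ×ˢ B, ∀ w : {w : List (Fin 3) // w.length = k + 1},
      ‖(R - dist x.2 p₀) • (dword hW w.1 F.gE).1 x‖ ≤ Q := by
    intro x hx w
    refine norm_le_of_deriv_le_exp_neg (ι := B × {w : List (Fin 3) // w.length = k + 1})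
      (f := fun i s => (R - dist i.1.1 p₀) • (dword hW i.2.1 F.gE).1 (s, i.1.1))
      (f' := fun i s => (R - dist i.1.1 p₀) • (dword hW i.2.1 (dsE hW F.gE)).1 (s, i.1.1))
      (s₁ := x.1) hs₀.1.le hCG hN₀ (fun i s hs => ?_) ?_ (fun i => ?_) ?_ (⟨x.2, hx.2⟩, w)
      (s := x.1) ⟨hx.1.1, le_rfl⟩
    · rw [dsE, dword_smoothDer]
      exact (hasDerivAt_slice hW _ (hSI (Icc_subset_flowTail hx.1 hs)) (hRH i.1.2)).const_smul _
    · obtain ⟨M, -, hM⟩ := exists_ordNorm_le (hW := hW) F.gE (k + 1)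
        ((isCompact_Icc (a := s₀) (b := x.1)).prod hB)
        (prod_mono ((Icc_subset_flowTail hx.1).trans hSD) hRH)
      refine ⟨1 * M, ?_⟩
      rintro ⟨p, w, hw⟩ s hs
      rw [norm_smul, Real.norm_of_nonneg (hd0 _ p.2)]
      refine mul_le_mul (hd1 _) ?_ (norm_nonneg _) zero_le_one
      refine (norm_dword_le w _).trans ?_
      rw [hw]
      exact hM (s, p.1) ⟨hs, p.2⟩
    · rcases i with ⟨p, w, hw⟩
      rw [norm_smul, Real.norm_of_nonneg (hd0 _ p.2), ← one_mul N₀]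
      refine mul_le_mul (hd1 _) ?_ (norm_nonneg _) zero_le_one
      refine (norm_dword_le w _).trans ?_
      rw [hw]
      exact h0 (s₀, p.1) ⟨rfl, p.2⟩
    · rintro s hs N hN hfN ⟨p, w, hw⟩
      have hsT := Icc_subset_flowTail hx.1 hs
      have haN : ∀ q ∈ B, (R - dist q p₀) * a (s, q) ≤ K * N := fun q hq => by
        rcases (hd0 q hq).eq_or_lt with h | h
        · rw [← h, zero_mul]; positivity
        · rw [mul_comm, ← le_div_iff₀ h, mul_div_assoc]
          refine ordNorm_le fun w hw => ?_
          rw [le_div_iff₀ h, mul_comm]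
          have := hfN (⟨q, hq⟩, ⟨w, hw⟩)
          rwa [norm_smul, Real.norm_of_nonneg h.le] at this
      have hbN := grad s hsT _ (by positivity) haN p.1 p.2
      have haN' := haN p.1 p.2
      rw [norm_smul, Real.norm_of_nonneg (hd0 _ p.2)]
      have h1 : ‖(dword hW w (dsE hW F.gE)).1 (s, p.1)‖
          ≤ Cp * (1 * Real.exp (-s) + a (s, p.1) * Real.exp (-s) + 1 * b (s, p.1)) := by
        refine (norm_dword_le w _).trans ?_
        rw [hw]
        exact hprod (s, p.1) ⟨hsT, p.2⟩
      refine (mul_le_mul_of_nonneg_left h1 (hd0 _ p.2)).trans ?_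
      set d := R - dist p.1 p₀
      have hdp : d ≤ 1 := hd1 p.1
      have he := Real.exp_pos (-s)
      set e := Real.exp (-s)
      have h2 : d * (Cp * (1 * e + a (s, p.1) * e + 1 * b (s, p.1)))
          = Cp * (d * e + d * a (s, p.1) * e + d * b (s, p.1)) := by ring
      have h3 : CG * e * (1 + N) = Cp * ((1 + K + C' * (1 + K)) * e * (1 + N)) := by
        simp only [CG]; ring
      rw [h2, h3]
      refine mul_le_mul_of_nonneg_left ?_ hCp
      have h4 : d * e ≤ 1 * e := mul_le_mul_of_nonneg_right hdp he.le
      have h5 : d * a (s, p.1) * e ≤ K * N * e := mul_le_mul_of_nonneg_right haN' he.le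
      have h6 : C' * ((1 + K * N) * e) ≤ C' * ((1 + K) * (1 + N) * e) := by
        refine mul_le_mul_of_nonneg_left (mul_le_mul_of_nonneg_right ?_ he.le) hC'
        nlinarith
      have h7 : 1 * e + K * N * e ≤ (1 + K) * (1 + N) * e := by
        have h8 : 1 + K * N ≤ (1 + K) * (1 + N) := by nlinarith
        calc _ = (1 + K * N) * e := by ring
          _ ≤ _ := mul_le_mul_of_nonneg_right h8 he.le
      calc _ ≤ (1 + K) * (1 + N) * e + C' * ((1 + K) * (1 + N) * e) := by linarith
        _ = _ := by ring
  have haQ : ∀ x ∈ flowTail s₀ T ×ˢ B, (R - dist x.2 p₀) * a x ≤ K * Q := fun x hx => by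
    rcases (hd0 x.2 hx.2).eq_or_lt with h | h
    · rw [← h, zero_mul]; positivity
    · rw [mul_comm, ← le_div_iff₀ h, mul_div_assoc]
      refine ordNorm_le fun w hw => ?_
      rw [le_div_iff₀ h, mul_comm]
      have := hfam x hx ⟨w, hw⟩
      rwa [norm_smul, Real.norm_of_nonneg h.le] at this
  have hsub : Metric.closedBall p₀ (R / 2) ⊆ B :=
    Metric.closedBall_subset_closedBall (by linarith)
  have hsub' := prod_mono (Subset.refl (flowTail s₀ T)) hsub
  have hdR : ∀ q ∈ Metric.closedBall p₀ (R / 2), R / 2 ≤ R - dist q p₀ := fun q hq => by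
    have := Metric.mem_closedBall.1 hq
    linarith
  have div_le : ∀ {q : P3} {y M : ℝ}, q ∈ Metric.closedBall p₀ (R / 2) → 0 ≤ y →
      (R - dist q p₀) * y ≤ M → y ≤ 2 / R * M := fun hq hy h => by
    rw [div_mul_eq_mul_div, le_div_iff₀ hR]
    have := mul_le_mul_of_nonneg_right (hdR _ hq) hy
    linarith
  refine ⟨(hg.subset hsub').succ_of_ordNorm_le ⟨2 / R * (K * Q), by positivity, fun x hx => ?_⟩,
    (hv.subset hsub').succ_of_ordNorm_le
      ⟨2 / R * (C' * (1 + K * Q)), by positivity, fun x hx => ?_⟩⟩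
  · rw [mul_one]
    exact div_le hx.2 (ha0 x) (haQ x (hsub' hx))
  · rw [mul_assoc, mul_assoc]
    exact div_le hx.2 (hb0 x) (grad x.1 hx.1 _ (by positivity)
      (fun q hq => haQ (x.1, q) ⟨hx.1, hq⟩) x.2 (hsub hx.2))

/-- Interior estimates for the flow, to all orders. -/
theorem exists_bd (hT : 0 < T) (hX : XnormSqInt D < ⊤) (hs₀ : s₀ ∈ flowInt T) {p₀ : P3}
    (hp₀ : p₀ ∈ Hsp) (k : ℕ) : ∃ R, 0 < R ∧ Metric.closedBall p₀ R ⊆ Hsp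
      ∧ Bd hW (flowTail s₀ T ×ˢ Metric.closedBall p₀ R) (fun _ => 1) k F.gE
      ∧ Bd hW (flowTail s₀ T ×ˢ Metric.closedBall p₀ R) (fun x => Real.exp (-x.1)) k
        (F.vE hW) := by
  suffices h : ∃ R, 0 < R ∧ R ≤ 1 ∧ Metric.closedBall p₀ R ⊆ Hsp
      ∧ Bd hW (flowTail s₀ T ×ˢ Metric.closedBall p₀ R) (fun _ => 1) k F.gE
      ∧ Bd hW (flowTail s₀ T ×ˢ Metric.closedBall p₀ R) (fun x => Real.exp (-x.1)) k
        (F.vE hW) by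
    obtain ⟨R, h1, -, h⟩ := h
    exact ⟨R, h1, h⟩
  induction k with
  | zero =>
    obtain ⟨R, hR, hRH⟩ := Metric.nhds_basis_closedBall.mem_iff.1 (isOpen_Hsp.mem_nhds hp₀)
    have hsub : Metric.closedBall p₀ (min R 1) ⊆ Hsp :=
      (Metric.closedBall_subset_closedBall (min_le_left _ _)).trans hRH
    exact ⟨min R 1, lt_min hR one_pos, min_le_right _ _, hsub,
      F.bd_zero hT hX hs₀.1 (isCompact_closedBall _ _) hsub⟩
  | succ k ih =>
    obtain ⟨R, hR, hR1, hRH, hg, hv⟩ := ih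
    exact ⟨R / 2, half_pos hR, by linarith,
      (Metric.closedBall_subset_closedBall (by linarith)).trans hRH,
      F.bd_succ hT hs₀ hR hR1 hRH hg hv⟩

end KWFlow

end FlowEstimates

section FlowEquations

variable {T : ℝ≥0∞} {s : ℝ} {D : DataSet Hsp} {hW : GoodDom (flowW T)}

lemma star_curv_eq_neg {E : Type*} [NormedAddCommGroup E] [NormedSpace ℝ E] {𝔸 : Type*}
    [CStarAlgebra 𝔸] {W : Set E} (hW : GoodDom W) (v w : E) {a b : smoothAlg 𝔸 W}
    (ha : star a = -a) (hb : star b = -b) :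
    star (curv (smoothDer hW v) (smoothDer hW w) a b)
      = -curv (smoothDer hW v) (smoothDer hW w) a b := by
  simp only [curv, star_add, star_sub, star_mul, ← smoothDer_star, ha, hb, map_neg,
    smoothAlg.neg_mul, smoothAlg.mul_neg]
  abel

/-- Slices of the real and imaginary parts of the complex curvature. -/
lemma IsSlice.curv_add {At A1 A2 a3 : smoothAlg N2 (flowW T)} {hAt hA1 hA2 ha3 : P3 → M2}
    (hs : s ∈ flowDom T) (rt : IsSlice s At hAt) (r1 : IsSlice s A1 hA1) (r2 : IsSlice s A2 hA2)
    (r3 : IsSlice s a3 ha3) :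
    IsSlice s (curv (dxE hW et) (dxE hW ez1) At A1 - cov (dxE hW ez2) A2 a3)
        (fun p => EA1Of hAt hA1 p - _root_.cd hA2 ez2 ha3 p)
      ∧ IsSlice s (curv (dxE hW et) (dxE hW ez2) At A2 + cov (dxE hW ez1) A1 a3)
        (fun p => EA2Of hAt hA2 p + _root_.cd hA1 ez1 ha3 p) :=
  ⟨(((r1.pd hW hs et).sub (rt.pd hW hs ez1)).add (rt.mcomm r1)).sub (r2.cd hW hs ez2 r3),
    (((r2.pd hW hs et).sub (rt.pd hW hs ez2)).add (rt.mcomm r2)).add (r1.cd hW hs ez1 r3)⟩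

namespace KWFlow

variable (F : KWFlow D T)

lemma star_half_sub (b : smoothAlg N2 (flowW T)) :
    star ((2:ℂ)⁻¹ • (b - star b)) = -((2:ℂ)⁻¹ • (b - star b)) := by
  rw [star_smul, star_sub, star_star]
  have : star (2:ℂ)⁻¹ = (2:ℂ)⁻¹ := by simp
  rw [this]; module

lemma star_I_half_add (b : smoothAlg N2 (flowW T)) :
    star ((Complex.I * (2:ℂ)⁻¹) • (b + star b)) = -((Complex.I * (2:ℂ)⁻¹) • (b + star b)) := by
  rw [star_smul, star_add, star_star]
  have : star (Complex.I * (2:ℂ)⁻¹) = -(Complex.I * (2:ℂ)⁻¹) := by simp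
  rw [this]; module

/-- The complex gauge action preserves the first three Kapustin-Witten equations. -/
theorem kw123_Ds (hKW : KW123 Hsp D) (hW : GoodDom (flowW T)) (hs : s ∈ flowDom T) :
    KW123 Hsp (F.Ds s) := by
  intro p hp
  obtain ⟨k1, k2, k3, k4⟩ := hKW p hp
  have dz : IsDer (dxE (𝔸 := N2) hW ez1 + Complex.I • dxE hW ez2) :=
    (isDer_smoothDer hW (0, ez1)).add ((isDer_smoothDer hW (0, ez2)).smul Complex.I)
  have dt : IsDer (dxE (𝔸 := N2) hW et) := isDer_smoothDer hW (0, et)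
  have hc : ∀ v w x, smoothDer hW v (smoothDer hW w x)
    = smoothDer (𝔸 := N2) hW w (smoothDer hW v x) := fun v w x => smoothDer_comm hW v w x
  have r : ∀ {h : P3 → M2} (hh : ContDiffOn ℝ (⊤:ℕ∞) h Hsp), IsSlice s (baseE T hh) h :=
    fun hh => baseE_isSlice hh hs
  have conj0 : ∀ {x : smoothAlg N2 (flowW T)}, x.1 (s, p) = 0 →
      (F.gE * x * F.giE).1 (s, p) = 0 := fun {x} hx => by
    change F.gE.1 (s, p) * x.1 (s, p) * F.giE.1 (s, p) = 0
    rw [hx, mul_zero, zero_mul]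
  have rt := F.AtE_isSlice hW hs
  have r1 := F.A1E_isSlice hW hs
  have r2 := F.A2E_isSlice hW hs
  have r3 := F.a3E_isSlice hW hs
  have rf := F.fE_isSlice hs
  have e1 : (curv (dxE hW et) (dxE hW ez1 + Complex.I • dxE hW ez2) (F.bE hW) (F.cE hW)).1 (s, p)
      = 0 := by
    rw [KWFlow.bE, KWFlow.cE, curv_gaugeC dt dz (fun x => by simp [dxE, hc (0, et)]) F.gE_mul_giE F.giE_mul_gE]
    refine conj0 ?_
    rw [DataSet.bE, DataSet.cE, curv_complex]
    obtain ⟨q1, q2⟩ := IsSlice.curv_add (hW := hW) hs (r D.smooth_At) (r D.smooth_A1)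
      (r D.smooth_A2) (r D.smooth_a3)
    rw [(q1.add (q2.smul Complex.I)) p hp]
    beta_reduce
    rw [k1, k2, sub_self, neg_add_cancel, smul_zero, add_zero,
      toN_zero]
  rw [← F.AtE_sub, ← F.A1E_add, curv_complex] at e1
  have st : star (F.AtE hW) = -F.AtE hW := star_half_sub _
  have s1 : star (F.A1E hW) = -F.A1E hW := star_half_sub _
  have s3 : star (F.a3E hW) = -F.a3E hW := star_I_half_add _
  have s2 : star (F.A2E hW) = -F.A2E hW := by
    rw [A2E, neg_mul, neg_smul, star_neg, star_I_half_add]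
  obtain ⟨q1, q2⟩ := IsSlice.curv_add (hW := hW) hs rt r1 r2 r3
  have z1 : star ((curv (dxE hW et) (dxE hW ez1) (F.AtE hW) (F.A1E hW)
      - cov (dxE hW ez2) (F.A2E hW) (F.a3E hW)).1 (s, p))
      = -(curv (dxE hW et) (dxE hW ez1) (F.AtE hW) (F.A1E hW)
      - cov (dxE hW ez2) (F.A2E hW) (F.a3E hW)).1 (s, p) := by
    refine congrArg (fun G : smoothAlg N2 (flowW T) => G.1 (s, p))
      (a₁ := star (curv (dxE hW et) (dxE hW ez1) (F.AtE hW) (F.A1E hW)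
      - cov (dxE hW ez2) (F.A2E hW) (F.a3E hW))) (a₂ := -_) ?_
    rw [star_sub, star_curv_eq_neg hW _ _ st s1,
      star_cov _ _ (smoothDer_star hW (0, ez2)) _ _ s3, s2, neg_neg, neg_sub']
  have z2 : star ((curv (dxE hW et) (dxE hW ez2) (F.AtE hW) (F.A2E hW)
      + cov (dxE hW ez1) (F.A1E hW) (F.a3E hW)).1 (s, p))
      = -(curv (dxE hW et) (dxE hW ez2) (F.AtE hW) (F.A2E hW)
      + cov (dxE hW ez1) (F.A1E hW) (F.a3E hW)).1 (s, p) := by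
    refine congrArg (fun G : smoothAlg N2 (flowW T) => G.1 (s, p))
      (a₁ := star (curv (dxE hW et) (dxE hW ez2) (F.AtE hW) (F.A2E hW)
      + cov (dxE hW ez1) (F.A1E hW) (F.a3E hW))) (a₂ := -_) ?_
    rw [star_add, star_curv_eq_neg hW _ _ st s2,
      star_cov _ _ (smoothDer_star hW (0, ez1)) _ _ s3, s1, neg_neg, neg_add]
  obtain ⟨y1, y2⟩ := eq_zero_of_add_I_smul z1 z2 e1
  rw [q1 p hp, ← toN_zero, toN_inj, sub_eq_zero] at y1
  rw [q2 p hp, ← toN_zero, toN_inj, add_eq_zero_iff_eq_neg] at y2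
  have e3 : (cov (dxE hW ez1 + Complex.I • dxE hW ez2) (F.cE hW) F.fE).1 (s, p) = 0 := by
    rw [KWFlow.cE, KWFlow.fE, cov_gaugeC dz F.gE_mul_giE F.giE_mul_gE]
    refine conj0 ?_
    rw [DataSet.cE, cov_complex_z]
    refine ((((r D.smooth_A1).cd hW hs ez1 (D.fE_isSlice hs)).add
      (((r D.smooth_A2).cd hW hs ez2 (D.fE_isSlice hs)).smul Complex.I)) p hp).trans ?_
    beta_reduce
    rw [k3, toN_zero]
  rw [← F.A1E_add, cov_complex_z] at e3
  replace e3 := (((r1.cd hW hs ez1 rf).add ((r2.cd hW hs ez2 rf).smul Complex.I)) p hp).symm.trans e3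
  have e4 : (cov (dxE hW et) (F.bE hW) F.fE).1 (s, p) = 0 := by
    rw [KWFlow.bE, KWFlow.fE, cov_gaugeC dt F.gE_mul_giE F.giE_mul_gE]
    refine conj0 ?_
    rw [DataSet.bE, cov_complex_t]
    refine ((((r D.smooth_At).cd hW hs et (D.fE_isSlice hs)).sub
      (((r D.smooth_a3).mcomm (D.fE_isSlice hs)).smul Complex.I)) p hp).trans ?_
    beta_reduce
    rw [k4, sub_self, toN_zero]
  rw [← F.AtE_sub, cov_complex_t] at e4
  replace e4 := (((rt.cd hW hs et rf).sub ((r3.mcomm rf).smul Complex.I)) p hp).symm.trans e4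
  rw [← toN_zero, toN_inj] at e3 e4
  exact ⟨y1, y2, e3, sub_eq_zero.1 e4⟩

end KWFlow

end FlowEquations

section FlowLimit

variable {T : ℝ≥0∞} {s₀ : ℝ} {D : DataSet Hsp} {hW : GoodDom (flowW T)}

/-- All spatial derivatives are locally bounded along the flow, and those of the time derivative
decay exponentially. -/
def LocBd (hW : GoodDom (flowW T)) (s₀ : ℝ) (F : smoothAlg N2 (flowW T)) : Prop :=
  ∀ k, ∀ p ∈ Hsp, ∃ U ∈ 𝓝 p, Bd hW (flowTail s₀ T ×ˢ U) (fun _ => 1) k F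
    ∧ Bd hW (flowTail s₀ T ×ˢ U) (fun x => Real.exp (-x.1)) k (dsE hW F)

lemma Bd.zero {Z : Set (ℝ × P3)} {β : ℝ × P3 → ℝ} (k : ℕ) :
    Bd hW Z β k (0 : smoothAlg N2 (flowW T)) := by
  have h0 : ∃ C, 0 ≤ C ∧ ∀ x ∈ Z, ‖(0 : smoothAlg N2 (flowW T)).1 x‖ ≤ C * β x :=
    ⟨0, le_rfl, fun x _ => by rw [zero_mul]; exact norm_le_zero_iff.2 rfl⟩
  induction k with
  | zero => exact h0
  | succ k ih => exact ⟨h0, fun i => by rw [map_zero]; exact ih⟩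

namespace LocBd

variable {F G : smoothAlg N2 (flowW T)}

lemma add (hF : LocBd hW s₀ F) (hG : LocBd hW s₀ G) : LocBd hW s₀ (F + G) := fun k p hp => by
  obtain ⟨U, hU, h1, h2⟩ := hF k p hp
  obtain ⟨V, hV, h3, h4⟩ := hG k p hp
  refine ⟨U ∩ V, inter_mem hU hV, ?_, ?_⟩
  · exact (h1.subset (prod_mono_right inter_subset_left)).add
      (h3.subset (prod_mono_right inter_subset_right))
  · rw [map_add]
    exact (h2.subset (prod_mono_right inter_subset_left)).add
      (h4.subset (prod_mono_right inter_subset_right))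

lemma smul (c : ℂ) (hF : LocBd hW s₀ F) : LocBd hW s₀ (c • F) := fun k p hp => by
  obtain ⟨U, hU, h1, h2⟩ := hF k p hp
  exact ⟨U, hU, h1.smul c, by rw [map_smul]; exact h2.smul c⟩

lemma sub (hF : LocBd hW s₀ F) (hG : LocBd hW s₀ G) : LocBd hW s₀ (F - G) := by
  have h : F - G = F + (-1:ℂ) • G := by module
  rw [h]; exact hF.add (hG.smul _)

lemma star (hF : LocBd hW s₀ F) : LocBd hW s₀ (star F) := fun k p hp => by
  obtain ⟨U, hU, h1, h2⟩ := hF k p hp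
  exact ⟨U, hU, h1.star, by rw [smoothDer_star]; exact h2.star⟩

lemma mul (hF : LocBd hW s₀ F) (hG : LocBd hW s₀ G) : LocBd hW s₀ (F * G) := fun k p hp => by
  obtain ⟨U, hU, h1, h2⟩ := hF k p hp
  obtain ⟨V, hV, h3, h4⟩ := hG k p hp
  replace h1 := h1.subset (prod_mono_right (s := flowTail s₀ T) (inter_subset_left (t := V)))
  replace h2 := h2.subset (prod_mono_right (s := flowTail s₀ T) (inter_subset_left (t := V)))
  replace h3 := h3.subset (prod_mono_right (s := flowTail s₀ T) (inter_subset_right (s := U)))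
  replace h4 := h4.subset (prod_mono_right (s := flowTail s₀ T) (inter_subset_right (s := U)))
  refine ⟨U ∩ V, inter_mem hU hV, ?_, ?_⟩
  · simpa using h1.mul h3
  · rw [smoothDer_mul]
    refine Bd.add ?_ ?_
    · simpa using h2.mul h3
    · simpa using h1.mul h4

lemma dxE (hF : LocBd hW s₀ F) (i : Fin 3) : LocBd hW s₀ (dxE hW (eb i) F) := fun k p hp => by
  obtain ⟨U, hU, h1, h2⟩ := hF (k + 1) p hp
  exact ⟨U, hU, h1.der i, by rw [smoothDer_comm]; exact h2.der i⟩

lemma baseE (hT : 0 < T) (hs₀ : 0 < s₀) {h : P3 → M2} (hh : ContDiffOn ℝ (⊤:ℕ∞) h Hsp) :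
    LocBd hW s₀ (baseE T hh) := fun k p hp => by
  obtain ⟨R, hR, hRH⟩ := Metric.nhds_basis_closedBall.mem_iff.1 (isOpen_Hsp.mem_nhds hp)
  refine ⟨_, Metric.closedBall_mem_nhds p hR, ?_, ?_⟩
  · exact baseE_bd hh ⟨le_rfl, by simpa using hT⟩ (flowTail_subset_flowDom hs₀)
      (isCompact_closedBall _ _) hRH k
  · rw [der_baseE]
    exact Bd.zero k

end LocBd

namespace KWFlow

variable (F : KWFlow D T)

lemma locBd_gE (hT : 0 < T) (hX : XnormSqInt D < ⊤) (hs₀ : s₀ ∈ flowInt T) :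
    LocBd hW s₀ F.gE := fun k p hp => by
  obtain ⟨R, hR, -, h1, h2⟩ := F.exists_bd (hW := hW) hT hX hs₀ hp k
  refine ⟨_, Metric.closedBall_mem_nhds p hR, h1, ?_⟩
  rw [F.dsE_gE']
  simpa using (h1.mul h2).smul Complex.I

lemma locBd_giE (hT : 0 < T) (hX : XnormSqInt D < ⊤) (hs₀ : s₀ ∈ flowInt T) :
    LocBd hW s₀ F.giE := fun k p hp => by
  obtain ⟨U, hU, h1, h2⟩ := F.locBd_gE (hW := hW) hT hX hs₀ k p hp
  refine ⟨U, hU, F.giE_bd h1, ?_⟩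
  rw [(isDer_smoothDer hW (1, 0)).map_inv F.gE_mul_giE F.giE_mul_gE]
  simpa using (((F.giE_bd h1).mul h2).mul (F.giE_bd h1)).neg

lemma locBd_bE (hT : 0 < T) (hX : XnormSqInt D < ⊤) (hs₀ : s₀ ∈ flowInt T) :
    LocBd hW s₀ (F.bE hW) := by
  have hg := F.locBd_gE (hW := hW) hT hX hs₀
  have hi := F.locBd_giE (hW := hW) hT hX hs₀
  exact ((hg.mul ((LocBd.baseE hT hs₀.1 _).sub ((LocBd.baseE hT hs₀.1 _).smul _))).mul hi).sub
    ((hg.dxE 0).mul hi)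

lemma locBd_cE (hT : 0 < T) (hX : XnormSqInt D < ⊤) (hs₀ : s₀ ∈ flowInt T) :
    LocBd hW s₀ (F.cE hW) := by
  have hg := F.locBd_gE (hW := hW) hT hX hs₀
  have hi := F.locBd_giE (hW := hW) hT hX hs₀
  exact ((hg.mul ((LocBd.baseE hT hs₀.1 _).add ((LocBd.baseE hT hs₀.1 _).smul _))).mul hi).sub
    (((hg.dxE 1).add ((hg.dxE 2).smul _)).mul hi)

lemma locBd_fE (hT : 0 < T) (hX : XnormSqInt D < ⊤) (hs₀ : s₀ ∈ flowInt T) :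
    LocBd hW s₀ F.fE :=
  ((F.locBd_gE hT hX hs₀).mul (LocBd.baseE hT hs₀.1 _)).mul (F.locBd_giE hT hX hs₀)

end KWFlow

/-- The pointwise limit along a sequence of times. -/
def flowLim (σ : ℕ → ℝ) (F : smoothAlg N2 (flowW T)) (p : P3) : N2 :=
  limUnder atTop fun n => F.1 (σ n, p)

variable {F : smoothAlg N2 (flowW T)} {σ : ℕ → ℝ} {L : ℝ}

lemma LocBd.exists_norm_sub_le (hF : LocBd hW s₀ F) (hs₀ : 0 < s₀) {p : P3} (hp : p ∈ Hsp) :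
    ∃ U ∈ 𝓝 p, ∃ C, 0 ≤ C ∧ ∀ q ∈ U ∩ Hsp, ∀ s ∈ flowTail s₀ T, ∀ s' ∈ flowTail s₀ T, s ≤ s' →
      ‖F.1 (s', q) - F.1 (s, q)‖ ≤ C * (Real.exp (-s) - Real.exp (-s')) := by
  obtain ⟨U, hU, -, h2⟩ := hF 0 p hp
  obtain ⟨C, hC, h⟩ := h2
  refine ⟨U, hU, C, hC, fun q hq s hs s' hs' hss => ?_⟩
  have hI : Icc s s' ⊆ flowTail s₀ T := fun r hr => ⟨hs.1.trans hr.1,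
    (ENNReal.ofReal_le_ofReal hr.2).trans_lt hs'.2⟩
  have hd : ∀ r ∈ Icc s s', HasDerivAt (fun r => F.1 (r, q) - F.1 (s, q))
      ((dsE hW F).1 (r, q)) r := fun r hr =>
    (hasDerivAt_slice hW F (flowTail_subset_flowInt hs₀ (hI hr)) hq.2).sub_const _
  have hB : ∀ r, HasDerivAt (fun r => C * (Real.exp (-s) - Real.exp (-r)))
      (C * Real.exp (-r)) r := fun r => by
    have := (((hasDerivAt_neg r).exp).const_sub (Real.exp (-s))).const_mul C
    simpa using this
  refine image_norm_le_of_norm_deriv_right_le_deriv_boundary'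
    (fun r hr => (hd r hr).continuousAt.continuousWithinAt)
    (fun r hr => (hd r (Ico_subset_Icc_self hr)).hasDerivWithinAt) ?_
    (fun r _ => (hB r).continuousAt.continuousWithinAt)
    (fun r _ => (hB r).hasDerivWithinAt)
    (fun r hr => h (r, q) ⟨hI (Ico_subset_Icc_self hr), hq.1⟩) (right_mem_Icc.2 hss)
  simp

/-- Quantitative convergence along the flow. -/
lemma LocBd.exists_norm_sub_flowLim_le (hF : LocBd hW s₀ F) (hs₀ : 0 < s₀) (hσ : Monotone σ)
    (hm : ∀ n, σ n ∈ flowTail s₀ T) (hL : Tendsto (fun n => Real.exp (-σ n)) atTop (𝓝 L))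
    {p : P3} (hp : p ∈ Hsp) :
    ∃ U ∈ 𝓝 p, ∃ C, 0 ≤ C ∧ ∀ q ∈ U ∩ Hsp, ∀ n,
      ‖flowLim σ F q - F.1 (σ n, q)‖ ≤ C * (Real.exp (-σ n) - L) := by
  obtain ⟨U, hU, C, hC, h⟩ := hF.exists_norm_sub_le hs₀ hp
  refine ⟨U, hU, C, hC, fun q hq n => ?_⟩
  have hb : ∀ n m, n ≤ m → ‖F.1 (σ m, q) - F.1 (σ n, q)‖
      ≤ C * (Real.exp (-σ n) - Real.exp (-σ m)) := fun n m hnm =>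
    h q hq _ (hm n) _ (hm m) (hσ hnm)
  have hge : ∀ n, L ≤ Real.exp (-σ n) := fun n =>
    le_of_tendsto hL (eventually_atTop.2 ⟨n, fun m hnm =>
      Real.exp_le_exp.2 (neg_le_neg (hσ hnm))⟩)
  have hc : CauchySeq fun n => F.1 (σ n, q) := by
    refine cauchySeq_of_le_tendsto_0' (fun n => C * (Real.exp (-σ n) - L)) (fun n m hnm => ?_) ?_
    · rw [dist_comm, dist_eq_norm]
      exact (hb n m hnm).trans (mul_le_mul_of_nonneg_left (by linarith [hge m]) hC)
    · simpa using (hL.sub_const L).const_mul C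
  have hl : Tendsto (fun m => F.1 (σ m, q)) atTop (𝓝 (flowLim σ F q)) := hc.tendsto_limUnder
  exact le_of_tendsto_of_tendsto ((hl.sub_const (F.1 (σ n, q))).norm)
    ((tendsto_const_nhds.sub hL).const_mul C) (eventually_atTop.2 ⟨n, fun m hnm => hb n m hnm⟩)

lemma LocBd.tendstoLocallyUniformlyOn (hF : LocBd hW s₀ F) (hs₀ : 0 < s₀) (hσ : Monotone σ)
    (hm : ∀ n, σ n ∈ flowTail s₀ T) (hL : Tendsto (fun n => Real.exp (-σ n)) atTop (𝓝 L)) :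
    TendstoLocallyUniformlyOn (fun n p => F.1 (σ n, p)) (flowLim σ F) atTop Hsp := by
  refine Metric.tendstoLocallyUniformlyOn_iff.2 fun ε hε p hp => ?_
  obtain ⟨U, hU, C, hC, h⟩ := hF.exists_norm_sub_flowLim_le hs₀ hσ hm hL hp
  refine ⟨U ∩ Hsp, inter_mem (mem_nhdsWithin_of_mem_nhds hU) self_mem_nhdsWithin, ?_⟩
  have h0 : Tendsto (fun n => C * (Real.exp (-σ n) - L)) atTop (𝓝 0) := by
    simpa using (hL.sub_const L).const_mul C
  filter_upwards [h0.eventually_lt_const hε] with n hn q hq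
  rw [dist_eq_norm]
  exact (h q hq n).trans_lt hn

end FlowLimit

section FlowLimitSmooth

variable {T : ℝ≥0∞} {s₀ : ℝ} {D : DataSet Hsp} {hW : GoodDom (flowW T)}

/-- A monotone sequence of times in the tail of the flow along which `exp (-s)` tends to `L`. -/
structure FlowSeq (T : ℝ≥0∞) (s₀ : ℝ) (σ : ℕ → ℝ) (L : ℝ) : Prop where
  pos : 0 < s₀
  mono : Monotone σ
  mem : ∀ n, σ n ∈ flowTail s₀ T
  tendsto_exp : Tendsto (fun n => Real.exp (-σ n)) atTop (𝓝 L)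

/-- The coordinate functionals dual to `eb`. -/
def coordL : Fin 3 → (P3 →L[ℝ] ℝ) :=
  ![.fst ℝ ℝ (ℝ × ℝ), (ContinuousLinearMap.fst ℝ ℝ ℝ).comp (.snd ℝ ℝ (ℝ × ℝ)),
    (ContinuousLinearMap.snd ℝ ℝ ℝ).comp (.snd ℝ ℝ (ℝ × ℝ))]

/-- The contribution of the `i`-th partial derivative to the total derivative. -/
def gradL (i : Fin 3) : N2 →L[ℝ] (P3 →L[ℝ] N2) :=
  ContinuousLinearMap.smulRightL ℝ P3 N2 (coordL i)

lemma sum_coordL_smul_eb (v : P3) : ∑ i, coordL i v • eb i = v := by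
  simp [Fin.sum_univ_three, coordL, eb, et, ez1, ez2]

lemma fderiv_eq_sum_gradL (f : P3 → N2) (p : P3) :
    fderiv ℝ f p = ∑ i, gradL i (fderiv ℝ f p (eb i)) := by
  refine ContinuousLinearMap.ext fun v => ?_
  conv_lhs => rw [← sum_coordL_smul_eb v, map_sum]
  rw [_root_.sum_apply]
  refine Finset.sum_congr rfl fun i _ => ?_
  rw [map_smul]
  rfl

namespace FlowSeq

variable {F : smoothAlg N2 (flowW T)} {σ : ℕ → ℝ} {L : ℝ}

lemma mem_flowDom (S : FlowSeq T s₀ σ L) (n : ℕ) : σ n ∈ flowDom T :=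
  flowTail_subset_flowDom S.pos (S.mem n)

lemma tendstoLocallyUniformlyOn (S : FlowSeq T s₀ σ L) (hF : LocBd hW s₀ F) :
    TendstoLocallyUniformlyOn (fun n p => F.1 (σ n, p)) (flowLim σ F) atTop Hsp :=
  hF.tendstoLocallyUniformlyOn S.pos S.mono S.mem S.tendsto_exp

lemma tendsto_flowLim (S : FlowSeq T s₀ σ L) (hF : LocBd hW s₀ F) {p : P3} (hp : p ∈ Hsp) :
    Tendsto (fun n => F.1 (σ n, p)) atTop (𝓝 (flowLim σ F p)) :=
  (S.tendstoLocallyUniformlyOn hF).tendsto_at hp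

lemma fderiv_slice_eq (S : FlowSeq T s₀ σ L) (hW : GoodDom (flowW T)) (F : smoothAlg N2 (flowW T))
    {p : P3} (hp : p ∈ Hsp) (n : ℕ) :
    fderiv ℝ (fun q => F.1 (σ n, q)) p = ∑ i, gradL i ((dxE hW (eb i) F).1 (σ n, p)) := by
  rw [fderiv_eq_sum_gradL]
  exact Finset.sum_congr rfl fun i _ => by rw [fderiv_slice hW F (S.mem_flowDom n) hp]

lemma hasFDerivAt_slice (S : FlowSeq T s₀ σ L) (hW : GoodDom (flowW T))
    (F : smoothAlg N2 (flowW T)) {p : P3} (hp : p ∈ Hsp) (n : ℕ) :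
    HasFDerivAt (fun q => F.1 (σ n, q)) (∑ i, gradL i ((dxE hW (eb i) F).1 (σ n, p))) p := by
  rw [← S.fderiv_slice_eq hW F hp n]
  exact ((slice_contDiffAt F (S.mem_flowDom n) hp).differentiableAt (by simp)).hasFDerivAt

lemma hasFDerivAt_flowLim (S : FlowSeq T s₀ σ L) (hF : LocBd hW s₀ F) {p : P3} (hp : p ∈ Hsp) :
    HasFDerivAt (flowLim σ F) (∑ i, gradL i (flowLim σ (dxE hW (eb i) F) p)) p := by
  have h i := (gradL i).uniformContinuous.comp_tendstoLocallyUniformlyOn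
    (S.tendstoLocallyUniformlyOn (hF.dxE i))
  refine hasFDerivAt_of_tendstoLocallyUniformlyOn isOpen_Hsp
    (f' := fun n p => ∑ i, gradL i ((dxE hW (eb i) F).1 (σ n, p)))
    (g' := fun p => ∑ i, gradL i (flowLim σ (dxE hW (eb i) F) p)) ?_
    (fun n x hx => S.hasFDerivAt_slice hW F hx n) (fun x hx => S.tendsto_flowLim hF hx) hp
  simp only [Fin.sum_univ_three]
  exact ((h 0).add (h 1)).add (h 2)

lemma contDiffOn_flowLim (S : FlowSeq T s₀ σ L) (hF : LocBd hW s₀ F) :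
    ContDiffOn ℝ (⊤:ℕ∞) (flowLim σ F) Hsp := by
  refine contDiffOn_infty.2 fun n => ?_
  induction n generalizing F with
  | zero =>
    exact contDiffOn_zero.2 fun p hp =>
      (S.hasFDerivAt_flowLim hF hp).continuousAt.continuousWithinAt
  | succ n ih =>
    have hc : ((n + 1 : ℕ) : WithTop ℕ∞) = n + 1 := by norm_cast
    rw [hc]
    refine (contDiffOn_succ_iff_fderiv_of_isOpen isOpen_Hsp).2 ⟨fun p hp =>
      (S.hasFDerivAt_flowLim hF hp).differentiableAt.differentiableWithinAt, fun h => ?_, ?_⟩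
    · exact absurd h (WithTop.natCast_ne_top n)
    · refine ContDiffOn.congr (ContDiffOn.sum fun i _ => ?_) fun p hp =>
        (S.hasFDerivAt_flowLim hF hp).fderiv
      exact (gradL i).contDiff.comp_contDiffOn (ih (hF.dxE i))

lemma contDiffAt_sub_flowLim (S : FlowSeq T s₀ σ L) (hF : LocBd hW s₀ F) {p : P3} (hp : p ∈ Hsp)
    (n : ℕ) : ContDiffAt ℝ (⊤:ℕ∞) (fun q => F.1 (σ n, q) - flowLim σ F q) p :=
  (slice_contDiffAt F (S.mem_flowDom n) hp).sub
    ((S.contDiffOn_flowLim hF).contDiffAt (isOpen_Hsp.mem_nhds hp))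

lemma norm_iteratedFDeriv_succ_sub_le (S : FlowSeq T s₀ σ L) (hF : LocBd hW s₀ F) {p : P3}
    (hp : p ∈ Hsp) (n m : ℕ) :
    ‖iteratedFDeriv ℝ (m + 1) (fun q => F.1 (σ n, q) - flowLim σ F q) p‖
      ≤ ∑ i, ‖gradL i‖ * ‖iteratedFDeriv ℝ m (fun q => (dxE hW (eb i) F).1 (σ n, q)
          - flowLim σ (dxE hW (eb i) F) q) p‖ := by
  set w : Fin 3 → P3 → N2 := fun i q => (dxE hW (eb i) F).1 (σ n, q)
    - flowLim σ (dxE hW (eb i) F) q with hw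
  have hwd : ∀ i, ContDiffAt ℝ (⊤:ℕ∞) (w i) p := fun i =>
    S.contDiffAt_sub_flowLim (hF.dxE i) hp n
  have hmt : (m : WithTop ℕ∞) ≤ ((⊤:ℕ∞) : WithTop ℕ∞) := by exact_mod_cast le_top
  have hgd : ∀ i, ContDiffAt ℝ m (gradL i ∘ w i) p := fun i =>
    ((gradL i).contDiff.contDiffAt.comp p (hwd i)).of_le hmt
  have he : fderiv ℝ (fun q => F.1 (σ n, q) - flowLim σ F q) =ᶠ[𝓝 p]
      gradL 0 ∘ w 0 + gradL 1 ∘ w 1 + gradL 2 ∘ w 2 := by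
    filter_upwards [isOpen_Hsp.mem_nhds hp] with q hq
    refine ((S.hasFDerivAt_slice hW F hq n).sub (S.hasFDerivAt_flowLim hF hq)).fderiv.trans ?_
    rw [← Finset.sum_sub_distrib, Fin.sum_univ_three]
    simp only [← map_sub]
    rfl
  rw [← norm_iteratedFDeriv_fderiv, (he.iteratedFDeriv ℝ m).eq_of_nhds,
    iteratedFDeriv_add_apply (f := gradL 0 ∘ w 0 + gradL 1 ∘ w 1) ((hgd 0).add (hgd 1)) (hgd 2),
    iteratedFDeriv_add_apply (hgd 0) (hgd 1), Fin.sum_univ_three]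
  refine (norm_add₃_le).trans ?_
  have h i := (gradL i).norm_iteratedFDeriv_comp_left (hwd i) hmt
  exact add_le_add (add_le_add (h 0) (h 1)) (h 2)

lemma eventually_norm_iteratedFDeriv_sub_le (S : FlowSeq T s₀ σ L) (hF : LocBd hW s₀ F)
    {K : Set P3} (hK : IsCompact K) (hKH : K ⊆ Hsp) (m : ℕ) {ε : ℝ} (hε : 0 < ε) :
    ∀ᶠ n in atTop, ∀ p ∈ K,
      ‖iteratedFDeriv ℝ m (fun q => F.1 (σ n, q) - flowLim σ F q) p‖ ≤ ε := by
  induction m generalizing F ε with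
  | zero =>
    have h := (tendstoLocallyUniformlyOn_iff_forall_isCompact isOpen_Hsp).1
      (S.tendstoLocallyUniformlyOn hF) K hKH hK
    filter_upwards [Metric.tendstoUniformlyOn_iff.1 h ε hε] with n hn p hp
    rw [norm_iteratedFDeriv_zero, ← dist_eq_norm, dist_comm]
    exact (hn p hp).le
  | succ m ih =>
    set M := ∑ i, ‖gradL i‖ with hM
    have hM0 : 0 ≤ M := Finset.sum_nonneg fun i _ => (gradL i).opNorm_nonneg
    have hδ : 0 < ε / (M + 1) := by positivity
    filter_upwards [eventually_all.2 fun i => ih (hF.dxE i) hδ] with n hn p hp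
    refine (S.norm_iteratedFDeriv_succ_sub_le hF (hKH hp) n m).trans ?_
    refine (Finset.sum_le_sum fun i _ =>
      mul_le_mul_of_nonneg_left (hn i p hp) (gradL i).opNorm_nonneg).trans ?_
    rw [← Finset.sum_mul, ← hM, ← mul_div_assoc, div_le_iff₀ (by positivity)]
    nlinarith

/-- Convergence of all derivatives, uniformly on compact sets, after a linear change of the
target. -/
lemma tendsto_sSup_norm_iteratedFDeriv (S : FlowSeq T s₀ σ L) (hF : LocBd hW s₀ F)
    {G : Type*} [NormedAddCommGroup G] [NormedSpace ℝ G] (J : N2 →ₗ[ℝ] G)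
    {K : Set P3} (hK : IsCompact K) (hKH : K ⊆ Hsp) (m : ℕ) {f : ℕ → P3 → G} {g : P3 → G}
    (hf : ∀ n, ∀ q ∈ Hsp, f n q - g q = J (F.1 (σ n, q) - flowLim σ F q)) :
    Tendsto (fun n => sSup ((fun p => ‖iteratedFDeriv ℝ m (fun q => f n q - g q) p‖) '' K))
      atTop (𝓝 0) := by
  set J' : N2 →L[ℝ] G := LinearMap.toContinuousLinearMap J with hJ
  refine Metric.tendsto_atTop'.2 fun ε hε => ?_
  have hδ : 0 < ε / 2 / (‖J'‖ + 1) := by positivity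
  obtain ⟨N, hN⟩ := eventually_atTop.1
    (S.eventually_norm_iteratedFDeriv_sub_le hF hK hKH m hδ)
  refine ⟨N, fun n hn => ?_⟩
  have hle : ∀ y ∈ (fun p => ‖iteratedFDeriv ℝ m (fun q => f n q - g q) p‖) '' K,
      y ≤ ε / 2 := by
    rintro _ ⟨p, hp, rfl⟩
    have he : (fun q => f n q - g q) =ᶠ[𝓝 p]
        J' ∘ fun q => F.1 (σ n, q) - flowLim σ F q := by
      filter_upwards [isOpen_Hsp.mem_nhds (hKH hp)] with q hq using hf n q hq
    change ‖iteratedFDeriv ℝ m (fun q => f n q - g q) p‖ ≤ _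
    rw [(he.iteratedFDeriv ℝ m).eq_of_nhds]
    refine (J'.norm_iteratedFDeriv_comp_left (S.contDiffAt_sub_flowLim hF (hKH hp) n)
      (by exact_mod_cast le_top)).trans ?_
    refine (mul_le_mul_of_nonneg_left (hN n hn.le p hp) (norm_nonneg _)).trans ?_
    rw [← mul_div_assoc, div_le_iff₀ (by positivity)]
    nlinarith [norm_nonneg J']
  rw [Real.dist_eq, sub_zero, abs_of_nonneg (Real.sSup_nonneg ?_)]
  · exact (Real.sSup_le hle (by positivity)).trans_lt (by linarith)
  · rintro _ ⟨p, -, rfl⟩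
    exact norm_nonneg _

end FlowSeq

end FlowLimitSmooth

section LimitData

/-- Pointwise convergence of functions and of their first derivatives. -/
def C1TendsTo (f : ℕ → P3 → M2) (g : P3 → M2) (p : P3) : Prop :=
  Tendsto (fun n => f n p) atTop (𝓝 (g p)) ∧
    ∀ v, Tendsto (fun n => pd v (f n) p) atTop (𝓝 (pd v g p))

lemma Filter.Tendsto.mcomm {f f' : ℕ → M2} {X X' : M2} (h : Tendsto f atTop (𝓝 X))
    (h' : Tendsto f' atTop (𝓝 X')) :
    Tendsto (fun n => mcomm (f n) (f' n)) atTop (𝓝 (mcomm X X')) :=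
  (h.mul h').sub (h'.mul h)

lemma C1TendsTo.cd {A f : ℕ → P3 → M2} {B g : P3 → M2} {p : P3} (hA : C1TendsTo A B p)
    (hf : C1TendsTo f g p) (v : P3) :
    Tendsto (fun n => cd (A n) v (f n) p) atTop (𝓝 (cd B v g p)) :=
  (hf.2 v).add (hA.1.mcomm hf.1)

section

variable {At A1 A2 a3 phi : ℕ → P3 → M2} {Bt B1 B2 b3 psi : P3 → M2} {p : P3}

lemma KW123At.of_tendsto (ht : C1TendsTo At Bt p) (h1 : C1TendsTo A1 B1 p)
    (h2 : C1TendsTo A2 B2 p) (h3 : C1TendsTo a3 b3 p) (hphi : C1TendsTo phi psi p)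
    (h : ∀ n, KW123At (At n) (A1 n) (A2 n) (a3 n) (phi n) p) : KW123At Bt B1 B2 b3 psi p := by
  refine ⟨?_, ?_, ?_, ?_⟩
  · refine tendsto_nhds_unique (((h1.2 et).sub (ht.2 ez1)).add (ht.1.mcomm h1.1))
      ((h2.cd h3 ez2).congr fun n => ?_)
    exact (h n).1.symm
  · refine tendsto_nhds_unique (((h2.2 et).sub (ht.2 ez2)).add (ht.1.mcomm h2.1))
      ((h1.cd h3 ez1).neg.congr fun n => ?_)
    exact (h n).2.1.symm
  · refine tendsto_nhds_unique ((h1.cd hphi ez1).add ((h2.cd hphi ez2).const_smul Complex.I))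
      (tendsto_const_nhds.congr fun n => ?_)
    exact (h n).2.2.1.symm
  · refine tendsto_nhds_unique (ht.cd hphi et) (((h3.1.mcomm hphi.1).const_smul Complex.I).congr
      fun n => ?_)
    exact (h n).2.2.2.symm

lemma C1TendsTo.XOf (ht : C1TendsTo At Bt p) (h1 : C1TendsTo A1 B1 p)
    (h2 : C1TendsTo A2 B2 p) (h3 : C1TendsTo a3 b3 p) (hphi : C1TendsTo phi psi p) :
    Tendsto (fun n => XOf (At n) (A1 n) (A2 n) (a3 n) (phi n) p) atTop
      (𝓝 (XOf Bt B1 B2 b3 psi p)) :=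
  ((ht.cd h3 et).sub (((h2.2 ez1).sub (h1.2 ez2)).add (h1.1.mcomm h2.1))).sub
    ((hphi.1.mcomm (hphi.1.star.neg)).const_smul _)

lemma C1TendsTo.isSU2 (h : C1TendsTo At Bt p) (hs : ∀ n, IsSU2 (At n p)) : IsSU2 (Bt p) :=
  ⟨tendsto_nhds_unique ((Continuous.tendsto (continuous_id.matrix_trace) _).comp h.1)
      (tendsto_const_nhds.congr fun n => (hs n).1.symm),
    tendsto_nhds_unique h.1.star (h.1.neg.congr fun n => (hs n).2.symm)⟩

lemma C1TendsTo.trace_eq_zero (h : C1TendsTo At Bt p) (hs : ∀ n, (At n p).trace = 0) :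
    (Bt p).trace = 0 :=
  tendsto_nhds_unique ((Continuous.tendsto (continuous_id.matrix_trace) _).comp h.1)
    (tendsto_const_nhds.congr fun n => (hs n).symm)

end

/-- Restriction of a data set to a smaller domain. -/
def DataSet.restrict {U V : Set P3} (D : DataSet U) (h : V ⊆ U) : DataSet V where
  At := D.At
  A1 := D.A1
  A2 := D.A2
  a3 := D.a3
  phi := D.phi
  smooth_At := D.smooth_At.mono h
  smooth_A1 := D.smooth_A1.mono h
  smooth_A2 := D.smooth_A2.mono h
  smooth_a3 := D.smooth_a3.mono h
  smooth_phi := D.smooth_phi.mono h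
  su2_At := fun p hp => D.su2_At p (h hp)
  su2_A1 := fun p hp => D.su2_A1 p (h hp)
  su2_A2 := fun p hp => D.su2_A2 p (h hp)
  su2_a3 := fun p hp => D.su2_a3 p (h hp)
  sl2_phi := fun p hp => D.sl2_phi p (h hp)

variable {T : ℝ≥0∞} {s₀ L : ℝ} {σ : ℕ → ℝ} {D : DataSet Hsp} {hW : GoodDom (flowW T)}

/-- The limit along the flow as a matrix-valued function. -/
def flowLimM (σ : ℕ → ℝ) (F : smoothAlg N2 (flowW T)) (p : P3) : M2 := toNL.symm (flowLim σ F p)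

namespace FlowSeq

variable {F : smoothAlg N2 (flowW T)} {f : ℕ → P3 → M2}

lemma contDiffOn_flowLimM (S : FlowSeq T s₀ σ L) (hF : LocBd hW s₀ F) :
    ContDiffOn ℝ (⊤:ℕ∞) (flowLimM σ F) Hsp :=
  contDiffOn_toN.1 (S.contDiffOn_flowLim hF)

lemma c1TendsTo (S : FlowSeq T s₀ σ L) (hF : LocBd hW s₀ F) (hf : ∀ n, IsSlice (σ n) F (f n))
    {p : P3} (hp : p ∈ Hsp) : C1TendsTo f (flowLimM σ F) p := by
  have hcont : ∀ {u : ℕ → N2} {x : N2}, Tendsto u atTop (𝓝 x) →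
      Tendsto (fun n => toNL.symm (u n)) atTop (𝓝 (toNL.symm x)) := fun h =>
    (toNL.symm.continuous.tendsto _).comp h
  refine ⟨(hcont (S.tendsto_flowLim hF hp)).congr fun n => hf n p hp, fun v => ?_⟩
  have hlim : pd v (flowLimM σ F) p = toNL.symm (fderiv ℝ (flowLim σ F) p v) :=
    (fderiv_toN (f := flowLimM σ F) (p := p) (v := v)).symm
  have hder : Tendsto (fun n => fderiv ℝ (fun q => F.1 (σ n, q)) p v) atTop
      (𝓝 (fderiv ℝ (flowLim σ F) p v)) := by
    have h : ∀ i, Tendsto (fun n => gradL i ((dxE hW (eb i) F).1 (σ n, p)) v) atTop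
        (𝓝 (gradL i (flowLim σ (dxE hW (eb i) F) p) v)) := fun i =>
      (S.tendsto_flowLim (hF.dxE i) hp).const_smul (coordL i v)
    simp only [S.fderiv_slice_eq hW F hp, (S.hasFDerivAt_flowLim hF hp).fderiv, _root_.sum_apply]
    exact tendsto_finsetSum _ fun i _ => h i
  rw [hlim]
  refine (hcont hder).congr fun n => ?_
  rw [fderiv_slice hW F (S.mem_flowDom n) hp]
  exact (hf n).pd hW (S.mem_flowDom n) v p hp

lemma cinftyTendsTo (S : FlowSeq T s₀ σ L) (hF : LocBd hW s₀ F)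
    (hf : ∀ n, IsSlice (σ n) F (f n)) {Ω : Set P3} (hΩ : Ω ⊆ Hsp) :
    CinftyTendsTo Ω f (flowLimM σ F) := fun K hK hKc m =>
  S.tendsto_sSup_norm_iteratedFDeriv hF (toNₗ.symm : N2 →ₗ[ℝ] M2) hKc (hK.trans hΩ) m
    fun n q hq => by
      rw [hf n q hq]
      rfl

end FlowSeq

lemma exists_flowSeq (hT : 0 < T) : ∃ s₀ ∈ flowInt T, ∃ σ L, FlowSeq T s₀ σ L ∧
    Tendsto (fun n => ENNReal.ofReal (σ n)) atTop (𝓝 T) ∧ (T = ⊤ → L = 0) ∧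
      (T ≠ ⊤ → L = Real.exp (-T.toReal)) := by
  obtain ⟨s₀, hs₀⟩ := flowInt_nonempty hT
  obtain ⟨u, hu, hmem, hlim⟩ := exists_seq_strictMono_tendsto' hs₀.2
  have hfin : ∀ n, u n ≠ ⊤ := fun n => (hmem n).2.ne_top
  have hof : ∀ n, ENNReal.ofReal (u n).toReal = u n := fun n => ENNReal.ofReal_toReal (hfin n)
  have key : ∀ L, Tendsto (fun n => Real.exp (-(u n).toReal)) atTop (𝓝 L) →
      FlowSeq T s₀ (fun n => (u n).toReal) L := fun L hL =>
    { pos := hs₀.1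
      mono := fun n m hnm => ENNReal.toReal_mono (hfin m) (hu.monotone hnm)
      mem := fun n => ⟨(ENNReal.ofReal_le_iff_le_toReal (hfin n)).1 (hmem n).1.le,
        (hof n).trans_lt (hmem n).2⟩
      tendsto_exp := hL }
  refine ⟨s₀, hs₀, fun n => (u n).toReal, ?_⟩
  by_cases hTt : T = ⊤
  · refine ⟨0, key 0 ?_, by simpa only [hof] using hlim, fun _ => rfl, fun h => absurd hTt h⟩
    refine Real.tendsto_exp_neg_atTop_nhds_zero.comp ?_
    refine ENNReal.tendsto_ofReal_nhds_top.1 ?_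
    simpa only [hof, ← hTt] using hlim
  · refine ⟨_, key _ ?_, by simpa only [hof] using hlim, fun h => absurd h hTt, fun _ => rfl⟩
    exact (Real.continuous_exp.tendsto _).comp (((ENNReal.tendsto_toReal hTt).comp hlim).neg)

/-- Along a sequence of times increasing to the end of the flow, the data sets converge. -/
theorem KWFlow.exists_limit (F : KWFlow D T) (hKW : KW123 Hsp D) (hX : XnormSqInt D < ⊤)
    (hT : 0 < T) (hs₀ : s₀ ∈ flowInt T) (S : FlowSeq T s₀ σ L) {Ω : Set P3} (hΩ : Ω ⊆ Hsp) :
    ∃ E : DataSet Ω, KW123 Ω E ∧ (∀ p ∈ Ω, mnorm (E.X p) = L * mnorm (D.X p)) ∧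
      CinftyTendsTo Ω (fun k => (F.Ds (σ k)).At) E.At ∧
      CinftyTendsTo Ω (fun k => (F.Ds (σ k)).A1) E.A1 ∧
      CinftyTendsTo Ω (fun k => (F.Ds (σ k)).A2) E.A2 ∧
      CinftyTendsTo Ω (fun k => (F.Ds (σ k)).phi) E.phi ∧
      CinftyTendsTo Ω (fun k => (F.Ds (σ k)).a3) E.a3 := by
  have hW := goodDom_flowW hT
  have hb := F.locBd_bE (hW := hW) hT hX hs₀
  have hc := F.locBd_cE (hW := hW) hT hX hs₀
  have bt : LocBd hW s₀ (F.AtE hW) := (hb.sub hb.star).smul _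
  have b3 : LocBd hW s₀ (F.a3E hW) := (hb.add hb.star).smul _
  have b1 : LocBd hW s₀ (F.A1E hW) := (hc.sub hc.star).smul _
  have b2 : LocBd hW s₀ (F.A2E hW) := (hc.add hc.star).smul _
  have bf : LocBd hW s₀ F.fE := F.locBd_fE hT hX hs₀
  have st n := F.AtE_isSlice hW (S.mem_flowDom n)
  have s3 n := F.a3E_isSlice hW (S.mem_flowDom n)
  have s1 n := F.A1E_isSlice hW (S.mem_flowDom n)
  have s2 n := F.A2E_isSlice hW (S.mem_flowDom n)
  have sf n := F.fE_isSlice (S.mem_flowDom n)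
  have ct {p} (hp : p ∈ Hsp) := S.c1TendsTo bt st hp
  have c3 {p} (hp : p ∈ Hsp) := S.c1TendsTo b3 s3 hp
  have c1 {p} (hp : p ∈ Hsp) := S.c1TendsTo b1 s1 hp
  have c2 {p} (hp : p ∈ Hsp) := S.c1TendsTo b2 s2 hp
  have cf {p} (hp : p ∈ Hsp) := S.c1TendsTo bf sf hp
  let E : DataSet Hsp :=
    { At := flowLimM σ (F.AtE hW)
      A1 := flowLimM σ (F.A1E hW)
      A2 := flowLimM σ (F.A2E hW)
      a3 := flowLimM σ (F.a3E hW)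
      phi := flowLimM σ F.fE
      smooth_At := S.contDiffOn_flowLimM bt
      smooth_A1 := S.contDiffOn_flowLimM b1
      smooth_A2 := S.contDiffOn_flowLimM b2
      smooth_a3 := S.contDiffOn_flowLimM b3
      smooth_phi := S.contDiffOn_flowLimM bf
      su2_At := fun p hp => (ct hp).isSU2 fun n => (F.Ds (σ n)).su2_At p hp
      su2_A1 := fun p hp => (c1 hp).isSU2 fun n => (F.Ds (σ n)).su2_A1 p hp
      su2_A2 := fun p hp => (c2 hp).isSU2 fun n => (F.Ds (σ n)).su2_A2 p hp
      su2_a3 := fun p hp => (c3 hp).isSU2 fun n => (F.Ds (σ n)).su2_a3 p hp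
      sl2_phi := fun p hp => (cf hp).trace_eq_zero fun n => (F.Ds (σ n)).sl2_phi p hp }
  refine ⟨E.restrict hΩ, fun p hp => ?_, fun p hp => ?_, S.cinftyTendsTo bt st hΩ,
    S.cinftyTendsTo b1 s1 hΩ, S.cinftyTendsTo b2 s2 hΩ, S.cinftyTendsTo bf sf hΩ,
    S.cinftyTendsTo b3 s3 hΩ⟩
  · have hp' := hΩ hp
    exact KW123At.of_tendsto (ct hp') (c1 hp') (c2 hp') (c3 hp') (cf hp') fun n =>
      F.kw123_Ds hKW hW (S.mem_flowDom n) p hp'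
  · have hp' := hΩ hp
    have h := (ct hp').XOf (c1 hp') (c2 hp') (c3 hp') (cf hp')
    refine tendsto_nhds_unique ((continuous_mnorm.tendsto _).comp h)
      ((S.tendsto_exp.mul_const _).congr fun n => ?_)
    change _ = mnorm ((F.Ds (σ n)).X p)
    rw [F.Ds_X hT (S.mem_flowDom n) hp', mnorm_smul, abs_of_pos (Real.exp_pos _)]

lemma gAct_one (v : P3) (A : P3 → M2) : gAct (fun _ => 1) v A = A := by
  funext p
  simp [gAct, pd]

end LimitData

/-- Proposition 5.3 of the paper: on any open `Ω` with compact closure in `H` there is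
a sequence `s_k → T` and gauge transformations `h_k` so that the gauge-transformed
data sets converge in `C^∞(Ω)` to a data set obeying KW (i)-(iii) with
`|𝔛| = e^{-T}|𝔛◊|` pointwise. -/
theorem statement4 (D : DataSet Hsp) (hKW : KW123 Hsp D) (hX : XnormSqInt D < ⊤)
    (T : ℝ≥0∞) (hT : 0 < T) (F : KWFlow D T)
    (Ω : Set P3) (hΩo : IsOpen Ω) (hΩc : IsCompact (closure Ω)) (hΩH : closure Ω ⊆ Hsp) :
    ∃ sk : ℕ → ℝ, (∀ k, sk k ∈ flowDom T) ∧
      Filter.Tendsto (fun k => ENNReal.ofReal (sk k)) Filter.atTop (nhds T) ∧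
      ∃ hk : ℕ → P3 → M2, (∀ k, SU2Map (hk k) Ω) ∧
      ∃ E : DataSet Ω,
        KW123 Ω E ∧
        (∀ p ∈ Ω, (T = ⊤ → mnorm (E.X p) = 0) ∧
          (T ≠ ⊤ → mnorm (E.X p) = Real.exp (-(T.toReal)) * mnorm (D.X p))) ∧
        CinftyTendsTo Ω (fun k => gAct (hk k) et (F.Ds (sk k)).At) E.At ∧
        CinftyTendsTo Ω (fun k => gAct (hk k) ez1 (F.Ds (sk k)).A1) E.A1 ∧
        CinftyTendsTo Ω (fun k => gAct (hk k) ez2 (F.Ds (sk k)).A2) E.A2 ∧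
        CinftyTendsTo Ω (fun k => fun p => hk k p * (F.Ds (sk k)).phi p * (hk k p)⁻¹) E.phi ∧
        CinftyTendsTo Ω (fun k => fun p => hk k p * (F.Ds (sk k)).a3 p * (hk k p)⁻¹) E.a3 := by
  obtain ⟨s₀, hs₀, σ, L, S, hσ, hL0, hL⟩ := exists_flowSeq hT
  obtain ⟨E, hE, hEX, ht, h1, h2, hphi, h3⟩ :=
    F.exists_limit hKW hX hT hs₀ S (subset_closure.trans hΩH)
  refine ⟨σ, S.mem_flowDom, hσ, fun _ _ => 1, fun _ => ⟨contDiffOn_const, fun p _ => by simp⟩, E,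
    hE, fun p hp => ⟨fun h => by rw [hEX p hp, hL0 h, zero_mul],
      fun h => by rw [hEX p hp, hL h]⟩, ?_⟩
  simp only [gAct_one, inv_one, one_mul, mul_one]
  exact ⟨ht, h1, h2, hphi, h3⟩

end
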